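/- Let t ≥ 1 be an integer and let G be a 3-connected 3t-regular finite simple graph. Let 𝒪 be a set of pairwise edge-disjoint cycles of G, each of length at least 3. Then there exists a t-factor F of G such that, for every O ∈ 𝒪, the edge set E(F) ∩ E(O) is a non-empty matching of G. -/

import Mathlib

open SimpleGraph

namespace PaperFormalization

variable {V : Type*}

/-- The degree of a vertex in a subgraph. -/
noncomputable def sdeg {G : SimpleGraph V} (H : G.Subgraph) (v : V) : ℕ :=
  (H.neighborSet v).ncard

/-- `H` is a `t`-factor of `G`: a spanning subgraph in which every vertex has degree `t`. -/
def IsTFactor {G : SimpleGraph V} (H : G.Subgraph) (t : ℕ) : Prop :=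
  H.IsSpanning ∧ ∀ v : V, sdeg H v = t

/-- A cycle of `G`: a connected 2-regular subgraph. -/
def IsCycleSG {G : SimpleGraph V} (C : G.Subgraph) : Prop :=
  C.Connected ∧ ∀ v ∈ C.verts, sdeg C v = 2

/-- An odd cycle: a cycle with an odd number of edges. -/
def IsOddCycleSG {G : SimpleGraph V} (C : G.Subgraph) : Prop :=
  IsCycleSG C ∧ Odd C.edgeSet.ncard

/-- A family of subgraphs is pairwise edge-disjoint. -/
def PairwiseEdgeDisjoint {G : SimpleGraph V} (𝒪 : Set G.Subgraph) : Prop :=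
  𝒪.Pairwise fun O₁ O₂ => Disjoint O₁.edgeSet O₂.edgeSet

/-- A family of subgraphs is pairwise vertex-disjoint. -/
def PairwiseVertexDisjoint {G : SimpleGraph V} (𝒪 : Set G.Subgraph) : Prop :=
  𝒪.Pairwise fun O₁ O₂ => Disjoint O₁.verts O₂.verts

/-- `G` is `r`-regular. -/
def IsRegular (G : SimpleGraph V) (r : ℕ) : Prop :=
  ∀ v : V, (G.neighborSet v).ncard = r

/-- `G` is 2-connected: connected, at least 3 vertices, and no cut vertex. -/
def TwoConnected [Fintype V] (G : SimpleGraph V) : Prop :=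
  G.Connected ∧ 3 ≤ Fintype.card V ∧ ∀ v : V, (G.induce {u | u ≠ v}).Connected

/-- `G` is `r`-connected: more than `r` vertices and deleting fewer than `r`
vertices leaves it connected. -/
def KConnected [Fintype V] (r : ℕ) (G : SimpleGraph V) : Prop :=
  r < Fintype.card V ∧ ∀ S : Set V, S.ncard < r → (G.induce Sᶜ).Connected

/-- A set of edges is a matching: pairwise non-adjacent edges. -/
def IsMatchingSet (M : Set (Sym2 V)) : Prop :=
  M.Pairwise fun e f => ∀ v : V, v ∈ e → v ∉ f

section Multigraph

open Finset
open scoped Classical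

variable {V E ι : Type*}

/-- In the multigraph in which the edge `e` has ends `p e` and `q e`, the edge `e` is a
non-loop incident with `v`. -/
def Inc (p q : E → V) (v : V) (e : E) : Prop := ¬(p e = v ↔ q e = v)

/-- The edges with exactly one end in `Z`. -/
noncomputable def cut [Fintype E] (p q : E → V) (Z : Finset V) : Finset E :=
  univ.filter fun e => ¬(p e ∈ Z ↔ q e ∈ Z)

/-- The non-loop edges with both ends in `Z`. -/
noncomputable def inner [Fintype E] (p q : E → V) (Z : Finset V) : Finset E :=
  univ.filter fun e => p e ≠ q e ∧ p e ∈ Z ∧ q e ∈ Z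

/-- The multigraph `(p, q)` is cubic and 3-edge-connected on the vertex set `S`, and at every
vertex each label of the partial edge labelling `L` occurs zero times or twice. -/
structure CubicOn [Fintype E] (p q : E → V) (S : Finset V) (L : E → Option ι) : Prop where
  ends : ∀ e, p e ∈ S ∧ q e ∈ S
  star : ∀ v ∈ S, ∃ a b c, a ≠ b ∧ a ≠ c ∧ b ≠ c ∧
    (∀ e, Inc p q v e ↔ e = a ∨ e = b ∨ e = c) ∧ L a = L b ∧ L c = none
  conn : ∀ Z ⊆ S, Z.Nonempty → Z ≠ S → 3 ≤ (cut p q Z).card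

/-- `F` meets the star of every vertex of `S` exactly once. -/
def PMOn (p q : E → V) (S : Finset V) (F : E → Prop) : Prop :=
  ∀ v ∈ S, ∃! e, Inc p q v e ∧ F e

/-- Every label occurring on a non-loop occurs on a non-loop of `F`. -/
def Hits (p q : E → V) (L : E → Option ι) (F : E → Prop) : Prop :=
  ∀ e i, p e ≠ q e → L e = some i → ∃ f, p f ≠ q f ∧ F f ∧ L f = some i

/-- For every multigraph on fewer than `n` vertices, all labels can be hit by a perfect matching
through a prescribed edge at an unlabelled vertex. -/
def SolvableBelow (V E ι : Type*) [Fintype E] (n : ℕ) : Prop :=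
  ∀ (p q : E → V) (S : Finset V) (L : E → Option ι), S.card < n → CubicOn p q S L →
    ∀ u ∈ S, (∀ e, Inc p q u e → L e = none) → ∀ e, Inc p q u e →
      ∃ F : E → Prop, PMOn p q S F ∧ Hits p q L F ∧ F e

variable [Fintype E] {p q : E → V} {S Z : Finset V} {L : E → Option ι}

lemma mem_cut {e : E} : e ∈ cut p q Z ↔ ¬(p e ∈ Z ↔ q e ∈ Z) := by simp [cut]

lemma mem_inner {e : E} : e ∈ inner p q Z ↔ p e ≠ q e ∧ p e ∈ Z ∧ q e ∈ Z := by simp [inner]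

omit [Fintype E] in
lemma Inc.ne {v : V} {e : E} (h : Inc p q v e) : p e ≠ q e := by
  intro h'; simp [Inc, h'] at h

lemma sum_card_inc (p q : E → V) (Z : Finset V) (P : E → Prop) [DecidablePred P] :
    ∑ v ∈ Z, (univ.filter fun e => Inc p q v e ∧ P e).card =
      ((cut p q Z).filter P).card + 2 * ((inner p q Z).filter P).card := by
  have h1 : ∀ v, (univ.filter fun e => Inc p q v e ∧ P e).card =
      ∑ e : E, if Inc p q v e ∧ P e then 1 else 0 := fun v => by rw [card_filter]
  simp_rw [h1]
  rw [sum_comm, cut, inner, filter_filter, filter_filter, card_filter, card_filter, mul_sum,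
    ← sum_add_distrib]
  refine sum_congr rfl fun e _ => ?_
  by_cases hP : P e
  · have hs : ∀ x : V, (∑ v ∈ Z, if x = v then 1 else 0) = if x ∈ Z then 1 else 0 := by
      intro x; simp
    by_cases hpq : p e = q e
    · simp [Inc, hP, hpq]
    · have : ∀ v, (if Inc p q v e ∧ P e then 1 else 0) =
          (if p e = v then 1 else 0) + (if q e = v then 1 else 0) := by
        intro v
        by_cases h1 : p e = v <;> by_cases h2 : q e = v <;> simp [Inc, hP, h1, h2]
        exact hpq (h1.trans h2.symm)
      simp_rw [this, sum_add_distrib, hs]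
      by_cases h1 : p e ∈ Z <;> by_cases h2 : q e ∈ Z <;> simp [h1, h2, hP, hpq]
  · simp [hP]

namespace CubicOn

lemma exists_star (h : CubicOn p q S L) {v : V} (hv : v ∈ S) {m : E} (hm : Inc p q v m) :
    ∃ a b, m ≠ a ∧ m ≠ b ∧ a ≠ b ∧ (∀ e, Inc p q v e ↔ e = m ∨ e = a ∨ e = b) := by
  obtain ⟨a, b, c, hab, hac, hbc, hs, -⟩ := h.star v hv
  rcases (hs m).1 hm with rfl | rfl | rfl
  · exact ⟨b, c, hab, hac, hbc, hs⟩
  · exact ⟨a, c, hab.symm, hbc, hac, fun e => by rw [hs]; tauto⟩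
  · exact ⟨a, b, hac.symm, hbc.symm, hab, fun e => by rw [hs]; tauto⟩

lemma card_star (h : CubicOn p q S L) {v : V} (hv : v ∈ S) :
    (univ.filter fun e => Inc p q v e).card = 3 := by
  obtain ⟨a, b, c, hab, hac, hbc, hs, -⟩ := h.star v hv
  rw [card_eq_three]
  exact ⟨a, b, c, hab, hac, hbc, by ext e; simp [hs]⟩

lemma card_cut (h : CubicOn p q S L) (hZ : Z ⊆ S) :
    3 * Z.card = (cut p q Z).card + 2 * (inner p q Z).card := by
  have := sum_card_inc p q Z (fun _ => True)
  simp only [and_true, filter_true] at this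
  rw [← this, sum_congr rfl fun v hv => h.card_star (hZ hv)]
  simp [mul_comm]

lemma even_cut (h : CubicOn p q S L) (hZ : Z ⊆ S) (i : ι) :
    Even ((cut p q Z).filter fun e => L e = some i).card := by
  have h1 := sum_card_inc p q Z (fun e => L e = some i)
  have h2 : Even (∑ v ∈ Z, (univ.filter fun e => Inc p q v e ∧ L e = some i).card) := by
    refine Finset.even_sum _ fun v hv => ?_
    obtain ⟨a, b, c, hab, hac, hbc, hs, hl, hc⟩ := h.star v (hZ hv)
    by_cases ha : L a = some i
    · have : (univ.filter fun e => Inc p q v e ∧ L e = some i) = {a, b} := by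
        ext e; simp only [mem_filter, mem_univ, true_and, hs, mem_insert, mem_singleton]
        constructor
        · rintro ⟨rfl | rfl | rfl, h⟩
          · exact .inl rfl
          · exact .inr rfl
          · simp [hc] at h
        · rintro (rfl | rfl)
          · exact ⟨.inl rfl, ha⟩
          · exact ⟨.inr (.inl rfl), hl ▸ ha⟩
      rw [this, card_pair hab]; exact even_two
    · have : (univ.filter fun e => Inc p q v e ∧ L e = some i) = ∅ := by
        ext e; simp only [mem_filter, mem_univ, true_and, hs, notMem_empty, iff_false]
        rintro ⟨rfl | rfl | rfl, h⟩ <;> simp_all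
      rw [this]; simp
  rw [h1] at h2
  exact (Nat.even_add.1 h2).2 (even_two_mul _)

lemma mapLabels {κ : Type*} (h : CubicOn p q S L) (g : Option ι → Option κ) (hg : g none = none) :
    CubicOn p q S (fun e => g (L e)) where
  ends := h.ends
  conn := h.conn
  star v hv := by
    obtain ⟨a, b, c, hab, hac, hbc, hs, hl, hc⟩ := h.star v hv
    exact ⟨a, b, c, hab, hac, hbc, hs, by rw [hl], by rw [hc, hg]⟩

end CubicOn

lemma cut_sdiff (h : ∀ e, p e ∈ S ∧ q e ∈ S) : cut p q (S \ Z) = cut p q Z := by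
  ext e; simp only [mem_cut, mem_sdiff, (h e).1, (h e).2, true_and]; tauto

omit [Fintype E] in
/-- Three labels each occurring an even number of times: two agree and the third is absent. -/
lemma exists_star_of_even {C : Finset E} (hC : C.card = 3)
    (hL : ∀ i, Even (C.filter fun e => L e = some i).card) :
    ∃ a b c, a ≠ b ∧ a ≠ c ∧ b ≠ c ∧ (∀ e, e ∈ C ↔ e = a ∨ e = b ∨ e = c) ∧
      L a = L b ∧ L c = none := by
  obtain ⟨x, y, z, hxy, hxz, hyz, rfl⟩ := card_eq_three.1 hC
  have key : ∀ i, Even ((if L x = some i then 1 else 0) + ((if L y = some i then 1 else 0) +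
      (if L z = some i then 1 else 0))) := by
    intro i
    have := hL i
    rwa [card_filter, sum_insert (by simp [hxy, hxz]), sum_insert (by simp [hyz]),
      sum_singleton] at this
  rcases hx : L x with _ | i
  · refine ⟨y, z, x, hyz, hxy.symm, hxz.symm, fun e => by simp; tauto, ?_, hx⟩
    rcases hy : L y with _ | j
    · rcases hz : L z with _ | k
      · rfl
      · have := key k; simp [hx, hy, hz] at this
    · have := key j; simp only [hx, hy] at this
      rcases hz : L z with _ | k
      · simp [hz] at this
      · by_contra hne
        simp [hz] at this; split_ifs at this with h <;> simp_all
  · have := key i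
    simp only [hx, if_true] at this
    by_cases hy : L y = some i
    · refine ⟨x, y, z, hxy, hxz, hyz, fun e => by simp, by rw [hx, hy], ?_⟩
      rcases hz : L z with _ | k
      · rfl
      · have h2 := key k
        simp only [hx, hy, hz] at h2 this
        by_cases hik : i = k
        · subst hik; simp at this; exact absurd this (by decide)
        · simp [hik] at h2
    · have hz : L z = some i := by
        by_contra hz; simp [hy, hz] at this
      refine ⟨x, z, y, hxz, hxy, hyz.symm, fun e => by simp; tauto, by rw [hx, hz], ?_⟩
      rcases hy' : L y with _ | k
      · rfl
      · have h2 := key k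
        simp only [hx, hy', hz] at h2
        have hik : i ≠ k := by rintro rfl; exact hy hy'
        simp [hik] at h2

end Multigraph

section ThreeCuts

open Finset
open scoped Classical

variable {V E ι : Type*} [Fintype E] {p q : E → V} {S Z : Finset V} {L : E → Option ι}

omit [Fintype E] in
lemma PMOn.congr {F F' : E → Prop} (h : PMOn p q S F)
    (hF : ∀ v ∈ S, ∀ e, Inc p q v e → (F' e ↔ F e)) : PMOn p q S F' := by
  intro v hv
  obtain ⟨e, ⟨he, hFe⟩, huniq⟩ := h v hv
  exact ⟨e, ⟨he, (hF v hv e he).2 hFe⟩, fun f hf => huniq f ⟨hf.1, (hF v hv f hf.1).1 hf.2⟩⟩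

omit [Fintype E] in
lemma Inc.mem {v : V} {e : E} (h : Inc p q v e) (hv : v ∈ Z) : p e ∈ Z ∨ q e ∈ Z := by
  by_cases h1 : p e = v
  · exact .inl (h1 ▸ hv)
  · by_cases h2 : q e = v
    · exact .inr (h2 ▸ hv)
    · simp [Inc, h1, h2] at h

lemma exists_glue {FZ FY : E → Prop}
    (hZ : PMOn p q Z FZ) (hY : PMOn p q (S \ Z) FY) (hc : ∀ e ∈ cut p q Z, FZ e ↔ FY e) :
    ∃ F : E → Prop, PMOn p q S F ∧ (∀ e, (p e ∈ Z ∨ q e ∈ Z) → (F e ↔ FZ e)) ∧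
      ∀ e, (p e ∈ S \ Z ∨ q e ∈ S \ Z) → (F e ↔ FY e) := by
  have h1 : ∀ e, (p e ∈ Z ∨ q e ∈ Z) →
      ((if p e ∈ Z ∨ q e ∈ Z then FZ e else FY e) ↔ FZ e) := fun e he => by rw [if_pos he]
  have h2 : ∀ e, (p e ∈ S \ Z ∨ q e ∈ S \ Z) →
      ((if p e ∈ Z ∨ q e ∈ Z then FZ e else FY e) ↔ FY e) := by
    intro e he
    split_ifs with h
    · refine hc e ?_
      simp only [mem_cut, mem_sdiff] at he ⊢; tauto
    · rfl
  refine ⟨fun e => if p e ∈ Z ∨ q e ∈ Z then FZ e else FY e, fun v hv => ?_, h1, h2⟩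
  by_cases hvZ : v ∈ Z
  · exact hZ.congr (fun w hw e he => h1 e (he.mem hw)) v hvZ
  · exact hY.congr (fun w hw e he => h2 e (he.mem hw)) v (mem_sdiff.2 ⟨hv, hvZ⟩)

/-- The end map contracting everything outside `Y` to `z`. -/
noncomputable def contract (p : E → V) (Y : Finset V) (z : V) (e : E) : V :=
  if p e ∈ Y then p e else z

omit [Fintype E] in
lemma inc_contract {Y : Finset V} {z v : V} (hz : z ∉ Y) (hv : v ∈ Y) (e : E) :
    Inc (contract p Y z) (contract q Y z) v e ↔ Inc p q v e := by
  have h : z ≠ v := by rintro rfl; exact hz hv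
  have h' : ∀ p : E → V, contract p Y z e = v ↔ p e = v := by
    intro p; unfold contract; split_ifs with h1
    · rfl
    · simp only [h, false_iff]; rintro rfl; exact h1 hv
  unfold Inc; rw [h', h']

lemma inc_contract_self {Y : Finset V} {z : V} (hz : z ∉ Y) (e : E) :
    Inc (contract p Y z) (contract q Y z) z e ↔ e ∈ cut p q Y := by
  have h' : ∀ p : E → V, contract p Y z e = z ↔ p e ∉ Y := by
    intro p; unfold contract; split_ifs with h1
    · simp only [h1, not_true, iff_false]; rintro h; exact hz (h ▸ h1)
    · simp [h1]
  unfold Inc; rw [h', h', mem_cut]; tauto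

omit [Fintype E] in
lemma ne_contract {Y : Finset V} {z : V} (hz : z ∉ Y) (e : E) :
    contract p Y z e ≠ contract q Y z e ↔ p e ≠ q e ∧ (p e ∈ Y ∨ q e ∈ Y) := by
  unfold contract
  split_ifs with h1 h2 h2
  · tauto
  · simp only [h1, true_or, and_true]
    exact ⟨fun _ h => h2 (h ▸ h1), fun _ h => hz (h ▸ h1)⟩
  · simp only [h2, or_true, and_true]
    exact ⟨fun _ h => h1 (h ▸ h2), fun _ h => hz (h ▸ h2)⟩
  · simp [h1, h2]

lemma CubicOn.contract (h : CubicOn p q S L) {Y : Finset V} (hY : Y ⊆ S) {z : V} (hzS : z ∈ S)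
    (hz : z ∉ Y) (hc : (cut p q Y).card = 3) :
    CubicOn (contract p Y z) (contract q Y z) (insert z Y) L where
  ends e := by
    unfold PaperFormalization.contract
    constructor <;> split_ifs with h1 <;> simp [h1]
  star v hv := by
    rcases mem_insert.1 hv with rfl | hv
    · obtain ⟨a, b, c, h1, h2, h3, h4, h5⟩ := exists_star_of_even hc (h.even_cut hY)
      exact ⟨a, b, c, h1, h2, h3, fun e => by rw [inc_contract_self hz, h4], h5⟩
    · obtain ⟨a, b, c, h1, h2, h3, h4, h5⟩ := h.star v (hY hv)
      exact ⟨a, b, c, h1, h2, h3, fun e => by rw [inc_contract hz hv, h4], h5⟩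
  conn Q hQ hQne hQS := by
    have key : cut (PaperFormalization.contract p Y z) (PaperFormalization.contract q Y z) Q =
        cut p q (S.filter fun v => (if v ∈ Y then v else z) ∈ Q) := by
      ext e; simp [mem_cut, PaperFormalization.contract, h.ends e]
    rw [key]
    refine h.conn _ (filter_subset _ _) ?_ ?_
    · obtain ⟨v, hv⟩ := hQne
      rcases mem_insert.1 (hQ hv) with rfl | hvY
      · exact ⟨v, by simp [hzS, hz, hv]⟩
      · exact ⟨v, by simp [hY hvY, hvY, hv]⟩
    · intro heq
      refine hQS (Subset.antisymm hQ fun v hv => ?_)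
      have hvS : v ∈ S := by
        rcases mem_insert.1 hv with rfl | hvY
        exacts [hzS, hY hvY]
      rw [← heq, mem_filter] at hvS
      rcases mem_insert.1 hv with rfl | hvY
      · simpa [hz] using hvS.2
      · simpa [hvY] using hvS.2

/-- Reduction of nontrivial 3-edge-cuts. -/
lemma CubicOn.solve_three_cut (h : CubicOn p q S L) (IH : SolvableBelow V E ι S.card)
    (hZ : Z ⊆ S) {u : V} (hu : u ∈ Z) (huL : ∀ e, Inc p q u e → L e = none) {e : E}
    (he : Inc p q u e) (h2 : 2 ≤ Z.card) (h2' : 2 ≤ (S \ Z).card) (hc : (cut p q Z).card = 3) :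
    ∃ F : E → Prop, PMOn p q S F ∧ Hits p q L F ∧ F e := by
  have hsum : (S \ Z).card + Z.card = S.card := card_sdiff_add_card_eq_card hZ
  obtain ⟨y, hy⟩ : (S \ Z).Nonempty := card_pos.1 (by omega)
  obtain ⟨hyS, hyZ⟩ := mem_sdiff.1 hy
  have huS := hZ hu
  have huY : u ∉ S \ Z := by simp [hu]
  obtain ⟨F₁, hF₁, hH₁, he₁⟩ := IH _ _ (insert y Z) L
    (by rw [card_insert_of_notMem hyZ]; omega) (h.contract hZ hyS hyZ hc) u
    (mem_insert_of_mem hu) (fun e he => huL e ((inc_contract hyZ hu e).1 he)) e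
    ((inc_contract hyZ hu e).2 he)
  obtain ⟨c, ⟨hcc, hcF⟩, hcu⟩ := hF₁ y (mem_insert_self _ _)
  rw [inc_contract_self hyZ] at hcc
  set g : Option ι → Option ι := fun o => if ∃ f ∈ cut p q Z, L f = o then none else o with hg
  have hg0 : g none = none := by simp [hg]
  have hcY : cut p q (S \ Z) = cut p q Z := cut_sdiff h.ends
  have hgc : ∀ f ∈ cut p q Z, g (L f) = none := fun f hf => if_pos ⟨f, hf, rfl⟩
  obtain ⟨F₂, hF₂, hH₂, he₂⟩ := IH _ _ (insert u (S \ Z)) (fun e => g (L e))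
    (by rw [card_insert_of_notMem huY]; omega)
    ((h.mapLabels g hg0).contract sdiff_subset huS huY (by rw [hcY, hc])) u
    (mem_insert_self _ _) (fun f hf => hgc f (by rwa [inc_contract_self huY, hcY] at hf)) c
    (by rwa [inc_contract_self huY, hcY])
  obtain ⟨F, hF, hFZ, hFY⟩ := exists_glue (FZ := F₁) (FY := F₂)
    (fun v hv => by
      simpa only [inc_contract hyZ hv] using hF₁ v (mem_insert_of_mem hv))
    (fun v hv => by
      simpa only [inc_contract huY hv] using hF₂ v (mem_insert_of_mem hv))
    (fun f hf => by
      obtain ⟨c', -, hcu'⟩ := hF₂ u (mem_insert_self _ _)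
      simp only [inc_contract_self huY, inc_contract_self hyZ, hcY] at hcu hcu'
      have hcc' := hcu' c ⟨hcc, he₂⟩
      constructor
      · intro hf1; rw [hcu f ⟨hf, hf1⟩]; exact he₂
      · intro hf2; rw [hcu' f ⟨hf, hf2⟩, ← hcc']; exact hcF)
  refine ⟨F, hF, fun f i hf hi => ?_, (hFZ e (he.mem hu)).2 he₁⟩
  have hit₁ : ∀ f, p f ≠ q f → (p f ∈ Z ∨ q f ∈ Z) → L f = some i →
      ∃ f, p f ≠ q f ∧ F f ∧ L f = some i := by
    intro f hf hfZ hi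
    obtain ⟨k, hk, hkF, hki⟩ := hH₁ f i ((ne_contract hyZ f).2 ⟨hf, hfZ⟩) hi
    obtain ⟨hk1, hk2⟩ := (ne_contract hyZ k).1 hk
    exact ⟨k, hk1, (hFZ k hk2).2 hkF, hki⟩
  by_cases hcr : ∃ f ∈ cut p q Z, L f = some i
  · obtain ⟨k, hk, hki⟩ := hcr
    rw [mem_cut] at hk
    exact hit₁ k (fun h => hk (by rw [h])) (by tauto) hki
  by_cases hfZ : p f ∈ Z ∨ q f ∈ Z
  · exact hit₁ f hf hfZ hi
  · have hfY : p f ∈ S \ Z ∨ q f ∈ S \ Z := by simp [h.ends f]; tauto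
    have hgi : g (L f) = some i := by rw [hi]; exact if_neg hcr
    obtain ⟨k, hk, hkF, hki⟩ := hH₂ f i ((ne_contract huY f).2 ⟨hf, hfY⟩) hgi
    obtain ⟨hk1, hk2⟩ := (ne_contract huY k).1 hk
    refine ⟨k, hk1, (hFY k hk2).2 hkF, ?_⟩
    simp only [hg] at hki
    split_ifs at hki
    exact hki

end ThreeCuts

section Closings

open Finset
open scoped Classical

variable {V E ι : Type*} [Fintype E] {p q : E → V} {S Z Y : Finset V} {L : E → Option ι}

/-- End map of a closing: ends outside `Y` move to `a` for edges in `A`, and to `b` otherwise. -/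
noncomputable def closeEnd (p : E → V) (Y : Finset V) (A : E → Prop) (a b : V) (e : E) : V :=
  if p e ∈ Y then p e else if A e then a else b

/-- One of the two closings of the side `Y` of the 4-edge-cut `{x, y, z, w}`: the ends of `x, y`
outside `Y` are moved to `a`, those of `z, w` are moved to `b`, and `d` joins `a` to `b`. -/
structure IsClosing [Fintype E] (p q : E → V) (S Y : Finset V) (a b : V) (d x y z w : E) : Prop where
  sub : Y ⊆ S
  ha : a ∈ S \ Y
  hb : b ∈ S \ Y
  hab : a ≠ b
  hd : p d ∉ Y ∧ q d ∉ Y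
  nodup : [x, y, z, w].Nodup
  legs : ∀ e, e ∈ cut p q Y ↔ e = x ∨ e = y ∨ e = z ∨ e = w

/-- Exactly one of three propositions holds. -/
def ExactlyOne (P Q R : Prop) : Prop := (P ∧ ¬Q ∧ ¬R) ∨ (¬P ∧ Q ∧ ¬R) ∨ (¬P ∧ ¬Q ∧ R)

omit [Fintype E] in
lemma exactlyOne_of_existsUnique {v : V} {a b c : E} {F : E → Prop} (hab : a ≠ b) (hac : a ≠ c)
    (hbc : b ≠ c) (hs : ∀ e, Inc p q v e ↔ e = a ∨ e = b ∨ e = c) :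
    (∃! e, Inc p q v e ∧ F e) ↔ ExactlyOne (F a) (F b) (F c) := by
  unfold ExactlyOne
  constructor
  · rintro ⟨e, ⟨he, hF⟩, hu⟩
    have ha := fun hF => hu a ⟨(hs a).2 (by simp), hF⟩
    have hb := fun hF => hu b ⟨(hs b).2 (by simp), hF⟩
    have hc := fun hF => hu c ⟨(hs c).2 (by simp), hF⟩
    rcases (hs e).1 he with rfl | rfl | rfl
    · exact .inl ⟨hF, fun h => hab (hb h).symm, fun h => hac (hc h).symm⟩
    · exact .inr (.inl ⟨fun h => hab (ha h), hF, fun h => hbc (hc h).symm⟩)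
    · exact .inr (.inr ⟨fun h => hac (ha h), fun h => hbc (hb h), hF⟩)
  · simp only [ExistsUnique, hs]
    rintro (⟨h1, h2, h3⟩ | ⟨h1, h2, h3⟩ | ⟨h1, h2, h3⟩)
    · exact ⟨a, ⟨by simp, h1⟩, by rintro f ⟨rfl | rfl | rfl, h⟩ <;> tauto⟩
    · exact ⟨b, ⟨by simp, h2⟩, by rintro f ⟨rfl | rfl | rfl, h⟩ <;> tauto⟩
    · exact ⟨c, ⟨by simp, h3⟩, by rintro f ⟨rfl | rfl | rfl, h⟩ <;> tauto⟩

omit [Fintype E] in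
lemma card_split_legs {x y z w : E} (hn : [x, y, z, w].Nodup) (T : Finset E) :
    T.card = (T.filter fun e => ¬(e = x ∨ e = y ∨ e = z ∨ e = w)).card +
      ((if x ∈ T then 1 else 0) + (if y ∈ T then 1 else 0) + (if z ∈ T then 1 else 0) +
        (if w ∈ T then 1 else 0)) := by
  rw [← card_filter_add_card_filter_not (s := T) (fun e => ¬(e = x ∨ e = y ∨ e = z ∨ e = w))]
  congr 1
  have : T.filter (fun e => ¬¬(e = x ∨ e = y ∨ e = z ∨ e = w)) =
      ({x, y, z, w} : Finset E).filter (· ∈ T) := by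
    ext e; simp; tauto
  simp only [List.nodup_cons, List.mem_cons, List.not_mem_nil, not_or, or_false] at hn
  rw [this, card_filter, sum_insert (by simp; tauto), sum_insert (by simp; tauto),
    sum_insert (by simp; tauto), sum_singleton]
  omega

namespace IsClosing

variable {a b : V} {d x y z w : E}

/-- First end map of the closing. -/
noncomputable abbrev fst (_ : IsClosing p q S Y a b d x y z w) : E → V :=
  closeEnd p Y (fun e => e = d ∨ e = x ∨ e = y) a b

/-- Second end map of the closing. -/
noncomputable abbrev snd (_ : IsClosing p q S Y a b d x y z w) : E → V :=
  closeEnd q Y (fun e => e = x ∨ e = y) a b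

variable (c : IsClosing p q S Y a b d x y z w)

include c

lemma notMem_a : a ∉ Y := (mem_sdiff.1 c.ha).2
lemma notMem_b : b ∉ Y := (mem_sdiff.1 c.hb).2

omit [Fintype E] c in
lemma mem_closeEnd {Q : Finset V} {A : E → Prop} (haQ : a ∈ Q) (hbQ : b ∉ Q) (r : E → V) (e : E) :
    closeEnd r Y A a b e ∈ Q ↔ (r e ∈ Y ∧ r e ∈ Q) ∨ (r e ∉ Y ∧ A e) := by
  unfold closeEnd; split_ifs <;> simp_all

lemma swap : IsClosing p q S Y b a d z w x y where
  sub := c.sub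
  ha := c.hb
  hb := c.ha
  hab := c.hab.symm
  hd := c.hd
  nodup := by
    have := c.nodup
    simp only [List.nodup_cons, List.mem_cons, List.not_mem_nil, not_or, or_false] at this ⊢
    tauto
  legs e := by rw [c.legs]; tauto

lemma d_ne : d ≠ x ∧ d ≠ y ∧ d ≠ z ∧ d ≠ w := by
  have h : d ∉ cut p q Y := by rw [mem_cut]; simp [c.hd]
  rw [c.legs] at h; tauto

lemma inc_iff {v : V} (hv : v ∈ Y) (e : E) : Inc c.fst c.snd v e ↔ Inc p q v e := by
  have ha : a ≠ v := fun h => c.notMem_a (h ▸ hv)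
  have hb : b ≠ v := fun h => c.notMem_b (h ▸ hv)
  have key : ∀ (r : E → V) (A : E → Prop), closeEnd r Y A a b e = v ↔ r e = v := by
    intro r A; unfold closeEnd
    split_ifs with h1 h2
    · rfl
    · simp only [ha, false_iff]; rintro rfl; exact h1 hv
    · simp only [hb, false_iff]; rintro rfl; exact h1 hv
  unfold Inc; rw [key, key]

lemma inc_a (e : E) : Inc c.fst c.snd a e ↔ e = x ∨ e = y ∨ e = d := by
  have key : ∀ (r : E → V) (A : E → Prop), closeEnd r Y A a b e = a ↔ r e ∉ Y ∧ A e := by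
    intro r A; unfold closeEnd
    split_ifs with h1 h2
    · simp only [h1, not_true, false_and, iff_false]; intro h; exact c.notMem_a (h ▸ h1)
    · simp [h1, h2]
    · simp [h1, h2, c.hab.symm]
  unfold Inc; rw [key, key]
  have h1 := (c.legs e); have h2 := c.hd; have h3 := c.d_ne
  rw [mem_cut] at h1
  by_cases hd : e = d
  · subst hd; tauto
  · tauto

lemma inc_b (e : E) : Inc c.fst c.snd b e ↔ e = z ∨ e = w ∨ e = d := by
  have key : ∀ (r : E → V) (A : E → Prop), closeEnd r Y A a b e = b ↔ r e ∉ Y ∧ ¬ A e := by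
    intro r A; unfold closeEnd
    split_ifs with h1 h2
    · simp only [h1, not_true, false_and, iff_false]; intro h; exact c.notMem_b (h ▸ h1)
    · simp [h1, h2, c.hab]
    · simp [h1, h2]
  unfold Inc; rw [key, key]
  have h1 := (c.legs e); have h2 := c.hd; have h3 := c.d_ne
  rw [mem_cut] at h1
  have h4 := c.nodup
  simp only [List.nodup_cons, List.mem_cons, List.not_mem_nil, not_or, or_false] at h4
  grind

lemma mem_cut_iff {Q : Finset V} (haQ : a ∈ Q) (hbQ : b ∉ Q) (e : E) :
    e ∈ cut c.fst c.snd Q ↔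
      e = d ∨ ((e = x ∨ e = y) ∧ e ∉ cut p q (Y.filter (· ∈ Q))) ∨
        (¬(e = x ∨ e = y) ∧ e ∈ cut p q (Y.filter (· ∈ Q))) := by
  have h1 := (c.legs e); have h2 := c.hd; have h3 := c.d_ne
  simp only [mem_cut, mem_closeEnd haQ hbQ, mem_filter] at h1 ⊢
  grind

lemma three_le_card_cut (h : CubicOn p q S L)
    (hN : ∀ Q ⊆ S, 2 ≤ Q.card → 2 ≤ (S \ Q).card → (cut p q Q).card ≠ 3) (hY : 3 ≤ Y.card)
    {Q : Finset V} (haQ : a ∈ Q) (hbQ : b ∉ Q) : 3 ≤ (cut c.fst c.snd Q).card := by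
  set X := Y.filter (· ∈ Q) with hX
  have hXS : X ⊆ S := (filter_subset _ _).trans c.sub
  have hXS' : Y \ X ⊆ S := sdiff_subset.trans c.sub
  have h1 := card_split_legs c.nodup (cut c.fst c.snd Q)
  have h2 := card_split_legs c.nodup (cut p q X)
  have h3 := card_split_legs c.nodup (cut p q (Y \ X))
  obtain ⟨d1, d2, d3, d4⟩ := c.d_ne
  have e1 : (cut c.fst c.snd Q).filter (fun e => ¬(e = x ∨ e = y ∨ e = z ∨ e = w)) =
      insert d ((cut p q X).filter (fun e => ¬(e = x ∨ e = y ∨ e = z ∨ e = w))) := by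
    ext e
    simp only [mem_filter, mem_insert, c.mem_cut_iff haQ hbQ, ← hX]
    grind
  have e2 : (cut p q (Y \ X)).filter (fun e => ¬(e = x ∨ e = y ∨ e = z ∨ e = w)) =
      (cut p q X).filter (fun e => ¬(e = x ∨ e = y ∨ e = z ∨ e = w)) := by
    ext e
    have h5 := (c.legs e)
    have h6 : ∀ v, v ∈ X → v ∈ Y := fun v hv => (mem_filter.1 hv).1
    have h7 := h6 (p e); have h8 := h6 (q e)
    simp only [mem_filter, mem_cut, mem_sdiff] at h5 ⊢
    grind
  have h4 : ∀ e, (e = x ∨ e = y ∨ e = z ∨ e = w) → (e ∈ cut p q (Y \ X) ↔ e ∉ cut p q X) := by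
    intro e he
    have h5 := (c.legs e).2 he
    have h6 : ∀ v, v ∈ X → v ∈ Y := fun v hv => (mem_filter.1 hv).1
    have h7 := h6 (p e); have h8 := h6 (q e)
    simp only [mem_cut, mem_sdiff] at h5 ⊢
    clear_value X
    grind
  rw [e1, card_insert_of_notMem (by
    have : d ∉ cut p q X := by
      have h6 : ∀ v, v ∈ X → v ∈ Y := fun v hv => (mem_filter.1 hv).1
      have h7 := h6 (p d); have h8 := h6 (q d)
      have h9 := c.hd
      rw [mem_cut]; tauto
    simp [this])] at h1
  rw [e2, if_congr (h4 x (by simp)) rfl rfl, if_congr (h4 y (by simp)) rfl rfl,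
    if_congr (h4 z (by simp)) rfl rfl, if_congr (h4 w (by simp)) rfl rfl] at h3
  have hn := c.nodup
  simp only [List.nodup_cons, List.mem_cons, List.not_mem_nil, not_or, or_false] at hn
  have hx : x ∈ cut c.fst c.snd Q ↔ x ∉ cut p q X := by
    rw [c.mem_cut_iff haQ hbQ, ← hX]; simp [d1.symm]
  have hy : y ∈ cut c.fst c.snd Q ↔ y ∉ cut p q X := by
    rw [c.mem_cut_iff haQ hbQ, ← hX]; simp [d2.symm]
  have hz : z ∈ cut c.fst c.snd Q ↔ z ∈ cut p q X := by
    rw [c.mem_cut_iff haQ hbQ, ← hX]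
    have : ¬ (z = x ∨ z = y) := by rintro (rfl | rfl) <;> simp at hn
    simp [d3.symm, this]
  have hw : w ∈ cut c.fst c.snd Q ↔ w ∈ cut p q X := by
    rw [c.mem_cut_iff haQ hbQ, ← hX]
    have : ¬ (w = x ∨ w = y) := by rintro (rfl | rfl) <;> simp at hn
    simp [d4.symm, this]
  rw [if_congr hx rfl rfl, if_congr hy rfl rfl, if_congr hz rfl rfl, if_congr hw rfl rfl] at h1
  have hcard : (Y \ X).card + X.card = Y.card := card_sdiff_add_card_eq_card (filter_subset _ _)
  have hfar : ∀ W ⊆ Y, 2 ≤ (S \ W).card := by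
    intro W hW
    rw [← card_pair c.hab]
    refine card_le_card fun v hv => ?_
    rcases mem_insert.1 hv with rfl | hv
    · exact mem_sdiff.2 ⟨(mem_sdiff.1 c.ha).1, fun h => c.notMem_a (hW h)⟩
    · rw [mem_singleton.1 hv]
      exact mem_sdiff.2 ⟨(mem_sdiff.1 c.hb).1, fun h => c.notMem_b (hW h)⟩
  have hne : ∀ W ⊆ Y, W ≠ S := by
    rintro W hW rfl; have := hfar W hW; simp at this
  have n1 := hN X hXS
  have n2 := hN (Y \ X) hXS'
  have n3 := hfar X (filter_subset _ _)
  have n4 := hfar (Y \ X) sdiff_subset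
  have n5 : X.card ≠ 0 → 3 ≤ (cut p q X).card := fun h0 =>
    h.conn X hXS (card_pos.1 (by omega)) (hne X (filter_subset _ _))
  have n6 : (Y \ X).card ≠ 0 → 3 ≤ (cut p q (Y \ X)).card := fun h0 =>
    h.conn _ hXS' (card_pos.1 (by omega)) (hne _ sdiff_subset)
  have n7 : X.card = 0 → (cut p q X).card = 0 := by
    intro h0; rw [card_eq_zero] at h0 ⊢; rw [h0]; ext; simp [mem_cut]
  have n8 : (Y \ X).card = 0 → (cut p q (Y \ X)).card = 0 := by
    intro h0; rw [card_eq_zero] at h0 ⊢; rw [h0]; ext; simp [mem_cut]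
  have hite : ∀ (P : Prop) [Decidable P], (if P then 0 else 1) + (if P then 1 else 0) = 1 := by
    intro P _; split_ifs <;> rfl
  have i1 := hite (x ∈ cut p q X)
  have i2 := hite (y ∈ cut p q X)
  have i3 := hite (z ∈ cut p q X)
  have i4 := hite (w ∈ cut p q X)
  simp only [ite_not] at h1 h3
  omega

lemma cubicOn (h : CubicOn p q S L)
    (hN : ∀ Q ⊆ S, 2 ≤ Q.card → 2 ≤ (S \ Q).card → (cut p q Q).card ≠ 3) (hY : 3 ≤ Y.card)
    {L' : E → Option ι} (hL : ∀ e, e ≠ d → L' e = L e)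
    (h1 : ∃ x' y' z', x' ≠ y' ∧ x' ≠ z' ∧ y' ≠ z' ∧
      (∀ e, (e = x ∨ e = y ∨ e = d) ↔ (e = x' ∨ e = y' ∨ e = z')) ∧ L' x' = L' y' ∧ L' z' = none)
    (h2 : ∃ x' y' z', x' ≠ y' ∧ x' ≠ z' ∧ y' ≠ z' ∧
      (∀ e, (e = z ∨ e = w ∨ e = d) ↔ (e = x' ∨ e = y' ∨ e = z')) ∧ L' x' = L' y' ∧ L' z' = none) :
    CubicOn c.fst c.snd (insert a (insert b Y)) L' :=
  have hends : ∀ e, c.fst e ∈ insert a (insert b Y) ∧ c.snd e ∈ insert a (insert b Y) := by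
    intro e
    constructor <;> simp only [fst, snd, closeEnd] <;> split_ifs with h1 h2 <;> simp [h1]
  {
  ends := hends
  star v hv := by
    simp only [mem_insert] at hv
    rcases hv with rfl | rfl | hv
    · simpa only [c.inc_a] using h1
    · simpa only [c.inc_b] using h2
    · obtain ⟨x', y', z', k1, k2, k3, k4, k5, k6⟩ := h.star v (c.sub hv)
      have hne : ∀ e, Inc p q v e → e ≠ d := by
        rintro e he rfl
        have := he.mem hv; have := c.hd; tauto
      exact ⟨x', y', z', k1, k2, k3, fun e => by rw [c.inc_iff hv, k4],
        by rw [hL _ (hne _ ((k4 _).2 (by simp))), hL _ (hne _ ((k4 _).2 (by simp))), k5],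
        by rw [hL _ (hne _ ((k4 _).2 (by simp))), k6]⟩
  conn Q hQ hQne hQS := by
    by_cases haQ : a ∈ Q <;> by_cases hbQ : b ∈ Q
    rotate_left
    · exact c.three_le_card_cut h hN hY haQ hbQ
    · rw [← cut_sdiff hends]
      exact c.three_le_card_cut h hN hY (by simp [haQ]) (by simp [hbQ])
    all_goals
      have haS := (mem_sdiff.1 c.ha).1
      have hbS := (mem_sdiff.1 c.hb).1
      have haY := c.notMem_a
      have hbY := c.notMem_b
      have key : cut c.fst c.snd Q =
          cut p q (S.filter fun v => if v ∈ Y then v ∈ Q else a ∈ Q) := by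
        ext e
        have k : ∀ (r : E → V) (A : E → Prop), closeEnd r Y A a b e ∈ Q ↔
            if r e ∈ Y then r e ∈ Q else a ∈ Q := by
          intro r A; unfold closeEnd; split_ifs <;> simp_all
        simp only [mem_cut, k, mem_filter, h.ends e, true_and]
      rw [key]
      refine h.conn _ (filter_subset _ _) ?_ ?_
      · obtain ⟨v, hv⟩ := hQne
        have hv' := hQ hv
        simp only [mem_insert] at hv'
        rcases hv' with rfl | rfl | hvY
        · exact ⟨v, by simp_all⟩
        · exact ⟨v, by simp_all⟩
        · exact ⟨v, by simp [c.sub hvY, hvY, hv]⟩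
      · intro heq
        refine hQS (Subset.antisymm hQ fun v hv => ?_)
        have haS' := haS
        rw [← heq, mem_filter, if_neg haY] at haS'
        simp only [mem_insert] at hv
        rcases hv with rfl | rfl | hvY
        · simp_all
        · simp_all
        · have := c.sub hvY
          rw [← heq, mem_filter, if_pos hvY] at this
          exact this.2 }

end IsClosing

end Closings

section FourCutSides

open Finset
open scoped Classical

variable {V E ι : Type*} [Fintype E] {p q : E → V} {S Y : Finset V} {L : E → Option ι}

/-- `Y` is a side of the 4-edge-cut `{x, y, z, w}`, both sides having at least three vertices. -/
structure IsSide (p q : E → V) (S Y : Finset V) (x y z w : E) : Prop where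
  sub : Y ⊆ S
  card : 3 ≤ Y.card
  card' : 3 ≤ (S \ Y).card
  nodup : [x, y, z, w].Nodup
  legs : ∀ e, e ∈ cut p q Y ↔ e = x ∨ e = y ∨ e = z ∨ e = w

/-- Every label occurring on a non-loop touching `Y` occurs on such an edge of `F`. -/
def HitsOn (p q : E → V) (Y : Finset V) (L : E → Option ι) (F : E → Prop) : Prop :=
  ∀ e i, p e ≠ q e → (p e ∈ Y ∨ q e ∈ Y) → L e = some i →
    ∃ f, p f ≠ q f ∧ (p f ∈ Y ∨ q f ∈ Y) ∧ F f ∧ L f = some i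

/-- None of four edges is in `F`. -/
def Avoids (F : E → Prop) (x y z w : E) : Prop := ¬F x ∧ ¬F y ∧ ¬F z ∧ ¬F w

/-- `F` contains exactly one of `x, y` and exactly one of `z, w`. -/
def Crosses (F : E → Prop) (x y z w : E) : Prop :=
  ((F x ∧ ¬F y) ∨ (¬F x ∧ F y)) ∧ ((F z ∧ ¬F w) ∨ (¬F z ∧ F w))

variable {a b : V} {d x y z w : E}

omit [Fintype E] in
lemma avoids_or_crosses {F : E → Prop} (h1 : ExactlyOne (F x) (F y) (F d))
    (h2 : ExactlyOne (F z) (F w) (F d)) :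
    (F d ∧ Avoids F x y z w) ∨ (¬F d ∧ Crosses F x y z w) := by
  unfold ExactlyOne at h1 h2
  unfold Avoids Crosses
  tauto

omit [Fintype E] in
lemma Avoids.not_crosses {F : E → Prop} (h : Avoids F x y z w) : ¬Crosses F x y z w := by
  unfold Avoids at h; unfold Crosses; tauto

lemma IsClosing.exists_matching (c : IsClosing p q S Y a b d x y z w) (h : CubicOn p q S L)
    (hN : ∀ Q ⊆ S, 2 ≤ Q.card → 2 ≤ (S \ Q).card → (cut p q Q).card ≠ 3) (hY3 : 3 ≤ Y.card)
    (hY' : 3 ≤ (S \ Y).card) (IH : SolvableBelow V E ι S.card) (l : Option ι)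
    (h1 : (L x = L y ∧ l = none) ∨ (L x = l ∧ L y = none) ∨ (L y = l ∧ L x = none))
    (h2 : (L z = L w ∧ l = none) ∨ (L z = l ∧ L w = none) ∨ (L w = l ∧ L z = none))
    {u : V} (hu : u ∈ insert a (insert b Y))
    (huL : ∀ e, Inc c.fst c.snd u e → Function.update L d l e = none) {e₀ : E}
    (he₀ : Inc c.fst c.snd u e₀) :
    ∃ F : E → Prop, PMOn p q Y F ∧
      ((F d ∧ Avoids F x y z w) ∨ (¬F d ∧ Crosses F x y z w)) ∧
      (∀ e i, p e ≠ q e → (p e ∈ Y ∨ q e ∈ Y) → L e = some i →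
        (∃ f, p f ≠ q f ∧ (p f ∈ Y ∨ q f ∈ Y) ∧ F f ∧ L f = some i) ∨ (F d ∧ l = some i)) ∧
      F e₀ := by
  obtain ⟨d1, d2, d3, d4⟩ := c.d_ne
  have hxy : x ≠ y := by rintro rfl; simpa using c.nodup
  have hzw : z ≠ w := by rintro rfl; simpa using c.nodup
  have hupd : ∀ e, e ≠ d → Function.update L d l e = L e := fun e he =>
    Function.update_of_ne he _ _
  have hud : Function.update L d l d = l := Function.update_self _ _ _
  have tri : ∀ x y, x ≠ y → d ≠ x → d ≠ y →
      ((L x = L y ∧ l = none) ∨ (L x = l ∧ L y = none) ∨ (L y = l ∧ L x = none)) →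
      ∃ x' y' z', x' ≠ y' ∧ x' ≠ z' ∧ y' ≠ z' ∧
        (∀ e, (e = x ∨ e = y ∨ e = d) ↔ (e = x' ∨ e = y' ∨ e = z')) ∧
        Function.update L d l x' = Function.update L d l y' ∧
        Function.update L d l z' = none := by
    intro x y hxy hx hy h
    rcases h with h | h | h
    · exact ⟨x, y, d, hxy, hx.symm, hy.symm, fun e => Iff.rfl,
        by rw [hupd _ hx.symm, hupd _ hy.symm, h.1], by rw [hud, h.2]⟩
    · exact ⟨x, d, y, hx.symm, hxy, hy, fun e => by tauto,
        by rw [hupd _ hx.symm, hud, h.1], by rw [hupd _ hy.symm, h.2]⟩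
    · exact ⟨y, d, x, hy.symm, hxy.symm, hx, fun e => by tauto,
        by rw [hupd _ hy.symm, hud, h.1], by rw [hupd _ hx.symm, h.2]⟩
  have hsum : (S \ Y).card + Y.card = S.card := card_sdiff_add_card_eq_card c.sub
  have hcard : (insert a (insert b Y)).card < S.card := by
    have := card_insert_le a (insert b Y)
    have := card_insert_le b Y
    omega
  obtain ⟨F, hF, hH, hFe⟩ := IH _ _ _ _ hcard
    (c.cubicOn h hN hY3 hupd (tri x y hxy d1 d2 h1) (tri z w hzw d3 d4 h2))
    u hu huL e₀ he₀
  have hFa := (exactlyOne_of_existsUnique hxy d1.symm d2.symm c.inc_a).1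
    (hF a (by simp))
  have hFb := (exactlyOne_of_existsUnique hzw d3.symm d4.symm c.inc_b).1
    (hF b (by simp))
  refine ⟨F, fun v hv => ?_, ?_, fun e i hpq hY hi => ?_, hFe⟩
  · simpa only [c.inc_iff hv] using hF v (by simp [hv])
  · exact avoids_or_crosses hFa hFb
  · have hed : e ≠ d := by rintro rfl; exact hY.elim c.hd.1 c.hd.2
    have hne : c.fst e ≠ c.snd e := by
      rcases hY with hv | hv
      · exact ((c.inc_iff hv e).2 (by simp [Inc, hpq.symm])).ne
      · exact ((c.inc_iff hv e).2 (by simp [Inc, hpq])).ne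
    obtain ⟨f, hf, hFf, hfi⟩ := hH e i hne (by rw [hupd _ hed, hi])
    by_cases hfd : f = d
    · subst hfd; rw [hud] at hfi; exact .inr ⟨hFf, hfi⟩
    · rw [hupd _ hfd] at hfi
      left
      by_cases hfY : p f ∈ Y ∨ q f ∈ Y
      · refine ⟨f, fun hpq => ?_, hfY, hFf, hfi⟩
        have hpY : p f ∈ Y := by rwa [← hpq, or_self] at hfY
        have hqY : q f ∈ Y := hpq ▸ hpY
        simp [IsClosing.fst, IsClosing.snd, closeEnd, hqY, hpq] at hf
      · exfalso
        have : ¬(f = x ∨ f = y) := by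
          intro hxy
          have h5 := (c.legs f).2 (hxy.imp_right .inl)
          rw [mem_cut] at h5
          rw [not_or] at hfY
          simp [hfY] at h5
        rw [not_or] at hfY
        simp [IsClosing.fst, IsClosing.snd, closeEnd, hfY, this, hfd] at hf

namespace IsSide

lemma exists_closing (s : IsSide p q S Y x y z w) (h : CubicOn p q S L) :
    ∃ a b d, IsClosing p q S Y a b d x y z w := by
  obtain ⟨a, ha, b, hb, hab⟩ := one_lt_card.1 (show 1 < (S \ Y).card by have := s.card'; omega)
  have h1 := h.card_cut (Z := S \ Y) sdiff_subset
  have h2 : (cut p q (S \ Y)).card = 4 := by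
    rw [cut_sdiff h.ends]
    have hn := s.nodup
    have : cut p q Y = [x, y, z, w].toFinset := by ext e; simp [s.legs]
    rw [this, List.toFinset_card_of_nodup hn]; rfl
  have h3 := s.card'
  obtain ⟨d, hd⟩ : (inner p q (S \ Y)).Nonempty := card_pos.1 (by omega)
  rw [mem_inner, mem_sdiff, mem_sdiff] at hd
  exact ⟨a, b, d, s.sub, ha, hb, hab, ⟨hd.2.1.2, hd.2.2.2⟩, s.nodup, s.legs⟩

lemma swap_left (s : IsSide p q S Y x y z w) : IsSide p q S Y y x z w where
  __ := s
  nodup := (List.Perm.swap _ _ _).nodup_iff.1 s.nodup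
  legs e := by rw [s.legs]; tauto

lemma swap_mid (s : IsSide p q S Y x y z w) : IsSide p q S Y x z y w where
  __ := s
  nodup := ((List.Perm.swap _ _ _).cons _).nodup_iff.1 s.nodup
  legs e := by rw [s.legs]; tauto

lemma swap_right (s : IsSide p q S Y x y z w) : IsSide p q S Y x y w z where
  __ := s
  nodup := (((List.Perm.swap _ _ _).cons _).cons _).nodup_iff.1 s.nodup
  legs e := by rw [s.legs]; tauto

lemma swap (s : IsSide p q S Y x y z w) : IsSide p q S Y z w x y :=
  s.swap_mid.swap_left.swap_right.swap_mid

lemma compl (s : IsSide p q S Y x y z w) (hends : ∀ e, p e ∈ S ∧ q e ∈ S) :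
    IsSide p q S (S \ Y) x y z w where
  sub := sdiff_subset
  card := s.card'
  card' := by rw [Finset.sdiff_sdiff_eq_self s.sub]; exact s.card
  nodup := s.nodup
  legs e := by rw [cut_sdiff hends, s.legs]

variable (s : IsSide p q S Y x y z w) (h : CubicOn p q S L)
    (hN : ∀ Q ⊆ S, 2 ≤ Q.card → 2 ≤ (S \ Q).card → (cut p q Q).card ≠ 3)
    (IH : SolvableBelow V E ι S.card)

include s h hN IH

/-- A partial matching through a prescribed edge at an unlabelled vertex of the side. -/
lemma exists_matching (l : Option ι)
    (h1 : (L x = L y ∧ l = none) ∨ (L x = l ∧ L y = none) ∨ (L y = l ∧ L x = none))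
    (h2 : (L z = L w ∧ l = none) ∨ (L z = l ∧ L w = none) ∨ (L w = l ∧ L z = none))
    {u : V} (hu : u ∈ Y) (huL : ∀ e, Inc p q u e → L e = none) {e₀ : E} (he₀ : Inc p q u e₀) :
    ∃ F : E → Prop, PMOn p q Y F ∧ (Avoids F x y z w ∨ Crosses F x y z w) ∧
      (∀ e i, p e ≠ q e → (p e ∈ Y ∨ q e ∈ Y) → L e = some i →
        (∃ f, p f ≠ q f ∧ (p f ∈ Y ∨ q f ∈ Y) ∧ F f ∧ L f = some i) ∨
          (Avoids F x y z w ∧ l = some i)) ∧ F e₀ := by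
  obtain ⟨a, b, d, c⟩ := s.exists_closing h
  obtain ⟨F, hF, ht, hh, he⟩ := c.exists_matching h hN s.card s.card' IH l h1 h2
    (u := u) (by simp [hu]) (fun e he => by
      rw [c.inc_iff hu] at he
      have : e ≠ d := by rintro rfl; exact (he.mem hu).elim c.hd.1 c.hd.2
      rw [Function.update_of_ne this, huL e he]) ((c.inc_iff hu e₀).2 he₀)
  refine ⟨F, hF, ht.imp And.right And.right, fun e i h1 h2 h3 => ?_, he⟩
  refine (hh e i h1 h2 h3).imp_right fun h4 => ⟨?_, h4.2⟩
  exact (ht.resolve_right fun h5 => h5.1 h4.1).2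

/-- A partial matching avoiding the cut. -/
lemma exists_avoiding (hx : L x = none) (hy : L y = none) (h2 : L z = L w) :
    ∃ F : E → Prop, PMOn p q Y F ∧ Avoids F x y z w ∧ HitsOn p q Y L F := by
  obtain ⟨a, b, d, c⟩ := s.exists_closing h
  have hd := c.d_ne
  obtain ⟨F, hF, ht, hh, he⟩ := c.exists_matching h hN s.card s.card' IH none
    (.inl ⟨hx.trans hy.symm, rfl⟩) (.inl ⟨h2, rfl⟩) (u := a) (by simp) (fun e he => by
      rw [c.inc_a] at he
      rcases he with rfl | rfl | rfl
      · rw [Function.update_of_ne hd.1.symm, hx]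
      · rw [Function.update_of_ne hd.2.1.symm, hy]
      · simp) ((c.inc_a d).2 (by simp))
  exact ⟨F, hF, (ht.resolve_right fun h5 => h5.1 he).2, fun e i h1 h2 h3 => by simpa using hh e i h1 h2 h3⟩

/-- A partial matching through a prescribed edge of the cut. -/
lemma exists_crossing (hx : L x = none) (hy : L y = none) (h2 : L z = L w) :
    ∃ F : E → Prop, PMOn p q Y F ∧ Crosses F x y z w ∧ HitsOn p q Y L F ∧ F x := by
  obtain ⟨a, b, d, c⟩ := s.exists_closing h
  have hd := c.d_ne
  obtain ⟨F, hF, ht, hh, he⟩ := c.exists_matching h hN s.card s.card' IH none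
    (.inl ⟨hx.trans hy.symm, rfl⟩) (.inl ⟨h2, rfl⟩) (u := a) (by simp) (fun e he => by
      rw [c.inc_a] at he
      rcases he with rfl | rfl | rfl
      · rw [Function.update_of_ne hd.1.symm, hx]
      · rw [Function.update_of_ne hd.2.1.symm, hy]
      · simp) ((c.inc_a x).2 (by simp))
  exact ⟨F, hF, (ht.resolve_left fun h5 => h5.2.1 he).2,
    fun e i h1 h2 h3 => by simpa using hh e i h1 h2 h3, he⟩

end IsSide

end FourCutSides

section FourCuts

open Finset
open scoped Classical

variable {V E ι : Type*} [Fintype E] {p q : E → V} {S Z Y : Finset V} {L : E → Option ι}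
  {x y z w : E}

/-- Erase the labels satisfying `P`. -/
noncomputable def dropIf (P : Option ι → Prop) (o : Option ι) : Option ι := if P o then none else o

lemma dropIf_none (P : Option ι → Prop) : dropIf P none = none := by simp [dropIf]

lemma dropIf_eq_some {P : Option ι → Prop} {o : Option ι} {i : ι} :
    dropIf P o = some i ↔ o = some i ∧ ¬P (some i) := by
  unfold dropIf; split_ifs with h
  · simp only [false_iff, not_and, not_not]; rintro rfl; exact h
  · constructor
    · rintro rfl; exact ⟨rfl, h⟩
    · exact And.left

/-- The labelling `L` without the labels that occur on the cut of `Y`. -/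
noncomputable def dropCrossing (p q : E → V) (Y : Finset V) (L : E → Option ι) (e : E) : Option ι :=
  dropIf (fun o => ∃ f ∈ cut p q Y, L f = o) (L e)

lemma HitsOn.dropCrossing {F : E → Prop} {P : Option ι → Prop}
    (hP : ∀ i, P (some i) → ∃ f ∈ cut p q Y, L f = some i)
    (h : HitsOn p q Y (fun e => dropIf P (L e)) F) : HitsOn p q Y (dropCrossing p q Y L) F := by
  intro e i h1 h2 h3
  have hLe := dropIf_eq_some.1 h3
  obtain ⟨f, hf, hf2, hF, hfi⟩ := h e i h1 h2
    (dropIf_eq_some.2 ⟨hLe.1, fun hPi => hLe.2 (hP i hPi)⟩)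
  exact ⟨f, hf, hf2, hF, dropIf_eq_some.2 ⟨(dropIf_eq_some.1 hfi).1, hLe.2⟩⟩

/-- Some matching of the side `Y` uses exactly the edges `j, k` of the cut and hits all
labels not on the cut. -/
def Achievable (p q : E → V) (Y : Finset V) (L : E → Option ι) (j k : E) : Prop :=
  ∃ F : E → Prop, PMOn p q Y F ∧ HitsOn p q Y (dropCrossing p q Y L) F ∧
    ∀ f ∈ cut p q Y, F f ↔ (f = j ∨ f = k)

lemma Achievable.symm {j k : E} (h : Achievable p q Y L j k) : Achievable p q Y L k j := by
  obtain ⟨F, h1, h2, h3⟩ := h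
  exact ⟨F, h1, h2, fun f hf => by rw [h3 f hf, or_comm]⟩

namespace IsSide

lemma type_iff (s : IsSide p q S Y x y z w) {F : E → Prop} (hx : F x) (hy : F y) (hz : ¬F z)
    (hw : ¬F w) : ∀ f ∈ cut p q Y, F f ↔ (f = x ∨ f = y) := by
  intro f hf
  have hn := s.nodup
  simp only [List.nodup_cons, List.mem_cons, List.not_mem_nil, not_or, or_false] at hn
  rcases (s.legs f).1 hf with rfl | rfl | rfl | rfl
  · simp [hx]
  · simp [hy]
  · simp [hz, Ne.symm hn.1.2.1, Ne.symm hn.2.1.1]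
  · simp [hw, Ne.symm hn.1.2.2, Ne.symm hn.2.1.2]

variable (h : CubicOn p q S L)
    (hN : ∀ Q ⊆ S, 2 ≤ Q.card → 2 ≤ (S \ Q).card → (cut p q Q).card ≠ 3)
    (IH : SolvableBelow V E ι S.card)

include h hN IH

lemma achievable_or (s : IsSide p q S Y x y z w) :
    Achievable p q Y L x z ∨ Achievable p q Y L x w := by
  have hd : ∀ f ∈ cut p q Y, dropCrossing p q Y L f = none := fun f hf => if_pos ⟨f, hf, rfl⟩
  have hl : ∀ f, (f = x ∨ f = y ∨ f = z ∨ f = w) → dropCrossing p q Y L f = none :=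
    fun f hf => hd f ((s.legs f).2 hf)
  obtain ⟨F, hF, ⟨hc1, hc2⟩, hh, hx⟩ := s.exists_crossing (L := dropCrossing p q Y L)
    (h.mapLabels (dropIf _) (dropIf_none _)) hN IH (hl x (by simp)) (hl y (by simp))
    (by rw [hl z (by simp), hl w (by simp)])
  have hy : ¬F y := by tauto
  rcases hc2 with ⟨hz, hw⟩ | ⟨hz, hw⟩
  · exact .inl ⟨F, hF, hh, s.swap_mid.type_iff hx hz hy hw⟩
  · exact .inr ⟨F, hF, hh, s.swap_right.swap_mid.type_iff hx hw hy hz⟩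

lemma achievable_cross (s : IsSide p q S Y x y z w) :
    (Achievable p q Y L x z ∧ Achievable p q Y L x w ∧ Achievable p q Y L y z ∧
      Achievable p q Y L y w) ∨
    (Achievable p q Y L x y ∧ Achievable p q Y L x w ∧ Achievable p q Y L z y ∧
      Achievable p q Y L z w) ∨
    (Achievable p q Y L x y ∧ Achievable p q Y L x z ∧ Achievable p q Y L w y ∧
      Achievable p q Y L w z) := by
  have sym : ∀ {j k}, Achievable p q Y L j k → Achievable p q Y L k j := fun h => h.symm
  have a1 := s.achievable_or h hN IH
  have a2 := s.swap_mid.achievable_or h hN IH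
  have a3 := s.swap_right.swap_mid.achievable_or h hN IH
  have b1 := s.swap_left.achievable_or h hN IH
  have b2 := s.swap_left.swap_mid.achievable_or h hN IH
  have b3 := s.swap_left.swap_right.swap_mid.achievable_or h hN IH
  have c1 := s.swap.achievable_or h hN IH
  have c2 := s.swap.swap_mid.achievable_or h hN IH
  have c3 := s.swap.swap_right.swap_mid.achievable_or h hN IH
  have d1 := s.swap.swap_left.achievable_or h hN IH
  have d2 := s.swap.swap_left.swap_mid.achievable_or h hN IH
  have d3 := s.swap.swap_left.swap_right.swap_mid.achievable_or h hN IH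
  have e1 : Achievable p q Y L y x ↔ Achievable p q Y L x y := ⟨sym, sym⟩
  have e2 : Achievable p q Y L z x ↔ Achievable p q Y L x z := ⟨sym, sym⟩
  have e3 : Achievable p q Y L w x ↔ Achievable p q Y L x w := ⟨sym, sym⟩
  have e4 : Achievable p q Y L z y ↔ Achievable p q Y L y z := ⟨sym, sym⟩
  have e5 : Achievable p q Y L w y ↔ Achievable p q Y L y w := ⟨sym, sym⟩
  have e6 : Achievable p q Y L w z ↔ Achievable p q Y L z w := ⟨sym, sym⟩
  simp only [e1, e2, e3, e4, e5, e6] at a1 a2 a3 b1 b2 b3 c1 c2 c3 d1 d2 d3 ⊢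
  clear sym e1 e2 e3 e4 e5 e6 h hN IH
  generalize Achievable p q Y L x y = A at *
  generalize Achievable p q Y L x z = B at *
  generalize Achievable p q Y L x w = C at *
  generalize Achievable p q Y L y z = D at *
  generalize Achievable p q Y L y w = K at *
  generalize Achievable p q Y L z w = G at *
  clear s
  grind

lemma exists_avoiding_dropCrossing (s : IsSide p q S Y x y z w) :
    ∃ F : E → Prop, PMOn p q Y F ∧ Avoids F x y z w ∧
      HitsOn p q Y (dropCrossing p q Y L) F := by
  have hd : ∀ f ∈ cut p q Y, dropCrossing p q Y L f = none := fun f hf => if_pos ⟨f, hf, rfl⟩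
  have hl : ∀ f, (f = x ∨ f = y ∨ f = z ∨ f = w) → dropCrossing p q Y L f = none :=
    fun f hf => hd f ((s.legs f).2 hf)
  exact s.exists_avoiding (L := dropCrossing p q Y L)
    (h.mapLabels (dropIf _) (dropIf_none _)) hN IH (hl x (by simp)) (hl y (by simp))
    (by rw [hl z (by simp), hl w (by simp)])

/-- If `x, y` have label `i` and `z, w` have another label, then there is a matching of the side
that uses exactly `x, y` from the cut and hits all labels but `i`. -/
lemma exists_pair (s : IsSide p q S Y x y z w) {i j : ι} (hij : i ≠ j) (hx : L x = some i)
    (hy : L y = some i) (hz : L z = some j) (hw : L w = some j)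
    (hA : ¬(Achievable p q Y L x z ∧ Achievable p q Y L y w)) :
    ∃ F : E → Prop, PMOn p q Y F ∧ HitsOn p q Y (fun e => dropIf (· = some i) (L e)) F ∧
      F x ∧ F y ∧ ¬F z ∧ ¬F w := by
  set M : E → Option ι := fun e => dropIf (· = some i) (L e) with hM
  have hMc : CubicOn p q S M := h.mapLabels (dropIf _) (dropIf_none _)
  have mx : M x = none := by simp [hM, hx, dropIf]
  have my : M y = none := by simp [hM, hy, dropIf]
  have mz : M z = some j := dropIf_eq_some.2 ⟨hz, by simpa using hij.symm⟩
  have mw : M w = some j := dropIf_eq_some.2 ⟨hw, by simpa using hij.symm⟩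
  have hoff : ∀ f ∈ cut p q Y, L f = some i →
      ∃ u ∈ Y, Inc p q u f ∧ ∀ e, Inc p q u e → M e = none := by
    intro f hf hfi
    have : ∃ u ∈ Y, Inc p q u f := by
      rw [mem_cut] at hf
      by_cases h1 : p f ∈ Y
      · exact ⟨p f, h1, by intro h2; apply hf; simp [h2.1 rfl]⟩
      · have h2 : q f ∈ Y := by tauto
        exact ⟨q f, h2, by intro h3; apply h1; rw [h3.2 rfl]; exact h2⟩
    obtain ⟨u, hu, huf⟩ := this
    obtain ⟨a, b, c, -, -, -, hs, hab, hc⟩ := h.star u (s.sub hu)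
    refine ⟨u, hu, huf, fun e he => ?_⟩
    have ha : L a = some i := by
      rcases (hs f).1 huf with rfl | rfl | rfl
      · exact hfi
      · rw [hab, hfi]
      · rw [hc] at hfi; cases hfi
    rcases (hs e).1 he with rfl | rfl | rfl
    · simp [hM, ha, dropIf]
    · simp [hM, ← hab, ha, dropIf]
    · simp [hM, hc, dropIf]
  have hxc : x ∈ cut p q Y := (s.legs x).2 (by simp)
  have hyc : y ∈ cut p q Y := (s.legs y).2 (by simp)
  have s' : IsSide p q S Y x w y z := s.swap_right.swap_mid
  have hach : ∀ F : E → Prop, HitsOn p q Y M F → HitsOn p q Y (PaperFormalization.dropCrossing p q Y L) F :=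
    fun F hF => HitsOn.dropCrossing (P := (· = some i))
      (by rintro k hk; exact ⟨x, hxc, by rw [hx, hk]⟩) hF
  have main : ∀ f, (f = x ∨ f = y) → ∃ F : E → Prop, PMOn p q Y F ∧ HitsOn p q Y M F ∧
      Crosses F x w y z ∧ F f := by
    intro f hf
    have hfc : f ∈ cut p q Y := (s.legs f).2 (by tauto)
    obtain ⟨u, hu, huf, huL⟩ := hoff f hfc (by rcases hf with rfl | rfl <;> assumption)
    obtain ⟨F, h1, h2, h3, h4⟩ := s'.exists_matching hMc hN IH (some j)
      (.inr (.inr ⟨mw, mx⟩)) (.inr (.inr ⟨mz, my⟩)) hu huL huf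
    have h2' : ¬ Avoids F x w y z := by
      rintro ⟨k1, -, k2, -⟩
      rcases hf with rfl | rfl
      exacts [k1 h4, k2 h4]
    exact ⟨F, h1, fun e k k1 k2 k3 => (h3 e k k1 k2 k3).resolve_right fun h => h2' h.1,
      h2.resolve_left h2', h4⟩
  by_cases hxz : Achievable p q Y L x z
  · have hyw : ¬ Achievable p q Y L y w := fun h => hA ⟨hxz, h⟩
    obtain ⟨F, h1, h2, ⟨h3, h4⟩, h5⟩ := main y (.inr rfl)
    have hz' : ¬F z := h4.elim And.right fun h => absurd h5 h.1
    rcases h3 with ⟨k1, k2⟩ | ⟨k1, k2⟩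
    · exact ⟨F, h1, h2, k1, h5, hz', k2⟩
    · exact absurd ⟨F, h1, hach F h2, s.swap_left.swap_right.swap_mid.type_iff h5 k2 k1 hz'⟩ hyw
  · obtain ⟨F, h1, h2, ⟨h3, h4⟩, h5⟩ := main x (.inl rfl)
    have hw' : ¬F w := h3.elim And.right fun h => absurd h5 h.1
    rcases h4 with ⟨k1, k2⟩ | ⟨k1, k2⟩
    · exact ⟨F, h1, h2, h5, k1, k2, hw'⟩
    · exact absurd ⟨F, h1, hach F h2, s.swap_mid.type_iff h5 k2 k1 hw'⟩ hxz

end IsSide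

end FourCuts

section FourCutGluing

open Finset
open scoped Classical

variable {V E ι : Type*} [Fintype E] {p q : E → V} {S Z Y : Finset V} {L : E → Option ι}
  {x y z w : E}

/-- Two partial matchings that agree on the cut give a solution if between them they hit
every label. -/
lemma IsSide.glue (s : IsSide p q S Z x y z w) {FZ FY : E → Prop} (hFZ : PMOn p q Z FZ)
    (hFY : PMOn p q (S \ Z) FY) (hx : FZ x ↔ FY x) (hy : FZ y ↔ FY y) (hz : FZ z ↔ FY z)
    (hw : FZ w ↔ FY w)
    (hH : ∀ i, (∃ e, p e ≠ q e ∧ L e = some i) →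
      (∃ f, p f ≠ q f ∧ (p f ∈ Z ∨ q f ∈ Z) ∧ FZ f ∧ L f = some i) ∨
      ∃ f, p f ≠ q f ∧ (p f ∈ S \ Z ∨ q f ∈ S \ Z) ∧ FY f ∧ L f = some i)
    {e : E} (he : p e ∈ Z ∨ q e ∈ Z) (hFe : FZ e) :
    ∃ F : E → Prop, PMOn p q S F ∧ Hits p q L F ∧ F e := by
  obtain ⟨F, h1, h2, h3⟩ := exists_glue hFZ hFY (fun f hf => by
    rcases (s.legs f).1 hf with rfl | rfl | rfl | rfl <;> assumption)
  refine ⟨F, h1, fun f i hf hi => ?_, (h2 e he).2 hFe⟩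
  rcases hH i ⟨f, hf, hi⟩ with ⟨k, k1, k2, k3, k4⟩ | ⟨k, k1, k2, k3, k4⟩
  · exact ⟨k, k1, (h2 k k2).2 k3, k4⟩
  · exact ⟨k, k1, (h3 k k2).2 k3, k4⟩

namespace IsSide

variable (h : CubicOn p q S L)

include h

/-- Labels of the cut can be paired off. -/
lemma exists_paired (s : IsSide p q S Y x y z w) :
    ∃ x' y' z' w', IsSide p q S Y x' y' z' w' ∧ L x' = L y' ∧ L z' = L w' := by
  have hn := s.nodup
  simp only [List.nodup_cons, List.mem_cons, List.not_mem_nil, not_or, or_false] at hn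
  have key : ∀ i, Even ((if L x = some i then 1 else 0) + ((if L y = some i then 1 else 0) +
      ((if L z = some i then 1 else 0) + (if L w = some i then 1 else 0)))) := by
    intro i
    have := h.even_cut s.sub i
    have hc : cut p q Y = {x, y, z, w} := by ext e; simp [s.legs]
    rwa [hc, card_filter, sum_insert (by simp; tauto), sum_insert (by simp; tauto),
      sum_insert (by simp; tauto), sum_singleton] at this
  by_cases h1 : L x = L y
  · refine ⟨x, y, z, w, s, h1, ?_⟩
    have e : ∀ i, L z = some i ↔ L w = some i := by
      intro i; have := key i
      rw [h1] at this
      split_ifs at this <;> simp_all <;> revert this <;> decide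
    rcases hz : L z with _ | i
    · rcases hw : L w with _ | j
      · rfl
      · rw [(e j).2 hw] at hz; cases hz
    · rw [(e i).1 hz]
  by_cases h2 : L x = L z
  · refine ⟨x, z, y, w, s.swap_mid, h2, ?_⟩
    have e : ∀ i, L y = some i ↔ L w = some i := by
      intro i; have := key i
      rw [h2] at this
      split_ifs at this <;> simp_all [Nat.even_iff]
    rcases hz : L y with _ | i
    · rcases hw : L w with _ | j
      · rfl
      · rw [(e j).2 hw] at hz; cases hz
    · rw [(e i).1 hz]
  by_cases h3 : L x = L w
  · refine ⟨x, w, y, z, s.swap_right.swap_mid, h3, ?_⟩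
    have e : ∀ i, L y = some i ↔ L z = some i := by
      intro i; have := key i
      rw [h3] at this
      split_ifs at this <;> simp_all
    rcases hz : L y with _ | i
    · rcases hw : L z with _ | j
      · rfl
      · rw [(e j).2 hw] at hz; cases hz
    · rw [(e i).1 hz]
  exfalso
  rcases hx : L x with _ | i
  · rw [hx] at h1 h2 h3
    rcases hy : L y with _ | j
    · exact h1 hy.symm
    · rcases hz : L z with _ | k
      · exact h2 hz.symm
      · rcases hw : L w with _ | l
        · exact h3 hw.symm
        · have k1 := key j
          have k2 := key k
          have k3 := key l
          simp only [hx, hy, hz, hw, Option.some.injEq] at k1 k2 k3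
          by_cases e1 : k = j
          · subst e1
            by_cases e2 : l = k
            · subst e2; revert k1; simp; decide
            · simp [Ne.symm e2] at k3
          · by_cases e2 : l = j
            · subst e2; simp [Ne.symm e1] at k2
            · simp [e1, e2] at k1
  · have := key i
    rw [hx] at h1 h2 h3
    simp [hx, Ne.symm h1, Ne.symm h2, Ne.symm h3] at this

lemma glue_achievable (s : IsSide p q S Z x y z w) {FZ : E → Prop} (hc : Crosses FZ x z y w)
    (hA : Achievable p q (S \ Z) L x y ∧ Achievable p q (S \ Z) L x w ∧
      Achievable p q (S \ Z) L z y ∧ Achievable p q (S \ Z) L z w) :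
    ∃ FY : E → Prop, PMOn p q (S \ Z) FY ∧ HitsOn p q (S \ Z) (dropCrossing p q (S \ Z) L) FY ∧
      (FZ x ↔ FY x) ∧ (FZ y ↔ FY y) ∧ (FZ z ↔ FY z) ∧ (FZ w ↔ FY w) := by
  have key : ∀ j k l m, IsSide p q S (S \ Z) j k l m → Achievable p q (S \ Z) L j k →
      FZ j → FZ k → ¬FZ l → ¬FZ m → ∃ FY : E → Prop, PMOn p q (S \ Z) FY ∧
      HitsOn p q (S \ Z) (dropCrossing p q (S \ Z) L) FY ∧
      ∀ f ∈ cut p q (S \ Z), FZ f ↔ FY f := by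
    rintro j k l m s' ⟨F, h1, h2, h3⟩ k1 k2 k3 k4
    exact ⟨F, h1, h2, fun f hf => by rw [s'.type_iff k1 k2 k3 k4 f hf, h3 f hf]⟩
  have s' := s.compl h.ends
  have fin : (∃ FY : E → Prop, PMOn p q (S \ Z) FY ∧
      HitsOn p q (S \ Z) (dropCrossing p q (S \ Z) L) FY ∧
      ∀ f ∈ cut p q (S \ Z), FZ f ↔ FY f) := by
    rcases hc with ⟨⟨h1, h2⟩ | ⟨h1, h2⟩, ⟨h3, h4⟩ | ⟨h3, h4⟩⟩
    · exact key x y z w s' hA.1 h1 h3 h2 h4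
    · exact key x w y z s'.swap_right.swap_mid hA.2.1 h1 h4 h3 h2
    · exact key z y x w s'.swap_left.swap_mid.swap_left hA.2.2.1 h2 h3 h1 h4
    · exact key z w x y s'.swap hA.2.2.2 h2 h4 h1 h3
  obtain ⟨FY, h1, h2, h3⟩ := fin
  refine ⟨FY, h1, h2, ?_, ?_, ?_, ?_⟩ <;> exact h3 _ ((s'.legs _).2 (by simp))

end IsSide

omit [Fintype E] in
lemma touches_of_mem {S Z : Finset V} (hends : ∀ e, p e ∈ S ∧ q e ∈ S) (e : E) :
    (p e ∈ Z ∨ q e ∈ Z) ∨ (p e ∈ S \ Z ∨ q e ∈ S \ Z) := by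
  simp [hends e]; tauto

namespace IsSide

variable (h : CubicOn p q S L)
    (hN : ∀ Q ⊆ S, 2 ≤ Q.card → 2 ≤ (S \ Q).card → (cut p q Q).card ≠ 3)
    (IH : SolvableBelow V E ι S.card)
    {u : V} (hu : u ∈ Z) (huL : ∀ e, Inc p q u e → L e = none) {e : E} (he : Inc p q u e)

include h in
lemma hits_dropCrossing {FZ FY : E → Prop} (hZ : HitsOn p q Z L FZ)
    (hY : HitsOn p q (S \ Z) (dropCrossing p q (S \ Z) L) FY) (i : ι)
    (hi : ∃ e, p e ≠ q e ∧ L e = some i) :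
      (∃ f, p f ≠ q f ∧ (p f ∈ Z ∨ q f ∈ Z) ∧ FZ f ∧ L f = some i) ∨
      ∃ f, p f ≠ q f ∧ (p f ∈ S \ Z ∨ q f ∈ S \ Z) ∧ FY f ∧ L f = some i := by
  obtain ⟨k, hk, hki⟩ := hi
  rcases touches_of_mem (Z := Z) h.ends k with ht | ht
  · exact .inl (hZ k i hk ht hki)
  · by_cases hc : ∃ f ∈ cut p q (S \ Z), L f = some i
    · obtain ⟨f, hf, hfi⟩ := hc
      rw [cut_sdiff h.ends, mem_cut] at hf
      exact .inl (hZ f i (fun hpq => hf (by rw [hpq])) (by tauto) hfi)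
    · obtain ⟨f, k1, k2, k3, k4⟩ := hY k i hk ht (dropIf_eq_some.2 ⟨hki, hc⟩)
      exact .inr ⟨f, k1, k2, k3, (dropIf_eq_some.1 k4).1⟩

include h hN IH hu huL he

lemma solve_of_real (s : IsSide p q S Z x y z w) (hxz : L x = L z) (hyw : L y = L w)
    (hA : Achievable p q (S \ Z) L x y ∧ Achievable p q (S \ Z) L x w ∧
      Achievable p q (S \ Z) L z y ∧ Achievable p q (S \ Z) L z w) :
    ∃ F : E → Prop, PMOn p q S F ∧ Hits p q L F ∧ F e := by
  obtain ⟨FZ, h1, h2, h3, h4⟩ := s.swap_mid.exists_matching h hN IH none (.inl ⟨hxz, rfl⟩)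
    (.inl ⟨hyw, rfl⟩) hu huL he
  have hZ : HitsOn p q Z L FZ := fun f i k1 k2 k3 => by simpa using h3 f i k1 k2 k3
  rcases h2 with h2 | h2
  · obtain ⟨FY, g1, g2, g3⟩ := (s.compl h.ends).exists_avoiding_dropCrossing h hN IH
    exact s.glue h1 g1 (iff_of_false h2.1 g2.1) (iff_of_false h2.2.2.1 g2.2.1)
      (iff_of_false h2.2.1 g2.2.2.1) (iff_of_false h2.2.2.2 g2.2.2.2)
      (hits_dropCrossing h hZ g3) (he.mem hu) h4
  · obtain ⟨FY, g1, g2, g3, g4, g5, g6⟩ := s.glue_achievable h h2 hA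
    exact s.glue h1 g1 g3 g4 g5 g6 (hits_dropCrossing h hZ g2) (he.mem hu) h4

/-- The cut carries a single label, on two edges that the closing separates. -/
lemma solve_of_single (s : IsSide p q S Z x y z w) {i : ι} (hx : L x = some i) (hy : L y = some i)
    (hz : L z = none) (hw : L w = none)
    (hA : Achievable p q (S \ Z) L x y ∧ Achievable p q (S \ Z) L x w ∧
      Achievable p q (S \ Z) L z y ∧ Achievable p q (S \ Z) L z w) :
    ∃ F : E → Prop, PMOn p q S F ∧ Hits p q L F ∧ F e := by
  obtain ⟨FZ, h1, h2, h3, h4⟩ := s.swap_mid.exists_matching h hN IH (some i)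
    (.inr (.inl ⟨hx, hz⟩)) (.inr (.inl ⟨hy, hw⟩)) hu huL he
  rcases h2 with h2 | h2
  · obtain ⟨FY, g1, g2, g3⟩ := (s.compl h.ends).swap.exists_avoiding h hN IH hz hw (hx.trans hy.symm)
    refine s.glue h1 g1 (iff_of_false h2.1 g2.2.2.1) (iff_of_false h2.2.2.1 g2.2.2.2)
      (iff_of_false h2.2.1 g2.1) (iff_of_false h2.2.2.2 g2.2.1) ?_ (he.mem hu) h4
    rintro j ⟨k, hk, hkj⟩
    rcases touches_of_mem (Z := Z) h.ends k with ht | ht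
    · refine (h3 k j hk ht hkj).imp_right ?_
      rintro ⟨-, hij⟩
      have hxc := (s.legs x).2 (by simp)
      rw [mem_cut] at hxc
      exact g3 x j (fun hpq => hxc (by rw [hpq])) (by simp [h.ends x]; tauto) (hx.trans hij)
    · exact .inr (g3 k j hk ht hkj)
  · obtain ⟨FY, g1, g2, g3, g4, g5, g6⟩ := s.glue_achievable h h2 hA
    exact s.glue h1 g1 g3 g4 g5 g6 (hits_dropCrossing h
      (fun f i k1 k2 k3 => (h3 f i k1 k2 k3).resolve_right fun h => h.1.not_crosses h2) g2)
      (he.mem hu) h4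

/-- The cut carries two labels, both of which the closing separates. -/
lemma solve_of_double (s : IsSide p q S Z x y z w) {i j : ι} (hij : i ≠ j) (hx : L x = some i)
    (hy : L y = some i) (hz : L z = some j) (hw : L w = some j)
    (hA : Achievable p q (S \ Z) L x y ∧ Achievable p q (S \ Z) L x w ∧
      Achievable p q (S \ Z) L z y ∧ Achievable p q (S \ Z) L z w)
    (hA' : ¬(Achievable p q (S \ Z) L x z ∧ Achievable p q (S \ Z) L y w)) :
    ∃ F : E → Prop, PMOn p q S F ∧ Hits p q L F ∧ F e := by
  have sY := s.compl h.ends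
  set g : Option ι → Option ι := fun o => if o = some j then some i else o with hg
  have hgi : g (some i) = some i := if_neg (by simpa using hij)
  have hgj : g (some j) = some i := if_pos rfl
  have hgk : ∀ {o k}, k ≠ i → (g o = some k ↔ (o = some k ∧ k ≠ j)) := by
    intro o k hk
    simp only [hg]; split_ifs with ho
    · rw [ho]; simp only [Option.some.injEq]
      constructor
      · intro h; exact absurd h.symm hk
      · rintro ⟨rfl, h⟩; exact absurd rfl h
    · constructor
      · rintro rfl; exact ⟨rfl, fun h => ho (by rw [h])⟩
      · exact And.left
  obtain ⟨FZ, h1, h2, h3, h4⟩ := s.swap_mid.exists_matching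
    (h.mapLabels g (by simp [hg])) hN IH none
    (.inl ⟨by rw [hx, hz, hgi, hgj], rfl⟩) (.inl ⟨by rw [hy, hw, hgi, hgj], rfl⟩) hu
    (fun f hf => by simp [huL f hf, hg]) he
  have hleg : ∀ f, f = x ∨ f = y ∨ f = z ∨ f = w → p f ≠ q f ∧ (p f ∈ Z ∨ q f ∈ Z) ∧
      (p f ∈ S \ Z ∨ q f ∈ S \ Z) := by
    intro f hf
    have hfc := (s.legs f).2 hf
    rw [mem_cut] at hfc
    refine ⟨fun hpq => hfc (by rw [hpq]), by tauto, by simp [h.ends f]; tauto⟩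
  have hother : ∀ k, k ≠ i → k ≠ j → ∀ f, p f ≠ q f → (p f ∈ Z ∨ q f ∈ Z) → L f = some k →
      ∃ f, p f ≠ q f ∧ (p f ∈ Z ∨ q f ∈ Z) ∧ FZ f ∧ L f = some k := by
    intro k hki hkj f k1 k2 k3
    obtain ⟨f', l1, l2, l3, l4⟩ :=
      (h3 f k k1 k2 ((hgk hki).2 ⟨k3, hkj⟩)).resolve_right (by simp)
    exact ⟨f', l1, l2, l3, ((hgk hki).1 l4).1⟩
  -- combining with a matching of the other side which misses only one label
  have fin : ∀ (m n : ι) (FY : E → Prop), (∀ k, k ≠ i ∧ k ≠ j ↔ k ≠ m ∧ k ≠ n) →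
      (∃ f, p f ≠ q f ∧ (p f ∈ S \ Z ∨ q f ∈ S \ Z) ∧ L f = some n) → m ≠ n →
      PMOn p q (S \ Z) FY → HitsOn p q (S \ Z) (fun e => dropIf (· = some m) (L e)) FY →
      (FZ x ↔ FY x) → (FZ y ↔ FY y) → (FZ z ↔ FY z) → (FZ w ↔ FY w) →
      (∃ f, p f ≠ q f ∧ (p f ∈ Z ∨ q f ∈ Z) ∧ FZ f ∧ L f = some m) →
      ∃ F : E → Prop, PMOn p q S F ∧ Hits p q L F ∧ F e := by
    intro m n FY hmn hn hmn' g1 g2 ex ey ez ew hm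
    have hY : ∀ k, k ≠ m → ∀ f, p f ≠ q f → (p f ∈ S \ Z ∨ q f ∈ S \ Z) → L f = some k →
        ∃ f, p f ≠ q f ∧ (p f ∈ S \ Z ∨ q f ∈ S \ Z) ∧ FY f ∧ L f = some k := by
      intro k hk f k1 k2 k3
      obtain ⟨f', l1, l2, l3, l4⟩ := g2 f k k1 k2 (dropIf_eq_some.2 ⟨k3, by simpa using hk⟩)
      exact ⟨f', l1, l2, l3, (dropIf_eq_some.1 l4).1⟩
    refine s.glue h1 g1 ex ey ez ew ?_ (he.mem hu) h4
    rintro k ⟨f, k1, k2⟩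
    by_cases hkm : k = m
    · subst hkm; exact .inl hm
    by_cases hkn : k = n
    · subst hkn
      obtain ⟨f', l1, l2, l3⟩ := hn
      exact .inr (hY k hkm f' l1 l2 l3)
    rcases touches_of_mem (Z := Z) h.ends f with ht | ht
    · obtain ⟨ki, kj⟩ := (hmn k).2 ⟨hkm, hkn⟩
      exact .inl (hother k ki kj f k1 ht k2)
    · exact .inr (hY k hkm f k1 ht k2)
  have finij := fun FY => fin i j FY (fun k => Iff.rfl)
    ⟨z, (hleg z (by simp)).1, (hleg z (by simp)).2.2, hz⟩ hij
  have finji := fun FY => fin j i FY (fun k => and_comm)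
    ⟨x, (hleg x (by simp)).1, (hleg x (by simp)).2.2, hx⟩ hij.symm
  rcases h2 with h2 | h2
  · obtain ⟨f, l1, l2, l3, l4⟩ := (h3 x i (hleg x (by simp)).1 (hleg x (by simp)).2.1
      (by rw [hx, hgi])).resolve_right (by simp)
    have hfij : L f = some i ∨ L f = some j := by
      simp only [hg] at l4; split_ifs at l4 with hf
      exacts [.inr hf, .inl l4]
    rcases hfij with hf | hf
    · obtain ⟨FY, g1, g2, g3⟩ := sY.exists_avoiding
        (h.mapLabels (dropIf (· = some i)) (dropIf_none _)) hN IH (by simp [dropIf, hx])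
        (by simp [dropIf, hy]) (by rw [hz, hw])
      exact finij FY g1 g3 (iff_of_false h2.1 g2.1) (iff_of_false h2.2.2.1 g2.2.1)
        (iff_of_false h2.2.1 g2.2.2.1) (iff_of_false h2.2.2.2 g2.2.2.2) ⟨f, l1, l2, l3, hf⟩
    · obtain ⟨FY, g1, g2, g3⟩ := sY.swap.exists_avoiding
        (h.mapLabels (dropIf (· = some j)) (dropIf_none _)) hN IH (by simp [dropIf, hz])
        (by simp [dropIf, hw]) (by rw [hx, hy])
      exact finji FY g1 g3 (iff_of_false h2.1 g2.2.2.1) (iff_of_false h2.2.2.1 g2.2.2.2)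
        (iff_of_false h2.2.1 g2.1) (iff_of_false h2.2.2.2 g2.2.1) ⟨f, l1, l2, l3, hf⟩
  · by_cases hxy : FZ x ∧ FZ y
    · have hz' : ¬FZ z := h2.1.elim And.right fun k => absurd hxy.1 k.1
      have hw' : ¬FZ w := h2.2.elim And.right fun k => absurd hxy.2 k.1
      obtain ⟨FY, g1, g2, g3, g4, g5, g6⟩ := sY.exists_pair h hN IH hij hx hy hz hw hA'
      exact finij FY g1 g2 (iff_of_true hxy.1 g3) (iff_of_true hxy.2 g4) (iff_of_false hz' g5)
        (iff_of_false hw' g6) ⟨x, (hleg x (by simp)).1, (hleg x (by simp)).2.1, hxy.1, hx⟩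
    by_cases hzw : FZ z ∧ FZ w
    · have hx' : ¬FZ x := h2.1.elim (fun k => absurd hzw.1 k.2) And.left
      have hy' : ¬FZ y := h2.2.elim (fun k => absurd hzw.2 k.2) And.left
      obtain ⟨FY, g1, g2, g3, g4, g5, g6⟩ := sY.swap.exists_pair h hN IH hij.symm hz hw hx hy
        (fun k => hA' ⟨k.1.symm, k.2.symm⟩)
      exact finji FY g1 g2 (iff_of_false hx' g5) (iff_of_false hy' g6) (iff_of_true hzw.1 g3)
        (iff_of_true hzw.2 g4) ⟨z, (hleg z (by simp)).1, (hleg z (by simp)).2.1, hzw.1, hz⟩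
    · obtain ⟨FY, g1, g2, g3, g4, g5, g6⟩ := s.glue_achievable h h2 hA
      have hi : ∃ f, p f ≠ q f ∧ (p f ∈ Z ∨ q f ∈ Z) ∧ FZ f ∧ L f = some i := by
        by_cases k : FZ x
        · exact ⟨x, (hleg x (by simp)).1, (hleg x (by simp)).2.1, k, hx⟩
        · have k' : FZ z := h2.1.elim (fun l => absurd l.1 k) And.right
          have : FZ y := h2.2.elim And.left fun l => absurd ⟨k', l.2⟩ hzw
          exact ⟨y, (hleg y (by simp)).1, (hleg y (by simp)).2.1, this, hy⟩
      have hj : ∃ f, p f ≠ q f ∧ (p f ∈ Z ∨ q f ∈ Z) ∧ FZ f ∧ L f = some j := by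
        by_cases k : FZ z
        · exact ⟨z, (hleg z (by simp)).1, (hleg z (by simp)).2.1, k, hz⟩
        · have k' : FZ x := h2.1.elim And.left fun l => absurd l.2 k
          have : FZ w := h2.2.elim (fun l => absurd ⟨k', l.1⟩ hxy) And.right
          exact ⟨w, (hleg w (by simp)).1, (hleg w (by simp)).2.1, this, hw⟩
      refine s.glue h1 g1 g3 g4 g5 g6 (hits_dropCrossing h (fun f k l1 l2 l3 => ?_) g2)
        (he.mem hu) h4
      by_cases hki : k = i
      · subst hki; exact hi
      by_cases hkj : k = j
      · subst hkj; exact hj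
      exact hother k hki hkj f l1 l2 l3

/-- Reduction of 4-edge-cuts with at least three vertices on each side. -/
lemma solve (s : IsSide p q S Z x y z w) :
    ∃ F : E → Prop, PMOn p q S F ∧ Hits p q L F ∧ F e := by
  obtain ⟨x, y, z, w, s, hxy, hzw⟩ := s.exists_paired h
  have sY := s.compl h.ends
  have main : ∀ {x y z w}, IsSide p q S Z x y z w → L x = L y → L z = L w →
      (Achievable p q (S \ Z) L x y ∧ Achievable p q (S \ Z) L x w ∧
        Achievable p q (S \ Z) L z y ∧ Achievable p q (S \ Z) L z w) →
      ¬(Achievable p q (S \ Z) L x z ∧ Achievable p q (S \ Z) L y w) →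
      ∃ F : E → Prop, PMOn p q S F ∧ Hits p q L F ∧ F e := by
    intro x y z w s hxy hzw hA hA'
    by_cases hxz : L x = L z
    · exact s.solve_of_real h hN IH hu huL he hxz (by rw [← hxy, hxz, hzw]) hA
    rcases hx : L x with _ | i
    · rcases hz : L z with _ | j
      · exact absurd (hx.trans hz.symm) hxz
      · exact s.swap.solve_of_single h hN IH hu huL he hz (hzw ▸ hz) hx (hxy ▸ hx)
          ⟨hA.2.2.2, hA.2.2.1, hA.2.1, hA.1⟩
    · rcases hz : L z with _ | j
      · exact s.solve_of_single h hN IH hu huL he hx (hxy ▸ hx) hz (hzw ▸ hz) hA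
      · exact s.solve_of_double h hN IH hu huL he (fun hij => hxz (by rw [hx, hz, hij])) hx
          (hxy ▸ hx) hz (hzw ▸ hz) hA hA'
  by_cases hT : Achievable p q (S \ Z) L x z ∧ Achievable p q (S \ Z) L x w ∧
      Achievable p q (S \ Z) L y z ∧ Achievable p q (S \ Z) L y w
  · exact s.swap_mid.solve_of_real h hN IH hu huL he hxy hzw hT
  · rcases sY.achievable_cross h hN IH with hA | hA | hA
    · exact absurd hA hT
    · refine main s hxy hzw hA fun k => hT ⟨k.1, hA.2.1, hA.2.2.1.symm, k.2⟩
    · refine main s.swap_right hxy hzw.symm hA fun k => hT ⟨hA.2.1, k.1, k.2, hA.2.2.1.symm⟩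

end IsSide

end FourCutGluing

section Reduction

open Finset
open scoped Classical

variable {V E ι : Type*} {p q : E → V} {e f a b c d : E} {v w x y z : V}

/-- The edge `e` joins the distinct vertices `v` and `w`. -/
def Joins (p q : E → V) (e : E) (v w : V) : Prop :=
  v ≠ w ∧ (p e = v ∧ q e = w ∨ p e = w ∧ q e = v)

namespace Joins

lemma symm (h : Joins p q e v w) : Joins p q e w v := ⟨h.1.symm, h.2.symm⟩

lemma inc_iff (h : Joins p q e v w) : Inc p q x e ↔ x = v ∨ x = w := by
  obtain ⟨hne, ⟨rfl, rfl⟩ | ⟨rfl, rfl⟩⟩ := h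
  · simp only [Inc, eq_comm (a := x)]
    constructor
    · tauto
    · rintro (rfl | rfl) <;> tauto
  · simp only [Inc, eq_comm (a := x)]
    constructor
    · tauto
    · rintro (rfl | rfl) <;> tauto

lemma left (h : Joins p q e v w) : Inc p q v e := h.inc_iff.2 (.inl rfl)

lemma right (h : Joins p q e v w) : Inc p q w e := h.inc_iff.2 (.inr rfl)

lemma ends_ne (h : Joins p q e v w) : p e ≠ q e := h.left.ne

lemma right_unique (h : Joins p q e v w) (h' : Joins p q e v x) : w = x :=
  (h'.inc_iff.1 h.right).resolve_left h.1.symm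

lemma mem_inner [Fintype E] (h : Joins p q e v w) {Q : Finset V} (hv : v ∈ Q) (hw : w ∈ Q) :
    e ∈ inner p q Q := by
  refine PaperFormalization.mem_inner.2 ⟨h.ends_ne, ?_⟩
  obtain ⟨-, ⟨rfl, rfl⟩ | ⟨rfl, rfl⟩⟩ := h <;> exact ⟨by assumption, by assumption⟩

lemma mem_cut [Fintype E] (h : Joins p q e v w) {Q : Finset V} (hv : v ∈ Q) (hw : w ∉ Q) :
    e ∈ cut p q Q := by
  refine PaperFormalization.mem_cut.2 ?_
  obtain ⟨-, ⟨rfl, rfl⟩ | ⟨rfl, rfl⟩⟩ := h <;> tauto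

lemma mem_right (h : Joins p q e v w) {S : Finset V} (hS : ∀ e, p e ∈ S ∧ q e ∈ S) : w ∈ S := by
  obtain ⟨-, ⟨rfl, rfl⟩ | ⟨rfl, rfl⟩⟩ := h
  exacts [(hS e).2, (hS e).1]

lemma mem_left (h : Joins p q e v w) {S : Finset V} (hS : ∀ e, p e ∈ S ∧ q e ∈ S) : v ∈ S :=
  h.symm.mem_right hS

end Joins

lemma Inc.exists_joins (h : Inc p q v e) : ∃ w, Joins p q e v w := by
  by_cases h1 : p e = v
  · exact ⟨q e, fun h2 => h (by simp [h1, ← h2]), .inl ⟨h1, rfl⟩⟩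
  · refine ⟨p e, Ne.symm h1, .inr ⟨rfl, ?_⟩⟩
    by_contra h2; exact h (by simp [h1, h2])

/-- Two distinct vertices of `S` that no edge joins. -/
def Far (p q : E → V) (v w : V) : Prop := v ≠ w ∧ ∀ e, ¬Joins p q e v w

lemma Far.symm (h : Far p q v w) : Far p q w v := ⟨h.1.symm, fun e he => h.2 e he.symm⟩

/-- Small vertex sets span forests. -/
def LocallySparse [Fintype E] (p q : E → V) (S : Finset V) : Prop :=
  ∀ Q ⊆ S, 2 ≤ Q.card → Q.card ≤ 4 → (inner p q Q).card < Q.card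

variable [Fintype E] {S : Finset V}

namespace LocallySparse

variable (hS : LocallySparse p q S) (hends : ∀ e, p e ∈ S ∧ q e ∈ S)

include hS hends

lemma eq_of_joins (ha : Joins p q a v w) (hb : Joins p q b v w) : a = b := by
  by_contra hab
  have := hS {v, w} (by simp [insert_subset_iff, ha.mem_left hends, ha.mem_right hends])
    (by rw [card_pair ha.1]) (by rw [card_pair ha.1]; omega)
  rw [card_pair ha.1] at this
  have h2 : ({a, b} : Finset E) ⊆ inner p q {v, w} := by
    simp [insert_subset_iff, ha.mem_inner, hb.mem_inner]
  have := card_le_card h2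
  rw [card_pair hab] at this
  omega

lemma no_triangle (ha : Joins p q a x y) (hb : Joins p q b y z) (hc : Joins p q c z x) : False := by
  have hab : a ≠ b := by rintro rfl; exact hc.1 (ha.symm.right_unique hb).symm
  have hbc : b ≠ c := by rintro rfl; exact ha.1 (hb.symm.right_unique hc).symm
  have hac : a ≠ c := by rintro rfl; exact hb.1 (ha.right_unique hc.symm)
  have hcard : ({x, y, z} : Finset V).card = 3 := card_eq_three.2 ⟨x, y, z, ha.1, hc.1.symm, hb.1, rfl⟩
  have := hS {x, y, z} (by
    simp [insert_subset_iff, ha.mem_left hends, ha.mem_right hends, hb.mem_right hends])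
    (by omega) (by omega)
  have h2 : ({a, b, c} : Finset E) ⊆ inner p q {x, y, z} := by
    simp [insert_subset_iff, ha.mem_inner, hb.mem_inner, hc.mem_inner]
  have := card_le_card h2
  rw [card_eq_three.2 ⟨a, b, c, hab, hac, hbc, rfl⟩] at this
  omega

lemma no_square (ha : Joins p q a x y) (hb : Joins p q b y z) (hc : Joins p q c z w)
    (hd : Joins p q d w x) (hxz : x ≠ z) (hyw : y ≠ w) : False := by
  have hab : a ≠ b := by rintro rfl; exact hxz (ha.symm.right_unique hb)
  have hbc : b ≠ c := by rintro rfl; exact hyw (hb.symm.right_unique hc)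
  have hcd : c ≠ d := by rintro rfl; exact hxz.symm (hc.symm.right_unique hd)
  have had : a ≠ d := by rintro rfl; exact hyw (ha.right_unique hd.symm)
  have hac : a ≠ c := by
    rintro rfl
    rcases ha.inc_iff.1 hc.left with h | h
    · exact hxz h.symm
    · exact hb.1 h.symm
  have hbd : b ≠ d := by
    rintro rfl
    rcases hb.inc_iff.1 hd.right with h | h
    · exact ha.1 h
    · exact hxz h
  have h4 : ({x, y, z, w} : Finset V).card = 4 := by
    rw [card_insert_of_notMem (by simp [ha.1, hxz, hd.1.symm]),
      card_insert_of_notMem (by simp [hb.1, hyw]), card_pair hc.1]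
  have := hS {x, y, z, w} (by
    simp [insert_subset_iff, ha.mem_left hends, ha.mem_right hends, hb.mem_right hends,
      hc.mem_right hends]) (by omega) (by omega)
  have h2 : ({a, b, c, d} : Finset E) ⊆ inner p q {x, y, z, w} := by
    simp [insert_subset_iff, ha.mem_inner, hb.mem_inner, hc.mem_inner, hd.mem_inner]
  have := card_le_card h2
  rw [card_insert_of_notMem (by simp [hab, hac, had]),
      card_insert_of_notMem (by simp [hbc, hbd]), card_pair hcd] at this
  omega

/-- The ends of a path of length three are not adjacent. -/
lemma far (ha : Joins p q a v x) (hb : Joins p q b x y) (hc : Joins p q c y w) (h1 : v ≠ y)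
    (h2 : x ≠ w) : Far p q v w := by
  refine ⟨?_, fun f hf => hS.no_square hends ha hb hc hf.symm h1 h2⟩
  rintro rfl
  exact hS.no_triangle hends ha hb hc

end LocallySparse

lemma CubicOn.locallySparse {L : E → Option ι} (h : CubicOn p q S L) (h7 : 7 ≤ S.card)
    (h5 : ∀ Q ⊆ S, 3 ≤ Q.card → 3 ≤ (S \ Q).card → 5 ≤ (cut p q Q).card) :
    LocallySparse p q S := by
  intro Q hQ h2 h4
  have hc := h.card_cut hQ
  have hsum : (S \ Q).card + Q.card = S.card := card_sdiff_add_card_eq_card hQ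
  have h3 := h.conn Q hQ (card_pos.1 (by omega)) (by rintro rfl; omega)
  by_cases hQ3 : 3 ≤ Q.card
  · have := h5 Q hQ hQ3 (by omega)
    omega
  · omega

/-- The end in `W` of an edge of the cut of `W`. -/
noncomputable def outer (p q : E → V) (W : Finset V) (e : E) : V := if p e ∈ W then p e else q e

omit [Fintype E] in
lemma Joins.outer_eq (h : Joins p q e v w) {W : Finset V} (hv : v ∈ W) (hw : w ∉ W) :
    outer p q W e = v := by
  unfold outer
  obtain ⟨-, ⟨rfl, rfl⟩ | ⟨rfl, rfl⟩⟩ := h <;> simp [hv, hw]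

lemma outer_mem {W : Finset V} (he : e ∈ cut p q W) : outer p q W e ∈ W := by
  rw [mem_cut] at he; unfold outer; split_ifs with h1
  · exact h1
  · tauto

lemma inc_iff_outer {W : Finset V} (he : e ∈ cut p q W) (hv : v ∈ W) :
    Inc p q v e ↔ v = outer p q W e := by
  rw [mem_cut] at he; unfold outer Inc; split_ifs with h1
  · have : q e ≠ v := by rintro rfl; tauto
    simp [this, eq_comm]
  · have : p e ≠ v := by rintro rfl; tauto
    simp [this, eq_comm]

/-- The edges of the cut of `W` are fused in pairs `e, σ e`, the edge in `H` becoming the fused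
edge and the other one a loop. -/
structure IsFusion (p q : E → V) (W : Finset V) (H : Finset E) (σ : E → E) : Prop where
  map : ∀ e ∈ cut p q W, σ e ∈ cut p q W
  invol : ∀ e ∈ cut p q W, σ (σ e) = e
  sub : H ⊆ cut p q W
  mem_iff : ∀ e ∈ cut p q W, (σ e ∈ H ↔ e ∉ H)
  far : ∀ e ∈ cut p q W, Far p q (outer p q W e) (outer p q W (σ e))

/-- An end map after fusing, where `τ` selects the edge of the pair whose end is taken. -/
noncomputable def fuse (p q : E → V) (W : Finset V) (H : Finset E) (u : V) (τ : E → E) (r : E → V)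
    (e : E) : V :=
  if e ∈ H then outer p q W (τ e) else if p e ∈ W ∧ q e ∈ W then r e else u

/-- The fused edge an edge belongs to. -/
noncomputable def fused (p q : E → V) (W : Finset V) (H : Finset E) (σ : E → E) (e : E) : E :=
  if e ∈ cut p q W ∧ e ∉ H then σ e else e

end Reduction

section Fusion

open Finset
open scoped Classical

variable {V E ι : Type*} [Fintype E] {p q : E → V} {W S : Finset V} {H : Finset E} {σ : E → E}
  {L : E → Option ι} {u v : V}

namespace IsFusion

lemma fused_eq (k : IsFusion p q W H σ) (e : E) :
    (fused p q W H σ e = e ∧ (e ∈ cut p q W → e ∈ H)) ∨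
      (e ∈ cut p q W ∧ e ∉ H ∧ fused p q W H σ e = σ e ∧ σ e ∈ H) := by
  unfold fused
  split_ifs with he
  · exact .inr ⟨he.1, he.2, rfl, (k.mem_iff e he.1).2 he.2⟩
  · exact .inl ⟨rfl, fun h => by_contra fun h' => he ⟨h, h'⟩⟩

lemma fused_of_notMem (k : IsFusion p q W H σ) {e : E} (he : e ∉ cut p q W) :
    fused p q W H σ e = e := (k.fused_eq e).elim And.left fun h => absurd h.1 he

lemma fused_of_mem (k : IsFusion p q W H σ) {e : E} (he : e ∈ H) : fused p q W H σ e = e :=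
  (k.fused_eq e).elim And.left fun h => absurd he h.2.1

lemma fused_map (k : IsFusion p q W H σ) {e : E} (he : e ∈ cut p q W) :
    fused p q W H σ (σ e) = fused p q W H σ e := by
  by_cases h : e ∈ H
  · have h' : σ e ∉ H := fun h' => (k.mem_iff e he).1 h' h
    rw [k.fused_of_mem h, fused, if_pos ⟨k.map e he, h'⟩, k.invol e he]
  · rw [k.fused_of_mem ((k.mem_iff e he).2 h), fused, if_pos ⟨he, h⟩]

lemma inc_fuse (k : IsFusion p q W H σ) (hv : v ∈ W) (e' : E) :
    Inc (fuse p q W H u id p) (fuse p q W H u σ q) v e' ↔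
      ∃ e, Inc p q v e ∧ fused p q W H σ e = e' := by
  by_cases hH : e' ∈ H
  · have hc := k.sub hH
    have hl : Inc (fuse p q W H u id p) (fuse p q W H u σ q) v e' ↔
        v = outer p q W e' ∨ v = outer p q W (σ e') := by
      have := (k.far e' hc).1
      simp only [Inc, fuse, hH, if_true, id]
      constructor
      · intro h; by_contra h'; push Not at h'; exact h (iff_of_false h'.1.symm h'.2.symm)
      · rintro (rfl | rfl)
        · simp [this.symm]
        · simp [this]
    rw [hl, ← inc_iff_outer hc hv, ← inc_iff_outer (k.map e' hc) hv]
    constructor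
    · rintro (h | h)
      · exact ⟨e', h, k.fused_of_mem hH⟩
      · exact ⟨σ e', h, by rw [k.fused_map hc, k.fused_of_mem hH]⟩
    · rintro ⟨e, he, hee⟩
      rcases k.fused_eq e with ⟨h1, -⟩ | ⟨h1, -, h2, -⟩
      · exact .inl (by rw [← hee, h1]; exact he)
      · exact .inr (by rw [← hee, h2, k.invol e h1]; exact he)
  · have hr : (∃ e, Inc p q v e ∧ fused p q W H σ e = e') ↔ Inc p q v e' ∧ e' ∉ cut p q W := by
      constructor
      · rintro ⟨e, he, hee⟩
        rcases k.fused_eq e with ⟨h1, h2⟩ | ⟨-, -, h2, h3⟩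
        · obtain rfl := h1.symm.trans hee
          exact ⟨he, fun h => hH (h2 h)⟩
        · exact absurd (hee ▸ h2 ▸ h3) hH
      · rintro ⟨h1, h2⟩
        exact ⟨e', h1, k.fused_of_notMem h2⟩
    rw [hr]
    by_cases hW : p e' ∈ W ∧ q e' ∈ W
    · have : e' ∉ cut p q W := by rw [mem_cut]; tauto
      simp [Inc, fuse, hH, hW, this]
    · simp only [Inc, fuse, hH, hW, if_false, not_true, false_iff]
      rintro ⟨h1, h2⟩
      have := Inc.mem h1 hv
      rw [mem_cut] at h2
      tauto

lemma fused_inj (k : IsFusion p q W H σ) (hv : v ∈ W) {a b : E} (ha : Inc p q v a)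
    (hb : Inc p q v b) (hab : fused p q W H σ a = fused p q W H σ b) : a = b := by
  have key : ∀ {a b}, Inc p q v a → Inc p q v b → a ∈ cut p q W → σ a = b → False := by
    rintro a b ha hb hc rfl
    rw [inc_iff_outer hc hv] at ha
    rw [inc_iff_outer (k.map a hc) hv] at hb
    exact (k.far a hc).1 (ha ▸ hb)
  rcases k.fused_eq a with ⟨h1, -⟩ | ⟨h1, -, h2, -⟩ <;>
    rcases k.fused_eq b with ⟨g1, -⟩ | ⟨g1, -, g2, -⟩
  · rw [← h1, ← g1, hab]
  · exact (key hb ha g1 (by rw [← g2, ← hab, h1])).elim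
  · exact (key ha hb h1 (by rw [← h2, hab, g1])).elim
  · rw [← k.invol a h1, ← k.invol b g1, ← h2, ← g2, hab]

lemma mem_cut_fuse (k : IsFusion p q W H σ) {Z : Finset V} (hZ : Z ⊆ W) {e : E}
    (he : e ∈ cut p q Z) :
    fused p q W H σ e ∈ cut (fuse p q W H u id p) (fuse p q W H u σ q) Z ∨
      (e ∈ cut p q W ∧ outer p q W e ∈ Z ∧ outer p q W (σ e) ∈ Z) := by
  by_cases hc : e ∈ cut p q W
  · have ho : outer p q W e ∈ Z := by
      rw [mem_cut] at he hc
      unfold outer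
      have h1 := @hZ (p e)
      have h2 := @hZ (q e)
      split_ifs <;> tauto
    by_cases ho' : outer p q W (σ e) ∈ Z
    · exact .inr ⟨hc, ho, ho'⟩
    left
    rw [mem_cut]
    by_cases hH : e ∈ H
    · rw [k.fused_of_mem hH]; simp [fuse, hH, ho, ho']
    · have hH' := (k.mem_iff e hc).2 hH
      rw [← k.fused_map hc, k.fused_of_mem hH']
      simp [fuse, hH', ho, ho', k.invol e hc]
  · left
    have hH : e ∉ H := fun h => hc (k.sub h)
    rw [k.fused_of_notMem hc]
    rw [mem_cut] at *
    have hW : p e ∈ W ∧ q e ∈ W := by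
      have h1 := @hZ (p e)
      have h2 := @hZ (q e)
      tauto
    simpa [fuse, hH, hW] using he

/-- The fused edges both of whose ends lie in `Z`. -/
noncomputable def both (p q : E → V) (W : Finset V) (H : Finset E) (σ : E → E) (Z : Finset V) :
    Finset E := H.filter fun e => outer p q W e ∈ Z ∧ outer p q W (σ e) ∈ Z

lemma card_cut_le (k : IsFusion p q W H σ) {Z : Finset V} (hZ : Z ⊆ W) :
    (cut p q Z).card ≤ (cut (fuse p q W H u id p) (fuse p q W H u σ q) Z).card +
      2 * (both p q W H σ Z).card := by
  set B := both p q W H σ Z with hB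
  set C := cut (fuse p q W H u id p) (fuse p q W H u σ q) Z with hC
  have h1 : cut p q Z ⊆ ((cut p q Z).filter fun e => fused p q W H σ e ∈ C) ∪ (B ∪ B.image σ) := by
    intro e he
    rcases k.mem_cut_fuse (u := u) hZ he with h | ⟨h1, h2, h3⟩
    · exact mem_union_left _ (mem_filter.2 ⟨he, h⟩)
    · refine mem_union_right _ (mem_union.2 ?_)
      by_cases hH : e ∈ H
      · exact .inl (mem_filter.2 ⟨hH, h2, h3⟩)
      · exact .inr (mem_image.2 ⟨σ e, mem_filter.2 ⟨(k.mem_iff e h1).2 hH, h3, by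
          rwa [k.invol e h1]⟩, k.invol e h1⟩)
  have h2 : ((cut p q Z).filter fun e => fused p q W H σ e ∈ C).card ≤ C.card := by
    refine card_le_card_of_injOn (fused p q W H σ) (fun e he => (mem_filter.1 he).2) ?_
    intro a ha b hb hab
    have ha := mem_filter.1 ha
    have hb := mem_filter.1 hb
    have key : ∀ {a b}, a ∈ cut p q W → σ a = b → a ∈ cut p q Z → b ∈ cut p q Z →
        fused p q W H σ a ∈ C → False := by
      rintro a b hc rfl h1 h2 h3
      have e1 : outer p q W a ∈ Z := by
        rw [mem_cut] at h1 hc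
        unfold outer
        have := @hZ (p a)
        have := @hZ (q a)
        split_ifs <;> tauto
      have e2 : outer p q W (σ a) ∈ Z := by
        have hc := k.map a hc
        rw [mem_cut] at h2 hc
        unfold outer
        have := @hZ (p (σ a))
        have := @hZ (q (σ a))
        split_ifs <;> tauto
      rw [hC, mem_cut] at h3
      by_cases hH : a ∈ H
      · rw [k.fused_of_mem hH] at h3; simp [fuse, hH, e1, e2] at h3
      · have hH' := (k.mem_iff a hc).2 hH
        rw [← k.fused_map hc, k.fused_of_mem hH'] at h3
        simp [fuse, hH', e1, e2, k.invol a hc] at h3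
    rcases k.fused_eq a with ⟨h1, -⟩ | ⟨h1, -, h2, -⟩ <;>
      rcases k.fused_eq b with ⟨g1, -⟩ | ⟨g1, -, g2, -⟩
    · rw [← h1, ← g1, hab]
    · exact (key g1 (by rw [← g2, ← hab, h1]) hb.1 ha.1 hb.2).elim
    · exact (key h1 (by rw [← h2, hab, g1]) ha.1 hb.1 ha.2).elim
    · rw [← k.invol a h1, ← k.invol b g1, ← h2, ← g2, hab]
  have h3 := card_le_card h1
  have h4 := card_union_le ((cut p q Z).filter fun e => fused p q W H σ e ∈ C) (B ∪ B.image σ)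
  have h5 := card_union_le B (B.image σ)
  have h6 : (B.image σ).card ≤ B.card := card_image_le
  omega

lemma ends_fuse (hu : u ∈ W) (k : IsFusion p q W H σ) (e : E) :
    fuse p q W H u id p e ∈ W ∧ fuse p q W H u σ q e ∈ W := by
  unfold fuse
  split_ifs with h1 h2
  · exact ⟨outer_mem (k.sub h1), outer_mem (k.map _ (k.sub h1))⟩
  · exact h2
  · exact ⟨hu, hu⟩

lemma two_lt_card_cut (k : IsFusion p q W H σ) (h : CubicOn p q S L)
    (h5 : ∀ Q ⊆ S, 3 ≤ Q.card → 3 ≤ (S \ Q).card → 5 ≤ (cut p q Q).card)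
    (hW : W ⊆ S) (hD : 2 ≤ (S \ W).card) {Z : Finset V} (hZ : Z ⊆ W) (hne : Z.Nonempty)
    (hZW : Z ≠ W) (hB : (both p q W H σ Z).card ≤ 1) :
    2 < (cut (fuse p q W H u id p) (fuse p q W H u σ q) Z).card := by
  by_contra! hlt
  have hle := k.card_cut_le (u := u) hZ
  have hZS := hZ.trans hW
  have h1 : (S \ Z).card + Z.card = S.card := card_sdiff_add_card_eq_card hZS
  have h2 : (S \ W).card + W.card = S.card := card_sdiff_add_card_eq_card hW
  have h3 := card_lt_card (hZ.ssubset_of_ne hZW)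
  have h4 := card_pos.2 hne
  have hc := h.conn Z hZS hne (by rintro rfl; omega)
  have hZ2 : Z.card ≤ 2 := by
    by_contra! hZ3
    have := h5 Z hZS hZ3 (by omega)
    omega
  obtain ⟨e, he⟩ : (both p q W H σ Z).Nonempty := card_pos.1 (by omega)
  obtain ⟨heH, h6, h7⟩ := mem_filter.1 he
  have hf := k.far e (k.sub heH)
  have hZe : Z = {outer p q W e, outer p q W (σ e)} := by
    refine (eq_of_subset_of_card_le (by simp [insert_subset_iff, h6, h7]) ?_).symm
    rw [card_pair hf.1]; exact hZ2
  have hcc := h.card_cut hZS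
  have hZ2' : Z.card = 2 := by rw [hZe, card_pair hf.1]
  obtain ⟨g, hg⟩ : (inner p q Z).Nonempty := card_pos.1 (by omega)
  obtain ⟨g1, g2, g3⟩ := mem_inner.1 hg
  rw [hZe, mem_insert, mem_singleton] at g2 g3
  rcases g2 with g2 | g2 <;> rcases g3 with g3 | g3
  · exact g1 (g2.trans g3.symm)
  · exact hf.2 g ⟨hf.1, .inl ⟨g2, g3⟩⟩
  · exact hf.2 g ⟨hf.1, .inr ⟨g2, g3⟩⟩
  · exact g1 (g2.trans g3.symm)

lemma cubicOn_fuse {κ : Type*} (k : IsFusion p q W H σ) (h : CubicOn p q S L)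
    (h5 : ∀ Q ⊆ S, 3 ≤ Q.card → 3 ≤ (S \ Q).card → 5 ≤ (cut p q Q).card)
    (hW : W ⊆ S) (hD : 2 ≤ (S \ W).card) (hu : u ∈ W) (hH : H.card ≤ 3) {g : Option ι → Option κ}
    (hg : g none = none) (hgc : ∀ e ∈ cut p q W, g (L e) = none) :
    CubicOn (fuse p q W H u id p) (fuse p q W H u σ q) W (fun e => g (L e)) where
  ends := k.ends_fuse hu
  star v hv := by
    obtain ⟨a, b, c, hab, hac, hbc, hs, hl, hc⟩ := h.star v (hW hv)
    have hL : ∀ e, g (L (fused p q W H σ e)) = g (L e) := by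
      intro e
      rcases k.fused_eq e with ⟨h1, -⟩ | ⟨h1, -, h2, -⟩
      · rw [h1]
      · rw [h2, hgc e h1, hgc _ (k.map e h1)]
    have ha : Inc p q v a := (hs a).2 (by simp)
    have hb : Inc p q v b := (hs b).2 (by simp)
    have hc' : Inc p q v c := (hs c).2 (by simp)
    refine ⟨fused p q W H σ a, fused p q W H σ b, fused p q W H σ c,
      fun h => hab (k.fused_inj hv ha hb h), fun h => hac (k.fused_inj hv ha hc' h),
      fun h => hbc (k.fused_inj hv hb hc' h), fun e => ?_, by rw [hL, hL, hl], by rw [hL, hc, hg]⟩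
    rw [k.inc_fuse hv]
    simp only [hs]
    constructor
    · rintro ⟨e, rfl | rfl | rfl, rfl⟩ <;> simp
    · rintro (rfl | rfl | rfl)
      exacts [⟨a, by simp, rfl⟩, ⟨b, by simp, rfl⟩, ⟨c, by simp, rfl⟩]
  conn Z hZ hne hZW := by
    have hdisj : Disjoint (both p q W H σ Z) (both p q W H σ (W \ Z)) := by
      rw [Finset.disjoint_left]
      intro e h1 h2
      exact (mem_sdiff.1 (mem_filter.1 h2).2.1).2 (mem_filter.1 h1).2.1
    have hle : ((both p q W H σ Z) ∪ (both p q W H σ (W \ Z))).card ≤ H.card :=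
      card_le_card (union_subset (filter_subset _ _) (filter_subset _ _))
    rw [card_union_of_disjoint hdisj] at hle
    by_cases hB : (both p q W H σ Z).card ≤ 1
    · exact k.two_lt_card_cut h h5 hW hD hZ hne hZW hB
    · rw [← cut_sdiff (S := W) (Z := Z) (k.ends_fuse hu)]
      refine k.two_lt_card_cut h h5 hW hD sdiff_subset ?_ ?_ (by omega)
      · rw [sdiff_nonempty]; exact fun h => hZW (hZ.antisymm h)
      · obtain ⟨z, hz⟩ := hne
        intro h'
        have : z ∈ W \ Z := by rw [h']; exact hZ hz
        exact (mem_sdiff.1 this).2 hz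

/-- Transferring a solution from the fused graph. -/
lemma exists_matching (k : IsFusion p q W H σ) (h : CubicOn p q S L)
    (h5 : ∀ Q ⊆ S, 3 ≤ Q.card → 3 ≤ (S \ Q).card → 5 ≤ (cut p q Q).card)
    (IH : SolvableBelow V E ι S.card)
    (hW : W ⊆ S) (hD : 2 ≤ (S \ W).card) (hu : u ∈ W) (hH : H.card ≤ 3) {g : Option ι → Option ι}
    (hg : g none = none) (hgc : ∀ e ∈ cut p q W, g (L e) = none)
    (huL : ∀ e, Inc p q u e → L e = none) {e : E} (he : Inc p q u e) (heW : e ∉ cut p q W) :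
    ∃ F : E → Prop, PMOn p q W F ∧ (∀ f ∈ cut p q W, F (σ f) ↔ F f) ∧
      HitsOn p q W (fun e => g (L e)) F ∧ F e := by
  have h2 : (S \ W).card + W.card = S.card := card_sdiff_add_card_eq_card hW
  obtain ⟨F, h3, h4, hF⟩ := IH _ _ W _ (by omega)
    (k.cubicOn_fuse h h5 hW hD hu hH hg hgc) u hu (fun f hf => by
      obtain ⟨f', h6, rfl⟩ := (k.inc_fuse hu f).1 hf
      rcases k.fused_eq f' with ⟨h1, -⟩ | ⟨h1, -, h2, -⟩
      · rw [h1, huL f' h6, hg]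
      · rw [h2, hgc _ (k.map _ h1)]) e ((k.inc_fuse hu e).2 ⟨e, he, k.fused_of_notMem heW⟩)
  refine ⟨fun f => F (fused p q W H σ f), ?_, fun f hf => by simp only [k.fused_map hf], ?_, ?_⟩
  · intro v hv
    obtain ⟨f, ⟨h6, h7⟩, h8⟩ := h3 v hv
    obtain ⟨f', h9, rfl⟩ := (k.inc_fuse hv f).1 h6
    exact ⟨f', ⟨h9, h7⟩, fun f'' hf'' => k.fused_inj hv hf''.1 h9
      (h8 _ ⟨(k.inc_fuse hv _).2 ⟨f'', hf''.1, rfl⟩, hf''.2⟩)⟩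
  · have key : ∀ f i, (p f ∈ W ∨ q f ∈ W) → g (L f) = some i →
        f ∉ H ∧ f ∉ cut p q W ∧ p f ∈ W ∧ q f ∈ W := by
      intro f i h1 h2
      have hc : f ∉ cut p q W := fun hc => by rw [hgc f hc] at h2; cases h2
      refine ⟨fun h => hc (k.sub h), hc, ?_⟩
      rw [mem_cut] at hc; tauto
    intro f i h6 h7 h8
    obtain ⟨k1, k2, k3⟩ := key f i h7 h8
    obtain ⟨f', h9, h10, h11⟩ := h4 f i (by simpa [fuse, k1, k3] using h6) h8
    have hfH : f' ∉ H := fun h => by simp [hgc _ (k.sub h)] at h11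
    have hfW : p f' ∈ W ∧ q f' ∈ W := by
      by_contra hn
      simp [fuse, hfH, hn] at h9
    obtain ⟨l1, l2, l3⟩ := key f' i (.inl hfW.1) h11
    exact ⟨f', by simpa [fuse, hfH, hfW] using h9, .inl hfW.1,
      by simpa only [k.fused_of_notMem l2] using h10, h11⟩
  · simpa [k.fused_of_notMem heW] using hF

end IsFusion

end Fusion

section Deletion

open Finset
open scoped Classical

variable {V E ι : Type*} [Fintype E] {p q : E → V} {W S : Finset V} {H : Finset E} {σ : E → E}
  {L : E → Option ι} {u v : V}

omit [Fintype E] in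
lemma Joins.ne_of_inc {e f : E} {v w x : V} (h : Joins p q e v w) (hf : Inc p q x f) (hv : x ≠ v)
    (hw : x ≠ w) : e ≠ f := by
  rintro rfl; exact (h.inc_iff.1 hf).elim hv hw

/-- An edge outside a spanning tree of a small vertex set is not induced. -/
lemma LocallySparse.notMem_of_joins (hS : LocallySparse p q S) {D : Finset V} {T : Finset E}
    (hD : D ⊆ S) (h2 : 2 ≤ D.card) (h4 : D.card ≤ 4) (hT : T ⊆ inner p q D)
    (hTD : D.card ≤ T.card + 1) {f : E} (hf : f ∉ T) {a b : V} (hj : Joins p q f a b) (ha : a ∈ D) :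
    b ∉ D := by
  intro hb
  have h1 : insert f T ⊆ inner p q D := insert_subset (hj.mem_inner ha hb) hT
  have := card_le_card h1
  rw [card_insert_of_notMem hf] at this
  have := hS D hD h2 h4
  omega

lemma exists_fusion_two {a b c d : E} (hn : [a, b, c, d].Nodup)
    (hc : ∀ f, f ∈ cut p q W ↔ f = a ∨ f = b ∨ f = c ∨ f = d)
    (h1 : Far p q (outer p q W a) (outer p q W b)) (h2 : Far p q (outer p q W c) (outer p q W d)) :
    ∃ H σ, IsFusion p q W H σ ∧ H.card ≤ 3 ∧ σ a = b ∧ σ c = d := by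
  simp only [List.nodup_cons, List.mem_cons, List.not_mem_nil, not_or, or_false, not_false_eq_true,
    List.nodup_nil, and_true] at hn
  obtain ⟨⟨n1, n2, n3⟩, ⟨n4, n5⟩, n6⟩ := hn
  set σ : E → E := fun f => if f = a then b else if f = b then a else if f = c then d else c
  have ea : σ a = b := by simp [σ]
  have eb : σ b = a := by simp [σ, Ne.symm n1]
  have ec : σ c = d := by simp [σ, Ne.symm n2, Ne.symm n4]
  have ed : σ d = c := by simp [σ, Ne.symm n3, Ne.symm n5, Ne.symm n6]
  refine ⟨{a, c}, σ, ⟨fun e he => ?_, fun e he => ?_, fun e he => ?_, fun e he => ?_,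
    fun e he => ?_⟩, card_le_two.trans (by norm_num), ea, ec⟩
  · rcases (hc e).1 he with rfl | rfl | rfl | rfl <;> simp [hc, ea, eb, ec, ed]
  · rcases (hc e).1 he with rfl | rfl | rfl | rfl <;> simp [ea, eb, ec, ed]
  · simp only [mem_insert, mem_singleton] at he; rw [hc]; tauto
  · rcases (hc e).1 he with rfl | rfl | rfl | rfl <;>
      simp [ea, eb, ec, ed, n2, n4, Ne.symm n1, Ne.symm n3, Ne.symm n6]
  · rcases (hc e).1 he with rfl | rfl | rfl | rfl <;> simp only [ea, eb, ec, ed]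
    exacts [h1, h1.symm, h2, h2.symm]

lemma exists_fusion_three {a b c d r s : E} (hn : [a, b, c, d, r, s].Nodup)
    (hc : ∀ f, f ∈ cut p q W ↔ f = a ∨ f = b ∨ f = c ∨ f = d ∨ f = r ∨ f = s)
    (h1 : Far p q (outer p q W a) (outer p q W b)) (h2 : Far p q (outer p q W c) (outer p q W d))
    (h3 : Far p q (outer p q W r) (outer p q W s)) :
    ∃ H σ, IsFusion p q W H σ ∧ H.card ≤ 3 ∧ σ a = b ∧ σ c = d ∧ σ r = s := by
  simp only [List.nodup_cons, List.mem_cons, List.not_mem_nil, not_or, or_false, not_false_eq_true,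
    List.nodup_nil, and_true] at hn
  obtain ⟨⟨n1, n2, n3, n4, n5⟩, ⟨n6, n7, n8, n9⟩, ⟨n10, n11, n12⟩, ⟨n13, n14⟩, n15⟩ := hn
  set σ : E → E := fun f => if f = a then b else if f = b then a else if f = c then d else
    if f = d then c else if f = r then s else r
  have ea : σ a = b := by simp [σ]
  have eb : σ b = a := by simp [σ, Ne.symm n1]
  have ec : σ c = d := by simp [σ, Ne.symm n2, Ne.symm n6]
  have ed : σ d = c := by simp [σ, Ne.symm n3, Ne.symm n7, Ne.symm n10]
  have er : σ r = s := by simp [σ, Ne.symm n4, Ne.symm n8, Ne.symm n11, Ne.symm n13]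
  have es : σ s = r := by
    simp [σ, Ne.symm n5, Ne.symm n9, Ne.symm n12, Ne.symm n14, Ne.symm n15]
  refine ⟨{a, c, r}, σ, ⟨fun e he => ?_, fun e he => ?_, fun e he => ?_, fun e he => ?_,
    fun e he => ?_⟩, card_le_three, ea, ec, er⟩
  · rcases (hc e).1 he with rfl | rfl | rfl | rfl | rfl | rfl <;> simp [hc, ea, eb, ec, ed, er, es]
  · rcases (hc e).1 he with rfl | rfl | rfl | rfl | rfl | rfl <;> simp [ea, eb, ec, ed, er, es]
  · simp only [mem_insert, mem_singleton] at he; rw [hc]; tauto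
  · rcases (hc e).1 he with rfl | rfl | rfl | rfl | rfl | rfl <;>
      simp [ea, eb, ec, ed, er, es, n2, n4, n6, n8, n11, n13, Ne.symm n1, Ne.symm n3,
        Ne.symm n5, Ne.symm n10, Ne.symm n11, Ne.symm n12, Ne.symm n15]
  · rcases (hc e).1 he with rfl | rfl | rfl | rfl | rfl | rfl <;> simp only [ea, eb, ec, ed, er, es]
    exacts [h1, h1.symm, h2, h2.symm, h3, h3.symm]

/-- Solving by deleting `S \ W` and fusing the edges of the cut, when all labels at deleted
vertices are equal to `o`. -/
lemma IsFusion.solve (k : IsFusion p q W H σ) (h : CubicOn p q S L)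
    (h5 : ∀ Q ⊆ S, 3 ≤ Q.card → 3 ≤ (S \ Q).card → 5 ≤ (cut p q Q).card)
    (IH : SolvableBelow V E ι S.card) (hW : W ⊆ S) (hD : 2 ≤ (S \ W).card) (hu : u ∈ W)
    (hH : H.card ≤ 3) (huL : ∀ e, Inc p q u e → L e = none) {e : E} (he : Inc p q u e)
    (heW : e ∉ cut p q W) (o : Option ι)
    (hlab : ∀ v ∈ S \ W, ∀ f, Inc p q v f → L f = none ∨ L f = o)
    (hfin : ∀ F₀ : E → Prop, PMOn p q W F₀ → (∀ f ∈ cut p q W, F₀ (σ f) ↔ F₀ f) → F₀ e →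
      ∃ FD : E → Prop, PMOn p q (S \ W) FD ∧ (∀ f ∈ cut p q W, F₀ f ↔ FD f) ∧
        ∀ F : E → Prop, PMOn p q S F → F e →
          (∀ f, (p f ∈ S \ W ∨ q f ∈ S \ W) → (F f ↔ FD f)) → ∀ i, o = some i →
          ∃ f, p f ≠ q f ∧ F f ∧ L f = some i) :
    ∃ F : E → Prop, PMOn p q S F ∧ Hits p q L F ∧ F e := by
  have hlab' : ∀ f, p f ≠ q f → (p f ∈ S \ W ∨ q f ∈ S \ W) → L f = none ∨ L f = o := by
    rintro f hf (h1 | h1)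
    · exact hlab _ h1 f (by simpa [Inc] using hf.symm)
    · exact hlab _ h1 f (by simpa [Inc] using hf)
  obtain ⟨F₀, h1, h2, h3, h4⟩ := k.exists_matching h h5 IH hW hD hu hH
    (g := dropIf (· = o)) (dropIf_none _) (fun f hf => by
      rw [mem_cut] at hf
      have := hlab' f (fun hpq => hf (by rw [hpq])) (by
        simp only [mem_sdiff, (h.ends f).1, (h.ends f).2, true_and]; tauto)
      unfold dropIf; split_ifs with hfo
      · rfl
      · tauto) huL he heW
  obtain ⟨FD, g1, g2, g3⟩ := hfin F₀ h1 h2 h4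
  obtain ⟨F, k1, k2, k3⟩ := exists_glue h1 g1 g2
  have hFe : F e := (k2 e (he.mem hu)).2 h4
  refine ⟨F, k1, fun f i hf hi => ?_, hFe⟩
  by_cases hio : o = some i
  · exact g3 F k1 hFe k3 i hio
  rcases touches_of_mem (Z := W) h.ends f with ht | ht
  · obtain ⟨f', l1, l2, l3, l4⟩ := h3 f i hf ht (dropIf_eq_some.2 ⟨hi, fun h => hio h.symm⟩)
    exact ⟨f', l1, (k2 f' l2).2 l3, (dropIf_eq_some.1 l4).1⟩
  · rcases hlab' f hf ht with h' | h'
    · rw [h'] at hi; cases hi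
    · exact absurd (h'.symm.trans hi) hio

end Deletion

section Configurations

open Finset
open scoped Classical

variable {V E ι : Type*} {p q : E → V} {S : Finset V} {L : E → Option ι} {u v w x y z : V}
  {e a b c f m o r h₁ h₂ k₁ k₂ o₂ s : E}

/-- The edges at `v` are the three distinct edges `a`, `b`, `c`. -/
structure IsStar (p q : E → V) (v : V) (a b c : E) : Prop where
  ne₁ : a ≠ b
  ne₂ : a ≠ c
  ne₃ : b ≠ c
  inc_iff : ∀ e, Inc p q v e ↔ e = a ∨ e = b ∨ e = c

namespace IsStar

lemma fst (st : IsStar p q v a b c) : Inc p q v a := (st.inc_iff a).2 (by simp)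
lemma snd (st : IsStar p q v a b c) : Inc p q v b := (st.inc_iff b).2 (by simp)
lemma trd (st : IsStar p q v a b c) : Inc p q v c := (st.inc_iff c).2 (by simp)

lemma swap (st : IsStar p q v a b c) : IsStar p q v a c b :=
  ⟨st.ne₂, st.ne₁, st.ne₃.symm, fun e => by rw [st.inc_iff]; tauto⟩

lemma existsUnique (st : IsStar p q v a b c) {F : E → Prop} (h : ExactlyOne (F a) (F b) (F c)) :
    ∃! e, Inc p q v e ∧ F e :=
  (exactlyOne_of_existsUnique st.ne₁ st.ne₂ st.ne₃ st.inc_iff).2 h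

end IsStar

lemma PMOn.eq_of_inc {F : E → Prop} (hF : PMOn p q S F) (hv : v ∈ S) (ha : Inc p q v a)
    (hb : Inc p q v b) (hFa : F a) (hFb : F b) : a = b :=
  (hF v hv).unique ⟨ha, hFa⟩ ⟨hb, hFb⟩

variable [Fintype E]

lemma CubicOn.exists_isStar (h : CubicOn p q S L) (hv : v ∈ S) (hm : Inc p q v m) :
    ∃ a b, IsStar p q v m a b := by
  obtain ⟨a, b, h1, h2, h3, h4⟩ := h.exists_star hv hm
  exact ⟨a, b, h1, h2, h3, h4⟩

lemma exists_inc_of_mem_cut {D : Finset V} (hf : f ∈ cut p q D) : ∃ v ∈ D, Inc p q v f :=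
  ⟨_, outer_mem hf, (inc_iff_outer hf (outer_mem hf)).2 rfl⟩

lemma notMem_cut_of_mem_inner {D : Finset V} (hf : f ∈ inner p q D) : f ∉ cut p q D := by
  rw [mem_inner] at hf; rw [mem_cut]; tauto

variable (h : CubicOn p q S L) (h7 : 7 ≤ S.card)
  (h5 : ∀ Q ⊆ S, 3 ≤ Q.card → 3 ≤ (S \ Q).card → 5 ≤ (cut p q Q).card)
  (IH : SolvableBelow V E ι S.card) (huL : ∀ e, Inc p q u e → L e = none)

include h h7 h5 IH huL

/-- Deleting two adjacent vertices `x` and `y`, where `x` is adjacent to the root `u`. -/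
lemma solve_of_delete_two (he : Inc p q u e)
    (hh₁ : Joins p q h₁ u x) (hne : h₁ ≠ e) (sx : IsStar p q x h₁ m h₂) (hm : Joins p q m x y)
    (sy : IsStar p q y m k₁ k₂) (l : Option ι) (lm : L m = none ∨ L m = l)
    (lh : L h₂ = none ∨ L h₂ = l) (lk₁ : L k₁ = none ∨ L k₁ = l) (lk₂ : L k₂ = none ∨ L k₂ = l)
    (hit : ∀ F : E → Prop, PMOn p q S F → F e → ∀ i, l = some i →
      ∃ f, p f ≠ q f ∧ F f ∧ L f = some i) :
    ∃ F : E → Prop, PMOn p q S F ∧ Hits p q L F ∧ F e := by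
  have hS := h.locallySparse h7 h5
  have hE := h.ends
  obtain ⟨x₂, hh₂⟩ := sx.trd.exists_joins
  obtain ⟨s, hk₁⟩ := sy.snd.exists_joins
  obtain ⟨t, hk₂⟩ := sy.trd.exists_joins
  have hu := hh₁.mem_left hE
  have hx := hm.mem_left hE
  have hy := hm.mem_right hE
  set D : Finset V := {x, y} with hD
  have hDS : D ⊆ S := by simp [hD, insert_subset_iff, hx, hy]
  have hDc : D.card = 2 := card_pair hm.1
  have hxD : x ∈ D := by simp [hD]
  have hyD : y ∈ D := by simp [hD]
  have hmD : m ∈ inner p q D := hm.mem_inner hxD hyD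
  have out : ∀ {f a b}, f ≠ m → Joins p q f a b → a ∈ D → b ∉ D := fun hf hj ha =>
    hS.notMem_of_joins hDS (by omega) (by omega) (T := {m}) (by simpa using hmD) (by simp [hDc])
      (by simpa using hf) hj ha
  have huD := out sx.ne₁ hh₁.symm hxD
  have hx₂D := out sx.ne₃.symm hh₂ hxD
  have hsD := out sy.ne₁.symm hk₁ hyD
  have htD := out sy.ne₂.symm hk₂ hyD
  have hSS : S \ (S \ D) = D := Finset.sdiff_sdiff_eq_self hDS
  have W : ∀ {v}, v ∈ S → v ∉ D → v ∈ S \ D := fun h1 h2 => mem_sdiff.2 ⟨h1, h2⟩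
  have W' : ∀ {v}, v ∈ D → v ∉ S \ D := fun h1 h2 => (mem_sdiff.1 h2).2 h1
  have ne : ∀ {v w}, v ∈ D → w ∉ D → v ≠ w := by rintro v w h1 h2 rfl; exact h2 h1
  have hcut : ∀ f, f ∈ cut p q (S \ D) ↔ f = h₁ ∨ f = k₁ ∨ f = h₂ ∨ f = k₂ := by
    intro f
    rw [cut_sdiff hE]
    constructor
    · intro hf
      have hfm : f ≠ m := by rintro rfl; exact notMem_cut_of_mem_inner hmD hf
      obtain ⟨v, hv, hfv⟩ := exists_inc_of_mem_cut hf
      simp only [hD, mem_insert, mem_singleton] at hv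
      rcases hv with rfl | rfl
      · rcases (sx.inc_iff f).1 hfv with rfl | rfl | rfl
        exacts [.inl rfl, absurd rfl hfm, .inr (.inr (.inl rfl))]
      · rcases (sy.inc_iff f).1 hfv with rfl | rfl | rfl
        exacts [absurd rfl hfm, .inr (.inl rfl), .inr (.inr (.inr rfl))]
    · rintro (rfl | rfl | rfl | rfl)
      exacts [hh₁.symm.mem_cut hxD huD, hk₁.mem_cut hyD hsD, hh₂.mem_cut hxD hx₂D,
        hk₂.mem_cut hyD htD]
  have o₁ : outer p q (S \ D) h₁ = u := hh₁.outer_eq (W hu huD) (W' hxD)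
  have o₂ : outer p q (S \ D) h₂ = x₂ := hh₂.symm.outer_eq (W (hh₂.mem_right hE) hx₂D) (W' hxD)
  have o₃ : outer p q (S \ D) k₁ = s := hk₁.symm.outer_eq (W (hk₁.mem_right hE) hsD) (W' hyD)
  have o₄ : outer p q (S \ D) k₂ = t := hk₂.symm.outer_eq (W (hk₂.mem_right hE) htD) (W' hyD)
  have f₁ := hS.far hE hh₁ hm hk₁ (ne hyD huD).symm (ne hxD hsD)
  have f₁' := hS.far hE hh₁ hm hk₂ (ne hyD huD).symm (ne hxD htD)
  have f₂ := hS.far hE hh₂.symm hm hk₂ (ne hyD hx₂D).symm (ne hxD htD)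
  have n₁ := hk₁.ne_of_inc sx.fst hm.1 (ne hxD hsD)
  have n₂ := hk₁.ne_of_inc sx.trd hm.1 (ne hxD hsD)
  have n₃ := hk₂.ne_of_inc sx.fst hm.1 (ne hxD htD)
  have n₄ := hk₂.ne_of_inc sx.trd hm.1 (ne hxD htD)
  obtain ⟨H, σ, k, hH, hσ₁, hσ₂⟩ := exists_fusion_two (W := S \ D)
    (by simp [n₁.symm, sx.ne₂, n₃.symm, n₂, sy.ne₃, n₄.symm] : [h₁, k₁, h₂, k₂].Nodup) hcut
    (by rw [o₁, o₃]; exact f₁) (by rw [o₂, o₄]; exact f₂)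
  have heW : e ∉ cut p q (S \ D) := by
    rw [hcut]
    rintro (rfl | rfl | rfl | rfl)
    · exact hne rfl
    · exact ((hk₁.inc_iff).1 he).elim (ne hyD huD).symm f₁.1
    · rcases (hh₂.inc_iff).1 he with h | h
      · exact hh₁.1 h
      · exact sx.ne₂ (hS.eq_of_joins hE hh₁.symm (h ▸ hh₂))
    · exact ((hk₂.inc_iff).1 he).elim (ne hyD huD).symm f₁'.1
  refine k.solve h h5 IH sdiff_subset (by rw [hSS, hDc]) (W hu huD) hH huL he heW l ?_ ?_
  · rw [hSS]
    intro v hv f hf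
    simp only [hD, mem_insert, mem_singleton] at hv
    rcases hv with rfl | rfl
    · rcases (sx.inc_iff f).1 hf with rfl | rfl | rfl
      exacts [.inl (huL _ hh₁.left), lm, lh]
    · rcases (sy.inc_iff f).1 hf with rfl | rfl | rfl
      exacts [lm, lk₁, lk₂]
  · rw [hSS]
    intro F₀ hF₀ hσ hFe
    have c₁ := hσ h₁ ((hcut _).2 (by simp))
    have c₂ := hσ h₂ ((hcut _).2 (by simp))
    rw [hσ₁] at c₁
    rw [hσ₂] at c₂
    have d₁ : ¬F₀ h₁ := fun hc => hne (hF₀.eq_of_inc (W hu huD) hh₁.left he hc hFe)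
    have d₂ : ¬F₀ k₁ := fun hc => d₁ (c₁.1 hc)
    refine ⟨fun f => if f = m then ¬F₀ h₂ else F₀ f, ?_, fun f hf => ?_,
      fun F hF hFe _ i hi => hit F hF hFe i hi⟩
    · intro v hv
      simp only [hD, mem_insert, mem_singleton] at hv
      rcases hv with rfl | rfl
      · apply sx.existsUnique
        simp only [sx.ne₁, sx.ne₃.symm, if_true, if_false, ExactlyOne, d₁]
        by_cases hc : F₀ h₂ <;> simp [hc]
      · apply sy.existsUnique
        simp only [sy.ne₁.symm, sy.ne₂.symm, if_true, if_false, ExactlyOne, d₂, c₂]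
        by_cases hc : F₀ h₂ <;> simp [hc]
    · have hfm : f ≠ m := by
        rintro rfl; exact notMem_cut_of_mem_inner hmD (cut_sdiff hE ▸ hf)
      simp [hfm]

/-- Deleting the path `x, y, y₁, z₁`, where `x` is adjacent to the root `u`. -/
lemma solve_of_delete_four {y₁ z₁ : V} (he : Joins p q e u v)
    (hh₁ : Joins p q h₁ u x) (hne : h₁ ≠ e) (sx : IsStar p q x h₁ m h₂) (hm : Joins p q m x y)
    (sy : IsStar p q y m k₁ k₂) (hk₁ : Joins p q k₁ y y₁) (sy₁ : IsStar p q y₁ k₁ o r)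
    (ho : Joins p q o y₁ z₁) (sz₁ : IsStar p q z₁ o o₂ s) (hs : Joins p q s z₁ w)
    (hfar : Far p q w u) (hvz : v ≠ z₁) {i : ι} (lm : L m = none) (lh : L h₂ = none)
    (lk₁ : L k₁ = some i) (lk₂ : L k₂ = some i) (lo : L o = some i) (lr : L r = none)
    (lo₂ : L o₂ = some i) (ls : L s = none) :
    ∃ F : E → Prop, PMOn p q S F ∧ Hits p q L F ∧ F e := by
  have hS := h.locallySparse h7 h5
  have hE := h.ends
  obtain ⟨x₂, hh₂⟩ := sx.trd.exists_joins
  obtain ⟨y₂, hk₂⟩ := sy.trd.exists_joins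
  obtain ⟨w₁, hr⟩ := sy₁.trd.exists_joins
  obtain ⟨z₂, ho₂⟩ := sz₁.snd.exists_joins
  have hu := hh₁.mem_left hE
  have xy := hm.1
  have yy₁ := hk₁.1
  have yz₁ := ho.1
  have xy₁ : x ≠ y₁ := by rintro rfl; exact sy.ne₁ (hS.eq_of_joins hE hm.symm hk₁)
  have xz₁ : x ≠ z₁ := by rintro rfl; exact hS.no_triangle hE hm hk₁ ho
  have yz : y ≠ z₁ := by rintro rfl; exact sy₁.ne₁ (hS.eq_of_joins hE hk₁.symm ho)
  set D : Finset V := {x, y, y₁, z₁} with hD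
  have hDS : D ⊆ S := by
    simp [hD, insert_subset_iff, hm.mem_left hE, hm.mem_right hE, ho.mem_left hE, ho.mem_right hE]
  have hDc : D.card = 4 := by
    rw [hD, card_insert_of_notMem (by simp [xy, xy₁, xz₁]),
      card_insert_of_notMem (by simp [yy₁, yz]), card_pair yz₁]
  have hxD : x ∈ D := by simp [hD]
  have hyD : y ∈ D := by simp [hD]
  have hy₁D : y₁ ∈ D := by simp [hD]
  have hz₁D : z₁ ∈ D := by simp [hD]
  have mk : m ≠ k₁ := sy.ne₁
  have ko : k₁ ≠ o := sy₁.ne₁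
  have mo : m ≠ o := (ho.ne_of_inc sx.snd xy₁ xz₁).symm
  have hT : ({m, k₁, o} : Finset E) ⊆ inner p q D := by
    simp [insert_subset_iff, hm.mem_inner hxD hyD, hk₁.mem_inner hyD hy₁D, ho.mem_inner hy₁D hz₁D]
  have out : ∀ {f a b}, f ≠ m → f ≠ k₁ → f ≠ o → Joins p q f a b → a ∈ D → b ∉ D :=
    fun h1 h2 h3 hj ha => hS.notMem_of_joins hDS (by omega) (by omega) hT
      (by rw [hDc, card_eq_three.2 ⟨m, k₁, o, mk, mo, ko, rfl⟩]) (by simp [h1, h2, h3]) hj ha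
  have huD := out sx.ne₁ (hk₁.ne_of_inc sx.fst xy xy₁).symm (ho.ne_of_inc sx.fst xy₁ xz₁).symm
    hh₁.symm hxD
  have hx₂D := out sx.ne₃.symm (hk₁.ne_of_inc sx.trd xy xy₁).symm
    (ho.ne_of_inc sx.trd xy₁ xz₁).symm hh₂ hxD
  have hy₂D := out sy.ne₂.symm sy.ne₃.symm (ho.ne_of_inc sy.trd yy₁ yz).symm hk₂ hyD
  have hw₁D := out (hm.ne_of_inc sy₁.trd xy₁.symm yy₁.symm).symm sy₁.ne₂.symm sy₁.ne₃.symm hr hy₁D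
  have hz₂D := out (hm.ne_of_inc sz₁.snd xz₁.symm yz.symm).symm
    (hk₁.ne_of_inc sz₁.snd yz.symm yz₁.symm).symm sz₁.ne₁.symm ho₂ hz₁D
  have hwD := out (hm.ne_of_inc sz₁.trd xz₁.symm yz.symm).symm
    (hk₁.ne_of_inc sz₁.trd yz.symm yz₁.symm).symm sz₁.ne₂.symm hs hz₁D
  have hSS : S \ (S \ D) = D := Finset.sdiff_sdiff_eq_self hDS
  have W : ∀ {v}, v ∈ S → v ∉ D → v ∈ S \ D := fun h1 h2 => mem_sdiff.2 ⟨h1, h2⟩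
  have W' : ∀ {v}, v ∈ D → v ∉ S \ D := fun h1 h2 => (mem_sdiff.1 h2).2 h1
  have ne : ∀ {v w}, v ∈ D → w ∉ D → v ≠ w := by rintro v w h1 h2 rfl; exact h2 h1
  have hin : ∀ {f}, f ∈ cut p q (S \ D) → f ≠ m ∧ f ≠ k₁ ∧ f ≠ o := by
    intro f hf
    rw [cut_sdiff hE] at hf
    refine ⟨?_, ?_, ?_⟩ <;> rintro rfl <;>
      exact notMem_cut_of_mem_inner (hT (by simp)) hf
  have hcut : ∀ f, f ∈ cut p q (S \ D) ↔ f = k₂ ∨ f = h₂ ∨ f = o₂ ∨ f = r ∨ f = s ∨ f = h₁ := by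
    intro f
    constructor
    · intro hf
      obtain ⟨g1, g2, g3⟩ := hin hf
      rw [cut_sdiff hE] at hf
      obtain ⟨v, hv, hfv⟩ := exists_inc_of_mem_cut hf
      simp only [hD, mem_insert, mem_singleton] at hv
      rcases hv with rfl | rfl | rfl | rfl
      · rcases (sx.inc_iff f).1 hfv with rfl | rfl | rfl <;> simp at g1 ⊢
      · rcases (sy.inc_iff f).1 hfv with rfl | rfl | rfl <;> simp at g1 g2 ⊢
      · rcases (sy₁.inc_iff f).1 hfv with rfl | rfl | rfl <;> simp at g2 g3 ⊢
      · rcases (sz₁.inc_iff f).1 hfv with rfl | rfl | rfl <;> simp at g3 ⊢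
    · rw [cut_sdiff hE]
      rintro (rfl | rfl | rfl | rfl | rfl | rfl)
      exacts [hk₂.mem_cut hyD hy₂D, hh₂.mem_cut hxD hx₂D, ho₂.mem_cut hz₁D hz₂D,
        hr.mem_cut hy₁D hw₁D, hs.mem_cut hz₁D hwD, hh₁.symm.mem_cut hxD huD]
  have o₁ : outer p q (S \ D) h₁ = u := hh₁.outer_eq (W hu huD) (W' hxD)
  have oo : ∀ {f a b}, Joins p q f a b → a ∈ D → b ∉ D → outer p q (S \ D) f = b :=
    fun hj ha hb => hj.symm.outer_eq (W (hj.mem_right hE) hb) (W' ha)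
  have f₁ := hS.far hE hk₂.symm hm.symm hh₂ (ne hxD hy₂D).symm (ne hyD hx₂D)
  have f₂ := hS.far hE ho₂.symm ho.symm hr (ne hy₁D hz₂D).symm (ne hz₁D hw₁D)
  have nn : ∀ {f g a b c}, Inc p q a f → Joins p q g b c → a ∈ D → c ∉ D → a ≠ b → f ≠ g :=
    fun hf hg ha hc hab => (hg.ne_of_inc hf hab (ne ha hc)).symm
  obtain ⟨H, σ, k, hH, hσ₁, hσ₂, hσ₃⟩ := exists_fusion_three (W := S \ D)
    (a := k₂) (b := h₂) (c := o₂) (d := r) (r := s) (s := h₁)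
    (by
      simp only [List.nodup_cons, List.mem_cons, List.not_mem_nil, not_or, or_false,
        not_false_eq_true, List.nodup_nil, and_true]
      exact ⟨⟨nn sy.trd hh₂ hyD hx₂D xy.symm, nn sy.trd ho₂ hyD hz₂D yz,
        nn sy.trd hr hyD hw₁D yy₁, nn sy.trd hs hyD hwD yz, nn sy.trd hh₁.symm hyD huD xy.symm⟩,
        ⟨nn sx.trd ho₂ hxD hz₂D xz₁, nn sx.trd hr hxD hw₁D xy₁, nn sx.trd hs hxD hwD xz₁,
          sx.ne₂.symm⟩,
        ⟨nn sz₁.snd hr hz₁D hw₁D yz₁.symm, sz₁.ne₃, nn sz₁.snd hh₁.symm hz₁D huD xz₁.symm⟩,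
        ⟨nn sy₁.trd hs hy₁D hwD yz₁, nn sy₁.trd hh₁.symm hy₁D huD xy₁.symm⟩,
        nn sz₁.trd hh₁.symm hz₁D huD xz₁.symm⟩) hcut
    (by rw [oo hk₂ hyD hy₂D, oo hh₂ hxD hx₂D]; exact f₁)
    (by rw [oo ho₂ hz₁D hz₂D, oo hr hy₁D hw₁D]; exact f₂)
    (by rw [oo hs hz₁D hwD, o₁]; exact hfar)
  have hvD : v ∉ D := by
    simp only [hD, mem_insert, mem_singleton, not_or]
    refine ⟨?_, ?_, ?_, hvz⟩
    · rintro rfl; exact hne (hS.eq_of_joins hE hh₁ he)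
    · rintro rfl; exact hS.no_triangle hE hh₁ hm he.symm
    · rintro rfl; exact hS.no_square hE hh₁ hm hk₁ he.symm (ne hyD huD).symm xy₁
  have heW : e ∉ cut p q (S \ D) := fun hc =>
    notMem_cut_of_mem_inner (he.mem_inner (W hu huD) (W (he.mem_right hE) hvD)) hc
  refine k.solve h h5 IH sdiff_subset (by rw [hSS, hDc]; omega) (W hu huD) hH huL he.left heW
    (some i) ?_ ?_
  · rw [hSS]
    intro v hv f hf
    simp only [hD, mem_insert, mem_singleton] at hv
    rcases hv with rfl | rfl | rfl | rfl
    · rcases (sx.inc_iff f).1 hf with rfl | rfl | rfl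
      exacts [.inl (huL _ hh₁.left), .inl lm, .inl lh]
    · rcases (sy.inc_iff f).1 hf with rfl | rfl | rfl
      exacts [.inl lm, .inr lk₁, .inr lk₂]
    · rcases (sy₁.inc_iff f).1 hf with rfl | rfl | rfl
      exacts [.inr lk₁, .inr lo, .inl lr]
    · rcases (sz₁.inc_iff f).1 hf with rfl | rfl | rfl
      exacts [.inr lo, .inr lo₂, .inl ls]
  · rw [hSS]
    intro F₀ hF₀ hσ hFe
    have c₁ := hσ k₂ ((hcut _).2 (by simp))
    have c₂ := hσ o₂ ((hcut _).2 (by simp))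
    have c₃ := hσ s ((hcut _).2 (by simp))
    rw [hσ₁] at c₁
    rw [hσ₂] at c₂
    rw [hσ₃] at c₃
    have d₁ : ¬F₀ h₁ := fun hc => hne (hF₀.eq_of_inc (W hu huD) hh₁.left he.left hc hFe)
    have d₂ : ¬F₀ s := fun hc => d₁ (c₃.2 hc)
    set FD : E → Prop := fun f => if f = m then ¬F₀ h₂ else if f = k₁ then False else
      if f = o then ¬F₀ r else F₀ f with hFD
    have em : FD m ↔ ¬F₀ h₂ := by simp [hFD]
    have ek : ¬FD k₁ := by simp [hFD, mk.symm]
    have eo : FD o ↔ ¬F₀ r := by simp [hFD, mo.symm, ko.symm]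
    have ef : ∀ {f}, f ∈ cut p q (S \ D) → (F₀ f ↔ FD f) := by
      intro f hf
      obtain ⟨g1, g2, g3⟩ := hin hf
      simp [hFD, g1, g2, g3]
    have e₁ := ef ((hcut h₁).2 (by simp))
    have e₂ := ef ((hcut h₂).2 (by simp))
    have e₃ := ef ((hcut k₂).2 (by simp))
    have e₄ := ef ((hcut r).2 (by simp))
    have e₅ := ef ((hcut o₂).2 (by simp))
    have e₆ := ef ((hcut s).2 (by simp))
    clear_value FD
    refine ⟨FD, ?_, fun f hf => ef hf, fun F hF hFe hFF j hj => ?_⟩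
    · intro v hv
      simp only [hD, mem_insert, mem_singleton] at hv
      rcases hv with rfl | rfl | rfl | rfl
      · apply sx.existsUnique
        rw [em, ← e₁, ← e₂, ExactlyOne]
        simp only [d₁]; by_cases hc : F₀ h₂ <;> simp [hc]
      · apply sy.existsUnique
        rw [em, ← e₃, ExactlyOne]
        simp only [ek, ← c₁]; by_cases hc : F₀ h₂ <;> simp [hc]
      · apply sy₁.existsUnique
        rw [eo, ← e₄, ExactlyOne]
        simp only [ek]; by_cases hc : F₀ r <;> simp [hc]
      · apply sz₁.existsUnique
        rw [eo, ← e₅, ← e₆, ExactlyOne]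
        simp only [d₂, ← c₂]; by_cases hc : F₀ r <;> simp [hc]
    · cases hj
      by_cases hc : F₀ r
      · exact ⟨o₂, ho₂.ends_ne, (hFF o₂ (sz₁.snd.mem hz₁D)).2 (e₅.1 (c₂.1 hc)), lo₂⟩
      · exact ⟨o, ho.ends_ne, (hFF o (sz₁.fst.mem hz₁D)).2 (eo.2 hc), lo⟩

end Configurations

section HighlyConnected

open Finset
open scoped Classical

variable {V E ι : Type*} {p q : E → V} {S : Finset V} {L : E → Option ι} {u v w x x₂ y y₁ z : V}
  {e a b c f g m o r h₁ h₂ k₁ k₂ s : E} {i j : ι}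

/-- Some edge at `v` has label `i`. -/
def Marked (p q : E → V) (L : E → Option ι) (i : ι) (v : V) : Prop :=
  ∃ f, Inc p q v f ∧ L f = some i

variable [Fintype E]

lemma CubicOn.labels (h : CubicOn p q S L) (hv : v ∈ S) (st : IsStar p q v a b c) :
    L a = L b ∧ L c = none ∨ L a = L c ∧ L b = none ∨ L b = L c ∧ L a = none := by
  obtain ⟨a', b', c', hab, hac, hbc, hs, h1, h2⟩ := h.star v hv
  have ha := (hs a).1 st.fst
  have hb := (hs b).1 st.snd
  have hc := (hs c).1 st.trd
  have n₁ := st.ne₁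
  have n₂ := st.ne₂
  have n₃ := st.ne₃
  rcases ha with rfl | rfl | rfl <;> rcases hb with rfl | rfl | rfl <;>
    rcases hc with rfl | rfl | rfl <;> simp_all

lemma CubicOn.marked_unique (h : CubicOn p q S L) (hv : v ∈ S) (hi : Marked p q L i v)
    (hj : Marked p q L j v) : i = j := by
  obtain ⟨f, hf, hfi⟩ := hi
  obtain ⟨g, hg, hgj⟩ := hj
  obtain ⟨a, b, st⟩ := h.exists_isStar hv hf
  have := h.labels hv st
  rcases (st.inc_iff g).1 hg with rfl | rfl | rfl <;> simp_all

lemma CubicOn.eq_some_of_marked (h : CubicOn p q S L) (hv : v ∈ S) (hi : Marked p q L i v)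
    (st : IsStar p q v a b c) (ha : L a = none) : L b = some i ∧ L c = some i := by
  obtain ⟨f, hf, hfi⟩ := hi
  have := h.labels hv st
  rcases (st.inc_iff f).1 hf with rfl | rfl | rfl <;> simp_all

lemma CubicOn.exists_isStar_of_some (h : CubicOn p q S L) (hv : v ∈ S) (hm : Inc p q v m)
    (hi : L m = some i) : ∃ a b, IsStar p q v m a b ∧ L a = some i ∧ L b = none := by
  obtain ⟨a, b, st⟩ := h.exists_isStar hv hm
  have := h.labels hv st
  by_cases hb : L b = none
  · exact ⟨a, b, st, by simp_all, hb⟩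
  · exact ⟨b, a, st.swap, by simp_all⟩

variable (h : CubicOn p q S L) (h7 : 7 ≤ S.card)
  (h5 : ∀ Q ⊆ S, 3 ≤ Q.card → 3 ≤ (S \ Q).card → 5 ≤ (cut p q Q).card)
  (IH : SolvableBelow V E ι S.card)
  (hG : ¬∃ F : E → Prop, PMOn p q S F ∧ Hits p q L F ∧ F e)

include h h7 h5 IH hG

lemma eq_none_of_joins_root (huL : ∀ e, Inc p q u e → L e = none) (he : Inc p q u e)
    (hh₁ : Joins p q h₁ u x) (hne : h₁ ≠ e) (hf : Inc p q x f) : L f = none := by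
  by_contra hc
  obtain ⟨i, hi⟩ := Option.ne_none_iff_exists'.1 hc
  have hE := h.ends
  have hx := hh₁.mem_right hE
  obtain ⟨m, h₂, sx⟩ := h.exists_isStar hx hh₁.right
  have hl := h.eq_some_of_marked hx ⟨f, hf, hi⟩ sx (huL _ hh₁.left)
  obtain ⟨y, hm⟩ := sx.snd.exists_joins
  obtain ⟨k₁, k₂, sy, l₁, l₂⟩ := h.exists_isStar_of_some (hm.mem_right hE) hm.right hl.1
  refine hG (solve_of_delete_two h h7 h5 IH huL he hh₁ hne sx hm sy (some i) (.inr hl.1)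
    (.inr hl.2) (.inr l₁) (.inl l₂) fun F hF hFe j hj => ?_)
  cases hj
  obtain ⟨g, ⟨hg, hFg⟩, -⟩ := hF x hx
  rcases (sx.inc_iff g).1 hg with rfl | rfl | rfl
  · exact absurd (hF.eq_of_inc (hh₁.mem_left hE) hh₁.left he hFg hFe) hne
  · exact ⟨_, hg.ne, hFg, hl.1⟩
  · exact ⟨_, hg.ne, hFg, hl.2⟩

lemma exists_marked_of_joins_root (huL : ∀ e, Inc p q u e → L e = none) (he : Inc p q u e)
    (hh₁ : Joins p q h₁ u x) (hne : h₁ ≠ e) (sx : IsStar p q x h₁ m h₂) (hm : Joins p q m x y) :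
    ∃ i, Marked p q L i y := by
  by_contra hc
  have hl : ∀ f, Inc p q y f → L f = none := by
    intro f hf
    by_contra hf'
    obtain ⟨i, hi⟩ := Option.ne_none_iff_exists'.1 hf'
    exact hc ⟨i, f, hf, hi⟩
  have hE := h.ends
  obtain ⟨k₁, k₂, sy⟩ := h.exists_isStar (hm.mem_right hE) hm.right
  exact hG (solve_of_delete_two h h7 h5 IH huL he hh₁ hne sx hm sy none (.inl (hl _ sy.fst))
    (.inl (eq_none_of_joins_root h h7 h5 IH hG huL he hh₁ hne sx.trd))
    (.inl (hl _ sy.snd)) (.inl (hl _ sy.trd)) fun F hF hFe j hj => by cases hj)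

lemma not_marked_of_marked (huL : ∀ e, Inc p q u e → L e = none) (he : Inc p q u e)
    (hh₁ : Joins p q h₁ u x) (hne : h₁ ≠ e) (sx : IsStar p q x h₁ m h₂) (hm : Joins p q m x y)
    (hh₂ : Joins p q h₂ x x₂) (hy : Marked p q L i y) (hx₂ : Marked p q L i x₂) : False := by
  have hE := h.ends
  have lm := eq_none_of_joins_root h h7 h5 IH hG huL he hh₁ hne sx.snd
  have lh := eq_none_of_joins_root h h7 h5 IH hG huL he hh₁ hne sx.trd
  obtain ⟨k₁, k₂, sy⟩ := h.exists_isStar (hm.mem_right hE) hm.right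
  obtain ⟨g₁, g₂, sx₂⟩ := h.exists_isStar (hh₂.mem_right hE) hh₂.right
  obtain ⟨l₁, l₂⟩ := h.eq_some_of_marked (hm.mem_right hE) hy sy lm
  obtain ⟨l₃, l₄⟩ := h.eq_some_of_marked (hh₂.mem_right hE) hx₂ sx₂ lh
  refine hG (solve_of_delete_two h h7 h5 IH huL he hh₁ hne sx hm sy (some i) (.inl lm)
    (.inl lh) (.inr l₁) (.inr l₂) fun F hF hFe j hj => ?_)
  cases hj
  obtain ⟨f, ⟨hf, hFf⟩, -⟩ := hF y (hm.mem_right hE)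
  rcases (sy.inc_iff f).1 hf with rfl | rfl | rfl
  · obtain ⟨g, ⟨hg, hFg⟩, -⟩ := hF x₂ (hh₂.mem_right hE)
    rcases (sx₂.inc_iff g).1 hg with rfl | rfl | rfl
    · exact absurd (hF.eq_of_inc (hm.mem_left hE) sx.snd sx.trd hFf hFg) sx.ne₃
    · exact ⟨_, hg.ne, hFg, l₃⟩
    · exact ⟨_, hg.ne, hFg, l₄⟩
  · exact ⟨_, hf.ne, hFf, l₁⟩
  · exact ⟨_, hf.ne, hFf, l₂⟩

/-- From a marked vertex `y` at distance two from the root, two steps along its label lead to the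
end `v` of the prescribed edge or to a neighbour of the third neighbour of the root. -/
lemma exists_blocking {x' : V} {h' : E} (huL : ∀ e, Inc p q u e → L e = none)
    (he : Joins p q e u v) (su : IsStar p q u e h₁ h') (hh₁ : Joins p q h₁ u x)
    (hh' : Joins p q h' u x') (sx : IsStar p q x h₁ m h₂) (hm : Joins p q m x y)
    (hy : Marked p q L i y) (sy : IsStar p q y m k₁ k₂) (hk₁ : Joins p q k₁ y y₁) :
    ∃ z o, Marked p q L i z ∧ o ≠ k₁ ∧ Joins p q o y₁ z ∧ (z = v ∨ ∃ s, Joins p q s x' z) := by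
  have hS := h.locallySparse h7 h5
  have hE := h.ends
  have hne := su.ne₁.symm
  have lm := eq_none_of_joins_root h h7 h5 IH hG huL he.left hh₁ hne sx.snd
  have lh := eq_none_of_joins_root h h7 h5 IH hG huL he.left hh₁ hne sx.trd
  obtain ⟨l₁, l₂⟩ := h.eq_some_of_marked (hm.mem_right hE) hy sy lm
  obtain ⟨o, r, sy₁, lo, lr⟩ := h.exists_isStar_of_some (hk₁.mem_right hE) hk₁.right l₁
  obtain ⟨z, ho⟩ := sy₁.snd.exists_joins
  obtain ⟨o₂, s, sz, lo₂, ls⟩ := h.exists_isStar_of_some (ho.mem_right hE) ho.right lo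
  obtain ⟨w, hs⟩ := sz.trd.exists_joins
  have hz : Marked p q L i z := ⟨o, ho.right, lo⟩
  refine ⟨z, o, hz, sy₁.ne₁.symm, ho, ?_⟩
  by_contra hc
  push Not at hc
  obtain ⟨hzv, hzx'⟩ := hc
  have off : ∀ {g a}, Joins p q g u a → g ≠ e → ∀ f, Inc p q a f → L f = none :=
    fun hg hge f hf => eq_none_of_joins_root h h7 h5 IH hG huL he.left hg hge hf
  have huz : ¬Inc p q u o := fun hc => by simp [huL _ hc] at lo
  have hse : s ≠ e := by
    rintro rfl
    rcases he.inc_iff.1 hs.left with rfl | rfl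
    · exact huz ho.right
    · exact hzv rfl
  refine hG (solve_of_delete_four h h7 h5 IH huL he hh₁ hne sx hm sy hk₁ sy₁ ho sz hs ⟨?_, ?_⟩
    (Ne.symm hzv) lm lh l₁ l₂ lo lr lo₂ ls)
  · rintro rfl
    simp [off hs.symm hse o ho.right] at lo
  · intro g hg
    rcases (su.inc_iff g).1 hg.right with rfl | rfl | rfl
    · obtain rfl := he.right_unique hg.symm
      have hvL : ∀ f, Inc p q v f → L f = none := by
        intro f hf
        by_contra hf'
        obtain ⟨j, hj⟩ := Option.ne_none_iff_exists'.1 hf'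
        obtain ⟨a, b, sv⟩ := h.exists_isStar (he.mem_right hE) he.right
        obtain ⟨la, lb⟩ := h.eq_some_of_marked (he.mem_right hE) ⟨f, hf, hj⟩ sv (huL _ he.left)
        rcases (sv.inc_iff s).1 hs.right with rfl | rfl | rfl
        · exact hse rfl
        · simp [ls] at la
        · simp [ls] at lb
      simp [eq_none_of_joins_root h h7 h5 IH hG hvL he.right hs.symm hse ho.right] at lo
    · obtain rfl := hh₁.right_unique hg.symm
      rcases (sx.inc_iff s).1 hs.right with rfl | rfl | rfl
      · obtain rfl := hh₁.symm.right_unique hs.symm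
        exact huz ho.right
      · obtain rfl := hm.right_unique hs.symm
        exact sy₁.ne₁ (hS.eq_of_joins hE hk₁ ho.symm)
      · exact not_marked_of_marked h h7 h5 IH hG huL he.left hh₁ hne sx hm hs.symm hy hz
    · obtain rfl := hh'.right_unique hg.symm
      exact hzx' s hs.symm

lemma marked_far_end {x' : V} {h' : E} (huL : ∀ e, Inc p q u e → L e = none)
    (he : Joins p q e u v) (su : IsStar p q u e h₁ h') (hh₁ : Joins p q h₁ u x)
    (hh' : Joins p q h' u x') (sx : IsStar p q x h₁ m h₂) (hm : Joins p q m x y)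
    (hy : Marked p q L i y) : Marked p q L i v := by
  have hS := h.locallySparse h7 h5
  have hE := h.ends
  obtain ⟨k₁, k₂, sy⟩ := h.exists_isStar (hm.mem_right hE) hm.right
  obtain ⟨y₁, hk₁⟩ := sy.snd.exists_joins
  obtain ⟨y₂, hk₂⟩ := sy.trd.exists_joins
  obtain ⟨z₁, o₁, mz₁, no₁, ho₁, hz₁⟩ :=
    exists_blocking h h7 h5 IH hG huL he su hh₁ hh' sx hm hy sy hk₁
  obtain ⟨z₂, o₂, mz₂, no₂, ho₂, hz₂⟩ :=
    exists_blocking h h7 h5 IH hG huL he su hh₁ hh' sx hm hy sy.swap hk₂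
  obtain rfl | ⟨s₁, hs₁⟩ := hz₁
  · exact mz₁
  obtain rfl | ⟨s₂, hs₂⟩ := hz₂
  · exact mz₂
  have hss : s₁ ≠ s₂ := by
    rintro rfl
    obtain rfl := hs₁.right_unique hs₂
    refine hS.no_square hE hk₁ ho₁ ho₂.symm hk₂.symm ?_ ?_
    · rintro rfl; exact no₁ (hS.eq_of_joins hE ho₁.symm hk₁)
    · rintro rfl; exact sy.ne₃ (hS.eq_of_joins hE hk₁ hk₂)
  have hn : ∀ {s z}, Joins p q s x' z → Marked p q L i z → s ≠ h' := by
    rintro s z hs ⟨f, hf, hfi⟩ rfl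
    obtain rfl := hh'.symm.right_unique hs
    simp [huL f hf] at hfi
  obtain ⟨a, b, sx'⟩ := h.exists_isStar (hh'.mem_right hE) hh'.right
  have n₁ := hn hs₁ mz₁
  have n₂ := hn hs₂ mz₂
  have key : IsStar p q x' h' s₁ s₂ := by
    have i₁ := (sx'.inc_iff s₁).1 hs₁.left
    have i₂ := (sx'.inc_iff s₂).1 hs₂.left
    rcases i₁ with rfl | rfl | rfl <;> rcases i₂ with rfl | rfl | rfl <;>
      first | exact absurd rfl n₁ | exact absurd rfl n₂ | exact absurd rfl hss | exact sx' |
        exact sx'.swap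
  exact (not_marked_of_marked h h7 h5 IH hG huL he.left hh' su.ne₂.symm key hs₁ hs₂ mz₁ mz₂).elim

omit hG in
/-- The case without small nontrivial cuts. -/
lemma CubicOn.solve_of_five_le (hu : u ∈ S) (huL : ∀ e, Inc p q u e → L e = none)
    (he : Inc p q u e) : ∃ F : E → Prop, PMOn p q S F ∧ Hits p q L F ∧ F e := by
  by_contra hG
  have hE := h.ends
  obtain ⟨v, he'⟩ := he.exists_joins
  obtain ⟨h₁, h', su⟩ := h.exists_isStar hu he
  obtain ⟨x, hh₁⟩ := su.snd.exists_joins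
  obtain ⟨x', hh'⟩ := su.trd.exists_joins
  obtain ⟨m, h₂, sx⟩ := h.exists_isStar (hh₁.mem_right hE) hh₁.right
  obtain ⟨y, hm⟩ := sx.snd.exists_joins
  obtain ⟨x₂, hh₂⟩ := sx.trd.exists_joins
  have hne := su.ne₁.symm
  obtain ⟨i, hi⟩ := exists_marked_of_joins_root h h7 h5 IH hG huL he hh₁ hne sx hm
  obtain ⟨j, hj⟩ := exists_marked_of_joins_root h h7 h5 IH hG huL he hh₁ hne sx.swap hh₂
  have vi := marked_far_end h h7 h5 IH hG huL he' su hh₁ hh' sx hm hi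
  have vj := marked_far_end h h7 h5 IH hG huL he' su hh₁ hh' sx.swap hh₂ hj
  obtain rfl := h.marked_unique (he'.mem_right hE) vi vj
  exact not_marked_of_marked h h7 h5 IH hG huL he hh₁ hne sx hm hh₂ hi hj

end HighlyConnected

section Induction

open Finset
open scoped Classical

variable {V E ι : Type*} {p q : E → V} {S T : Finset V} {L : E → Option ι} {F : E → Prop}
  {a b c d u v : V} {e f g : E}

/-- `F` is a perfect matching of the vertex set `T`, without edges elsewhere. -/
def Matches (p q : E → V) (T : Finset V) (F : E → Prop) : Prop :=
  PMOn p q T F ∧ ∀ f, F f → p f ∈ T ∧ q f ∈ T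

lemma matches_empty : Matches p q ∅ fun _ => False := by simp [Matches, PMOn]

lemma Matches.insert (h : Matches p q T F) (hg : Joins p q g a b) (ha : a ∉ T) (hb : b ∉ T) :
    Matches p q (insert a (insert b T)) fun f => f = g ∨ F f := by
  have hT : ∀ {f v}, F f → Inc p q v f → v ∈ T := by
    intro f v hf hv
    obtain ⟨h1, h2⟩ := h.2 f hf
    by_contra hvT
    refine hv ⟨fun h => absurd (h ▸ h1) hvT, fun h => absurd (h ▸ h2) hvT⟩
  refine ⟨fun v hv => ?_, ?_⟩
  · by_cases hvT : v ∈ T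
    · obtain ⟨f, ⟨h1, h2⟩, h3⟩ := h.1 v hvT
      refine ⟨f, ⟨h1, .inr h2⟩, ?_⟩
      rintro f' ⟨h4, rfl | h5⟩
      · rcases hg.inc_iff.1 h4 with rfl | rfl
        exacts [absurd hvT ha, absurd hvT hb]
      · exact h3 f' ⟨h4, h5⟩
    · have : v = a ∨ v = b := by simpa [hvT] using hv
      refine ⟨g, ⟨hg.inc_iff.2 this, .inl rfl⟩, ?_⟩
      rintro f' ⟨h4, rfl | h5⟩
      · rfl
      · exact absurd (hT h5 h4) hvT
  · rintro f (rfl | hf)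
    · obtain ⟨-, ⟨rfl, rfl⟩ | ⟨rfl, rfl⟩⟩ := hg <;> simp
    · have := h.2 f hf; simp [this]

variable [Fintype E]

lemma joins_of_mem_inner_pair (hg : g ∈ inner p q {a, b}) : Joins p q g a b := by
  obtain ⟨h1, h2, h3⟩ := mem_inner.1 hg
  simp only [mem_insert, mem_singleton] at h2 h3
  rcases h2 with h2 | h2 <;> rcases h3 with h3 | h3
  · exact absurd (h2.trans h3.symm) h1
  · exact ⟨fun h => h1 (by rw [h2, h3, h]), .inl ⟨h2, h3⟩⟩
  · exact ⟨fun h => h1 (by rw [h2, h3, h]), .inr ⟨h2, h3⟩⟩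
  · exact absurd (h2.trans h3.symm) h1

variable (h : CubicOn p q S L)

include h

lemma CubicOn.card_inner_pair (h3 : 3 ≤ S.card) (ha : a ∈ S) (hb : b ∈ S) :
    (inner p q {a, b}).card ≤ 1 := by
  by_cases hab : a = b
  · subst hab
    rw [card_le_one]
    intro f hf
    exact absurd rfl (joins_of_mem_inner_pair hf).1
  have hQ : ({a, b} : Finset V) ⊆ S := by simp [insert_subset_iff, ha, hb]
  have hc := h.card_cut hQ
  have h2 := card_pair hab
  have := h.conn _ hQ ⟨a, by simp⟩ (by rintro h4; rw [h4] at h2; omega)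
  omega

lemma CubicOn.exists_matches (h6 : S.card ≤ 6) (hu : u ∈ S) (he : Inc p q u e) :
    ∃ F : E → Prop, PMOn p q S F ∧ F e := by
  have hE := h.ends
  obtain ⟨v, he⟩ := he.exists_joins
  have hv := he.mem_right hE
  have hQ : ({u, v} : Finset V) ⊆ S := by simp [insert_subset_iff, hu, hv]
  set R := S \ {u, v} with hR
  have hSR : S = insert u (insert v R) := by
    ext x; simp only [hR, mem_insert, mem_sdiff, mem_singleton]
    constructor
    · tauto
    · rintro (rfl | rfl | ⟨h, -⟩) <;> assumption
  have huR : u ∉ R := by simp [hR]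
  have hvR : v ∉ R := by simp [hR]
  have hRS : R ⊆ S := sdiff_subset
  have hsum : R.card + 2 = S.card := by
    rw [← card_pair he.1]; exact card_sdiff_add_card_eq_card hQ
  have hcutS : cut p q S = ∅ := by
    ext f; simp [mem_cut, hE f]
  have c₀ := h.card_cut subset_rfl
  rw [hcutS, card_empty] at c₀
  have c₁ := h.card_cut hQ
  have c₂ := h.card_cut hRS
  rw [cut_sdiff hE] at c₂
  rw [card_pair he.1] at c₁
  have c₃ : 0 < (inner p q {u, v}).card := card_pos.2 ⟨e, he.mem_inner (by simp) (by simp)⟩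
  suffices hs : ∃ F : E → Prop, Matches p q R F by
    obtain ⟨F, hF⟩ := hs
    have := (hF.insert he huR hvR).1
    rw [← hSR] at this
    exact ⟨_, this, .inl rfl⟩
  obtain hn | hn | hn : R.card = 0 ∨ R.card = 2 ∨ R.card = 4 := by omega
  · rw [card_eq_zero] at hn
    exact ⟨_, hn ▸ matches_empty⟩
  · obtain ⟨a, b, -, hab⟩ := card_eq_two.1 hn
    obtain ⟨g, hg⟩ : (inner p q R).Nonempty := card_pos.1 (by omega)
    rw [hab] at hg
    exact ⟨_, hab ▸ matches_empty.insert (joins_of_mem_inner_pair hg) (by simp) (by simp)⟩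
  · obtain ⟨a, haR⟩ : R.Nonempty := card_pos.1 (by omega)
    obtain ⟨b, c, d, hbc, hbd, hcd, hbcd⟩ := card_eq_three.1
      (show (R.erase a).card = 3 by rw [card_erase_of_mem haR]; omega)
    have hR4 : R = {a, b, c, d} := by rw [← hbcd, insert_erase haR]
    have hna : a ∉ ({b, c, d} : Finset V) := by rw [← hbcd]; simp
    simp only [mem_insert, mem_singleton, not_or] at hna
    have mem : ∀ x ∈ ({a, b, c, d} : Finset V), x ∈ S := by rw [← hR4]; exact hRS
    simp only [mem_insert, mem_singleton, forall_eq_or_imp, forall_eq] at mem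
    obtain ⟨ma, mb, mc, md⟩ := mem
    have key : ∀ {a b c d : V}, a ∈ S → b ∈ S → c ∈ S → d ∈ S → a ≠ c → a ≠ d → b ≠ c → b ≠ d →
        R = {a, b, c, d} → 2 ≤ (inner p q {a, b}).card + (inner p q {c, d}).card →
        ∃ F : E → Prop, Matches p q R F := by
      intro a b c d ha hb hc hd hac had hbc hbd hR4 h2
      have h1 := h.card_inner_pair (by omega) ha hb
      have h1' := h.card_inner_pair (by omega) hc hd
      obtain ⟨f, hf⟩ : (inner p q {a, b}).Nonempty := card_pos.1 (by omega)
      obtain ⟨g, hg⟩ : (inner p q {c, d}).Nonempty := card_pos.1 (by omega)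
      exact ⟨_, hR4 ▸ (matches_empty.insert (joins_of_mem_inner_pair hg) (by simp)
        (by simp)).insert (joins_of_mem_inner_pair hf) (by simp [hac, had]) (by simp [hbc, hbd])⟩
    have hsub : inner p q R ⊆ (inner p q {a, b} ∪ inner p q {c, d}) ∪
        ((inner p q {a, c} ∪ inner p q {b, d}) ∪ (inner p q {a, d} ∪ inner p q {b, c})) := by
      intro f hf
      obtain ⟨h1, h2, h3⟩ := mem_inner.1 hf
      rw [hR4] at h2 h3
      simp only [mem_insert, mem_singleton] at h2 h3
      simp only [mem_union, mem_inner, mem_insert, mem_singleton]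
      rcases h2 with h2 | h2 | h2 | h2 <;> rcases h3 with h3 | h3 | h3 | h3 <;>
        simp only [h2, h3] at h1 ⊢ <;> first | exact absurd rfl h1 | simp [h1]
    have hle := (card_le_card hsub).trans ((card_union_le _ _).trans (add_le_add
      (card_union_le _ _) ((card_union_le _ _).trans (add_le_add (card_union_le _ _)
        (card_union_le _ _)))))
    by_cases k₁ : 2 ≤ (inner p q {a, b}).card + (inner p q {c, d}).card
    · exact key ma mb mc md hna.2.1 hna.2.2 hbc hbd hR4 k₁
    by_cases k₂ : 2 ≤ (inner p q {a, c}).card + (inner p q {b, d}).card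
    · exact key ma mc mb md hna.1 hna.2.2 hbc.symm hcd (by rw [hR4]; ext; simp; tauto) k₂
    by_cases k₃ : 2 ≤ (inner p q {a, d}).card + (inner p q {b, c}).card
    · exact key ma md mb mc hna.1 hna.2.1 hbd.symm hcd.symm (by rw [hR4]; ext; simp; tauto) k₃
    omega

lemma CubicOn.hits_of_card_le (h6 : S.card ≤ 6)
    (hN : ∀ Q ⊆ S, 2 ≤ Q.card → 2 ≤ (S \ Q).card → (cut p q Q).card ≠ 3) (hu : u ∈ S)
    (huL : ∀ e, Inc p q u e → L e = none) (hF : PMOn p q S F) : Hits p q L F := by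
  intro e i hne hi
  by_contra hc
  have hE := h.ends
  set Q := S.filter fun v => Marked p q L i v with hQd
  have hQ : Q ⊆ S := filter_subset _ _
  have huQ : u ∉ Q := by
    rintro hc
    obtain ⟨f, hf, hfi⟩ := (mem_filter.1 hc).2
    simp [huL f hf] at hfi
  have hpe : p e ∈ Q := by
    refine mem_filter.2 ⟨(hE e).1, e, ?_, hi⟩
    simp [Inc, Ne.symm hne]
  have hcut : ∀ f ∈ cut p q Q, F f := by
    intro f hf
    have hfi : L f ≠ some i := by
      intro hfi
      refine mem_cut.1 hf (iff_of_true ?_ ?_)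
      · exact mem_filter.2 ⟨(hE f).1, f, by
          have : p f ≠ q f := fun hc => mem_cut.1 hf (by rw [hc])
          simp [Inc, Ne.symm this], hfi⟩
      · exact mem_filter.2 ⟨(hE f).2, f, by
          have : p f ≠ q f := fun hc => mem_cut.1 hf (by rw [hc])
          simp [Inc, this], hfi⟩
    obtain ⟨v, hv, hfv⟩ := exists_inc_of_mem_cut hf
    obtain ⟨hvS, hvi⟩ := mem_filter.1 hv
    obtain ⟨a, b, sv⟩ := h.exists_isStar hvS hfv
    have hla : L f = none := by
      obtain ⟨g, hg, hgi⟩ := hvi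
      have := h.labels hvS sv
      rcases (sv.inc_iff g).1 hg with rfl | rfl | rfl <;> simp_all
    obtain ⟨la, lb⟩ := h.eq_some_of_marked hvS hvi sv hla
    obtain ⟨g, ⟨hg, hFg⟩, -⟩ := hF v hvS
    rcases (sv.inc_iff g).1 hg with rfl | rfl | rfl
    · exact hFg
    · exact absurd ⟨_, hg.ne, hFg, la⟩ hc
    · exact absurd ⟨_, hg.ne, hFg, lb⟩ hc
  have bound : ∀ T ⊆ S, cut p q T = cut p q Q → (cut p q Q).card ≤ T.card := by
    intro T hT hTQ
    have := sum_card_inc p q T F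
    rw [sum_congr rfl fun v hv => show _ = 1 from ?_, sum_const, hTQ,
      filter_true_of_mem hcut] at this
    · simp only [smul_eq_mul, mul_one] at this; omega
    · obtain ⟨g, hg, hg'⟩ := hF v (hT hv)
      exact card_eq_one.2 ⟨g, by ext f; simpa using ⟨hg' f, by rintro rfl; exact hg⟩⟩
  have b₁ := bound Q hQ rfl
  have b₂ := bound (S \ Q) sdiff_subset (cut_sdiff hE)
  have b₃ := h.conn Q hQ ⟨_, hpe⟩ (fun hc => huQ (hc ▸ hu))
  have hsum : (S \ Q).card + Q.card = S.card := card_sdiff_add_card_eq_card hQ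
  exact hN Q hQ (by omega) (by omega) (by omega)

omit h in
/-- In a cubic 3-edge-connected multigraph, all labels can be hit by a perfect matching through a
prescribed edge at an unlabelled vertex. -/
theorem solvableBelow (V E ι : Type*) [Fintype E] (n : ℕ) : SolvableBelow V E ι n := by
  induction n with
  | zero => intro p q S L hc; omega
  | succ n ih =>
  intro p q S L hcard h u hu huL e he
  have IH : SolvableBelow V E ι S.card := fun p q T L hT => ih p q T L (by omega)
  have hE := h.ends
  have flip : ∀ {Q}, Q ⊆ S → S \ (S \ Q) = Q := fun hQ => Finset.sdiff_sdiff_eq_self hQ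
  by_cases hN : ∀ Q ⊆ S, 2 ≤ Q.card → 2 ≤ (S \ Q).card → (cut p q Q).card ≠ 3
  swap
  · push Not at hN
    obtain ⟨Q, hQ, h2, h2', hc⟩ := hN
    by_cases huQ : u ∈ Q
    · exact h.solve_three_cut IH hQ huQ huL he h2 h2' hc
    · exact h.solve_three_cut IH sdiff_subset (mem_sdiff.2 ⟨hu, huQ⟩) huL he h2'
        (by rwa [flip hQ]) (by rwa [cut_sdiff hE])
  by_cases h4 : ∀ Q ⊆ S, 3 ≤ Q.card → 3 ≤ (S \ Q).card → (cut p q Q).card ≠ 4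
  swap
  · push Not at h4
    obtain ⟨Q, hQ, h2, h2', hc⟩ := h4
    obtain ⟨x, hx⟩ : (cut p q Q).Nonempty := card_pos.1 (by omega)
    obtain ⟨y, z, w, hyz, hyw, hzw, hyzw⟩ := card_eq_three.1
      (show ((cut p q Q).erase x).card = 3 by rw [card_erase_of_mem hx]; omega)
    have hcut : cut p q Q = {x, y, z, w} := by rw [← hyzw, insert_erase hx]
    have hnx : x ∉ ({y, z, w} : Finset E) := by rw [← hyzw]; simp
    have s : IsSide p q S Q x y z w :=
      ⟨hQ, h2, h2', by simp at hnx; simp [hnx, hyz, hyw, hzw], fun f => by rw [hcut]; simp⟩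
    by_cases huQ : u ∈ Q
    · exact s.solve h hN IH huQ huL he
    · exact (s.compl hE).solve h hN IH (mem_sdiff.2 ⟨hu, huQ⟩) huL he
  by_cases h7 : 7 ≤ S.card
  · refine h.solve_of_five_le h7 (fun Q hQ h3 h3' => ?_) IH hu huL he
    have c₁ := h.conn Q hQ (card_pos.1 (by omega)) (by rintro rfl; simp at h3')
    have c₂ := h4 Q hQ h3 h3'
    have c₃ := hN Q hQ (by omega) (by omega)
    omega
  · obtain ⟨F, hF, hFe⟩ := h.exists_matches (by omega) hu he
    exact ⟨F, hF, h.hits_of_card_le (by omega) hN hu huL hF, hFe⟩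

end Induction

section Ladder

open Finset
open scoped Classical

/-- There are cubic 3-edge-connected multigraphs with any positive even number of vertices: the
Möbius ladders. -/
lemma exists_ladder (t : ℕ) [NeZero t] :
    ∃ α β : ZMod (2 * t) ⊕ Fin t → ZMod (2 * t), (∀ l, α l ≠ β l) ∧
      CubicOn α β univ fun _ => (none : Option Empty) := by
  have ht := NeZero.pos t
  have h1 : (1 : ZMod (2 * t)) ≠ 0 := by
    have := ZMod.natCast_eq_zero_iff 1 (2 * t)
    rw [Nat.cast_one] at this
    rw [Ne, this, Nat.dvd_one]; omega
  have h2 : (t : ZMod (2 * t)) ≠ 0 := by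
    rw [Ne, ZMod.natCast_eq_zero_iff]
    exact fun h => absurd (Nat.le_of_dvd ht h) (by omega)
  have h3 : (t : ZMod (2 * t)) + t = 0 := by
    rw [← Nat.cast_add, ZMod.natCast_eq_zero_iff, two_mul]
  have hinj : ∀ a b : ℕ, a < 2 * t → b < 2 * t → (a : ZMod (2 * t)) = b → a = b := by
    intro a b ha hb hab
    rw [ZMod.natCast_eq_natCast_iff] at hab
    exact Nat.ModEq.eq_of_lt_of_lt hab ha hb
  refine ⟨Sum.elim id fun j => (j : ℕ), Sum.elim (· + 1) fun j => (j : ℕ) + t, ?_, fun _ => by simp,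
    fun b _ => ?_, fun Z _ hZ hZ' => ?_⟩
  · rintro (i | j)
    · simpa using h1
    · simpa using h2
  · obtain ⟨j, hj⟩ : ∃ j : Fin t, b = (j : ℕ) ∨ b = (j : ℕ) + t := by
      have hb := ZMod.val_lt b
      by_cases hbt : b.val < t
      · exact ⟨⟨b.val, hbt⟩, .inl (by simp)⟩
      · refine ⟨⟨b.val - t, by omega⟩, .inr ?_⟩
        rw [← Nat.cast_add, Nat.sub_add_cancel (by omega)]
        simp
    refine ⟨.inl b, .inl (b - 1), .inr j, by
      rw [Ne, Sum.inl.injEq, eq_comm, sub_eq_self]; exact h1, by simp, by simp, ?_, rfl, rfl⟩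
    rintro (i | k)
    · simp only [Inc, Sum.elim_inl, id, Sum.inl.injEq, reduceCtorEq, or_false, eq_sub_iff_add_eq]
      have : i = b → i + 1 ≠ b := by rintro rfl; simpa using h1
      tauto
    · simp only [Inc, Sum.elim_inr, reduceCtorEq, Sum.inr.injEq, false_or]
      have e1 : ((k : ℕ) : ZMod (2 * t)) = (j : ℕ) ↔ k = j :=
        ⟨fun h => Fin.ext (hinj _ _ (by omega) (by omega) h), fun h => by rw [h]⟩
      have e2 : ((k : ℕ) : ZMod (2 * t)) ≠ (j : ℕ) + t := by
        rw [← Nat.cast_add]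
        intro h
        have := hinj _ _ (by omega) (by omega) h
        omega
      have e3 : ((k : ℕ) : ZMod (2 * t)) + t ≠ (j : ℕ) := by
        rw [← Nat.cast_add]
        intro h
        have := hinj _ _ (by omega) (by omega) h
        omega
      rcases hj with rfl | rfl
      · rw [e1]; tauto
      · rw [add_left_inj, e1]; tauto
  · have step : ∀ {Y : Finset (ZMod (2 * t))}, Y.Nonempty → Y ≠ univ → ∃ i ∈ Y, i + 1 ∉ Y := by
      intro Y ⟨y, hy⟩ hY'
      by_contra hc
      push Not at hc
      have hall : ∀ n : ℕ, y + n ∈ Y := by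
        intro n
        induction n with
        | zero => simpa
        | succ n ih => rw [Nat.cast_succ, ← add_assoc]; exact hc _ ih
      refine hY' (eq_univ_of_forall fun x => ?_)
      have := hall (x - y).val
      rwa [ZMod.natCast_zmod_val, add_sub_cancel] at this
    obtain ⟨i, hi, hi'⟩ := step hZ hZ'
    obtain ⟨j, hj, hj'⟩ := step (Y := Zᶜ) (by simpa [nonempty_iff_ne_empty] using hZ')
      (by simpa using hZ.ne_empty)
    simp only [mem_compl, not_not] at hj hj'
    have hij : i ≠ j := by rintro rfl; exact hj hi
    obtain ⟨e, he, hei, hej⟩ : ∃ e, e ∈ cut (Sum.elim id fun j : Fin t => ((j : ℕ) : ZMod (2 * t)))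
        (Sum.elim (· + 1) fun j => ((j : ℕ) : ZMod (2 * t)) + t) Z ∧ e ≠ .inl i ∧ e ≠ .inl j := by
      by_cases hr : ∃ k : Fin t, ¬(((k : ℕ) : ZMod (2 * t)) ∈ Z ↔ ((k : ℕ) : ZMod (2 * t)) + t ∈ Z)
      · obtain ⟨k, hk⟩ := hr
        exact ⟨.inr k, by simpa [mem_cut] using hk, by simp, by simp⟩
      · push Not at hr
        have hr' : ∀ b : ZMod (2 * t), b ∈ Z ↔ b + t ∈ Z := by
          intro b
          have hb := ZMod.val_lt b
          by_cases hbt : b.val < t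
          · simpa using hr ⟨b.val, hbt⟩
          · have := hr ⟨b.val - t, by omega⟩
            have hbb : ((b.val - t : ℕ) : ZMod (2 * t)) + t = b := by
              rw [← Nat.cast_add, Nat.sub_add_cancel (by omega)]; simp
            simp only [hbb] at this
            have hbb' := congrArg (· + (t : ZMod (2 * t))) hbb
            simp only [add_assoc, h3, add_zero] at hbb'
            rw [← this, ← hbb']
        refine ⟨.inl (i + t), ?_, by simpa using h2, ?_⟩
        · have h4 := (hr' i).1 hi
          have h5 : i + t + 1 ∉ Z := by
            rw [add_right_comm, ← hr']; exact hi'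
          simp [mem_cut, h4, h5]
        · rintro h
          rw [Sum.inl.injEq] at h
          exact hj (h ▸ (hr' i).1 hi)
    have hsub : ({.inl i, .inl j, e} : Finset (ZMod (2 * t) ⊕ Fin t)) ⊆
        cut (Sum.elim id fun j : Fin t => ((j : ℕ) : ZMod (2 * t)))
          (Sum.elim (· + 1) fun j => ((j : ℕ) : ZMod (2 * t)) + t) Z := by
      simp only [insert_subset_iff, singleton_subset_iff]
      refine ⟨?_, ?_, he⟩ <;> simp [mem_cut, hi, hi', hj, hj']
    refine le_trans (le_of_eq ?_) (card_le_card hsub)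
    exact (card_eq_three.2 ⟨_, _, _, by simpa using hij, hei.symm, hej.symm, rfl⟩).symm

end Ladder

section Expansion

open Finset
open scoped Classical

variable {V E ι B Λ C : Type*}

/-- The vertex at which the dart `d` starts. -/
def tail (p q : E → V) (d : E × Bool) : V := cond d.2 (p d.1) (q d.1)

/-- The opposite dart. -/
def rev (d : E × Bool) : E × Bool := (d.1, !d.2)

lemma rev_ne (d : E × Bool) : rev d ≠ d := by
  rintro h; have := congrArg Prod.snd h; simp [rev] at this

lemma rev_rev (d : E × Bool) : rev (rev d) = d := by simp [rev]

lemma eq_or_eq_rev {d d' : E × Bool} (h : d.1 = d'.1) : d = d' ∨ d = rev d' := by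
  obtain ⟨g, s⟩ := d
  obtain ⟨g', s'⟩ := d'
  obtain rfl : g = g' := h
  cases s <;> cases s' <;> simp [rev]

/-- The vertices of the expanded multigraph: `B` copies inside each vertex `v`, a port for each
dart, and two hubs for each passage `c` of a labelled cycle through a vertex. -/
abbrev Node (V B E C : Type*) := (V × B) ⊕ ((E × Bool) ⊕ (C × Bool))

/-- The edges of the expanded multigraph: two halves at each port, the original edges, a stub for
each dart and a link for each passage. -/
abbrev Wire (E C : Type*) := ((E × Bool) × Bool) ⊕ (E ⊕ ((E × Bool) ⊕ C))

/-- The hub on side `s` of the passage that contains `d`, or the port of `d` if there is none. -/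
def attach (V B : Type*) (cls : E × Bool → Option C) (d : E × Bool) (s : Bool) : Node V B E C :=
  (cls d).elim (.inr (.inl d)) fun c => .inr (.inr (c, s))

/-- The first ends of the edges of the expanded multigraph. -/
def expP (p q : E → V) (α β : Λ → B) (Φ : E × Bool ≃ V × Λ) (cls : E × Bool → Option C) :
    Wire E C → Node V B E C :=
  Sum.elim (fun x => .inl (tail p q x.1, cond x.2 (α (Φ x.1).2) (β (Φ x.1).2)))
    (Sum.elim (fun g => attach V B cls (g, true) false)
      (Sum.elim (fun d => .inr (.inl d)) fun c => .inr (.inr (c, false))))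

/-- The second ends of the edges of the expanded multigraph. -/
def expQ (V B : Type*) (cls : E × Bool → Option C) : Wire E C → Node V B E C :=
  Sum.elim (fun x => .inr (.inl x.1))
    (Sum.elim (fun g => attach V B cls (g, false) false)
      (Sum.elim (fun d => attach V B cls d true) fun c => .inr (.inr (c, true))))

/-- The labels of the edges of the expanded multigraph. -/
def expL (C : Type*) (L : E → Option ι) : Wire E C → Option ι :=
  Sum.elim (fun _ => none) (Sum.elim L fun _ => none)

/-- At most two edges, with a common end. -/
def SmallStar (p q : E → V) (Y : Finset E) : Prop := Y.card ≤ 2 ∧ ∃ v, ∀ g ∈ Y, Inc p q v g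

/-- No two small stars separate the vertices. -/
def WellConnected [Fintype V] [Fintype E] (p q : E → V) : Prop :=
  ∀ (X : Finset V) (R : Finset (Finset E)), R.card ≤ 2 → (∀ Y ∈ R, SmallStar p q Y) →
    (∀ g ∈ cut p q X, ∃ Y ∈ R, g ∈ Y) → X = ∅ ∨ X = univ

/-- The data from which the expanded multigraph is built. -/
structure IsExpansion [Fintype V] [Fintype E] [Fintype B] [Fintype Λ] (p q : E → V)
    (L : E → Option ι) (α β : Λ → B) (Φ : E × Bool ≃ V × Λ) (cls : E × Bool → Option C) (cv : C → V)
    (ci : C → ι) : Prop where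
  loopless : ∀ g, p g ≠ q g
  simple : ∀ d d', tail p q d = tail p q d' → tail p q (rev d) = tail p q (rev d') → d = d'
  connected : WellConnected p q
  ladder : CubicOn α β univ fun _ => (none : Option Empty)
  ladder_ne : ∀ l, α l ≠ β l
  fst : ∀ d, (Φ d).1 = tail p q d
  cls_iff : ∀ d c, cls d = some c ↔ tail p q d = cv c ∧ L d.1 = some (ci c)
  cls_none : ∀ d, cls d = none ↔ L d.1 = none
  two : ∀ c, ∃ d d', d ≠ d' ∧ ∀ x, cls x = some c ↔ x = d ∨ x = d'

variable {p q : E → V} {L : E → Option ι} {α β : Λ → B} {Φ : E × Bool ≃ V × Λ}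
  {cls : E × Bool → Option C} {cv : C → V} {ci : C → ι}

lemma inc_tail (hl : ∀ g, p g ≠ q g) (d : E × Bool) : Inc p q (tail p q d) d.1 := by
  obtain ⟨g, s⟩ := d
  have := hl g
  cases s <;> simp [tail, Inc, this, this.symm]

lemma inc_iff_tail (hl : ∀ g, p g ≠ q g) {v : V} {g : E} :
    Inc p q v g ↔ ∃ s, tail p q (g, s) = v := by
  have := hl g
  simp only [Bool.exists_bool, tail, cond_true, cond_false, Inc]
  constructor
  · tauto
  · rintro (rfl | rfl) <;> simp [this, this.symm]

lemma attach_none {d : E × Bool} (h : cls d = none) (s : Bool) :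
    attach V B cls d s = .inr (.inl d) := by simp [attach, h]

lemma attach_some {d : E × Bool} {c : C} (h : cls d = some c) (s : Bool) :
    attach V B cls d s = .inr (.inr (c, s)) := by simp [attach, h]

lemma attach_eq_inl {d : E × Bool} {s : Bool} {x : V × B} : attach V B cls d s ≠ .inl x := by
  cases h : cls d <;> simp [attach, h]

lemma attach_eq_port {d d' : E × Bool} {s : Bool} :
    attach V B cls d s = .inr (.inl d') ↔ d = d' ∧ cls d' = none := by
  cases h : cls d
  · simp only [attach, h, Option.elim, Sum.inr.injEq, Sum.inl.injEq]
    constructor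
    · rintro rfl; exact ⟨rfl, h⟩
    · exact And.left
  · simp only [attach, h, Option.elim, Sum.inr.injEq, reduceCtorEq, false_iff, not_and]
    rintro rfl; simp [h]

lemma attach_eq_hub {d : E × Bool} {c : C} {s s' : Bool} :
    attach V B cls d s = .inr (.inr (c, s')) ↔ cls d = some c ∧ s = s' := by
  cases h : cls d <;> simp [attach, h]

section

variable (p q α β Φ cls)

/-- Incidence in the expanded multigraph. -/
def EInc (n : Node V B E C) (e : Wire E C) : Prop := Inc (expP p q α β Φ cls) (expQ V B cls) n e

end

lemma eInc_inside_half {v : V} {b : B} {d : E × Bool} {s : Bool} :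
    EInc p q α β Φ cls (.inl (v, b)) (.inl (d, s)) ↔
      tail p q d = v ∧ cond s (α (Φ d).2) (β (Φ d).2) = b := by
  simp [EInc, Inc, expP, expQ]

lemma eInc_inside_inr {x : V × B} {e : E ⊕ ((E × Bool) ⊕ C)} :
    ¬EInc p q α β Φ cls (.inl x) (.inr e) := by
  rcases e with g | d | c <;> simp [EInc, Inc, expP, expQ, attach_eq_inl]

lemma eInc_port_half {d d' : E × Bool} {s : Bool} :
    EInc p q α β Φ cls (.inr (.inl d)) (.inl (d', s)) ↔ d' = d := by
  simp [EInc, Inc, expP, expQ]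

lemma eInc_port_core {d : E × Bool} {g : E} :
    EInc p q α β Φ cls (.inr (.inl d)) (.inr (.inl g)) ↔ cls d = none ∧ g = d.1 := by
  obtain ⟨g', s⟩ := d
  cases s <;> simp [EInc, Inc, expP, expQ, attach_eq_port] <;> tauto

lemma eInc_port_stub {d d' : E × Bool} :
    EInc p q α β Φ cls (.inr (.inl d)) (.inr (.inr (.inl d'))) ↔ cls d ≠ none ∧ d' = d := by
  simp [EInc, Inc, expP, expQ, attach_eq_port]; tauto

lemma eInc_port_link {d : E × Bool} {c : C} :
    ¬EInc p q α β Φ cls (.inr (.inl d)) (.inr (.inr (.inr c))) := by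
  simp [EInc, Inc, expP, expQ]

lemma eInc_hub_half {x : C × Bool} {y : (E × Bool) × Bool} :
    ¬EInc p q α β Φ cls (.inr (.inr x)) (.inl y) := by
  simp [EInc, Inc, expP, expQ]

lemma eInc_near_core {c : C} {g : E} : EInc p q α β Φ cls (.inr (.inr (c, false))) (.inr (.inl g)) ↔
    ¬(cls (g, true) = some c ↔ cls (g, false) = some c) := by
  simp [EInc, Inc, expP, expQ, attach_eq_hub]

lemma eInc_near_stub {c : C} {d : E × Bool} :
    ¬EInc p q α β Φ cls (.inr (.inr (c, false))) (.inr (.inr (.inl d))) := by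
  simp [EInc, Inc, expP, expQ, attach_eq_hub]

lemma eInc_hub_link {c c' : C} {s : Bool} :
    EInc p q α β Φ cls (.inr (.inr (c, s))) (.inr (.inr (.inr c'))) ↔ c' = c := by
  cases s <;> simp [EInc, Inc, expP, expQ]

lemma eInc_far_core {c : C} {g : E} :
    ¬EInc p q α β Φ cls (.inr (.inr (c, true))) (.inr (.inl g)) := by
  simp [EInc, Inc, expP, expQ, attach_eq_hub]

lemma eInc_far_stub {c : C} {d : E × Bool} :
    EInc p q α β Φ cls (.inr (.inr (c, true))) (.inr (.inr (.inl d))) ↔ cls d = some c := by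
  simp [EInc, Inc, expP, expQ, attach_eq_hub]

variable [Fintype V] [Fintype E] [Fintype B] [Fintype Λ]

namespace IsExpansion

variable (k : IsExpansion p q L α β Φ cls cv ci)

include k

lemma tail_rev_ne (d : E × Bool) : tail p q (rev d) ≠ tail p q d := by
  obtain ⟨g, s⟩ := d
  have := k.loopless g
  cases s <;> simp [tail, rev, this, this.symm]

lemma cls_rev_ne {d : E × Bool} {c : C} (h : cls d = some c) : cls (rev d) ≠ some c := by
  intro h'
  exact k.tail_rev_ne d (((k.cls_iff _ _).1 h').1.trans ((k.cls_iff _ _).1 h).1.symm)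

lemma cls_rev_none {d : E × Bool} (h : cls d = none) : cls (rev d) = none :=
  (k.cls_none _).2 ((k.cls_none d).1 h)

lemma exists_cls_rev {d : E × Bool} {c : C} (h : cls d = some c) :
    ∃ c', c' ≠ c ∧ cls (rev d) = some c' := by
  have : cls (rev d) ≠ none := fun h' => by
    have := k.cls_rev_none h'
    rw [rev_rev, h] at this
    cases this
  obtain ⟨c', hc'⟩ := Option.ne_none_iff_exists'.1 this
  exact ⟨c', by rintro rfl; exact k.cls_rev_ne h hc', hc'⟩

lemma eInc_near_core {c : C} {g : E} :
    EInc p q α β Φ cls (.inr (.inr (c, false))) (.inr (.inl g)) ↔ ∃ s, cls (g, s) = some c := by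
  rw [PaperFormalization.eInc_near_core, Bool.exists_bool]
  have := fun h : cls (g, true) = some c => k.cls_rev_ne h
  simp only [rev, Bool.not_true] at this
  tauto

lemma star (n : Node V B E C) : ∃ a b c, a ≠ b ∧ a ≠ c ∧ b ≠ c ∧
    (∀ e, EInc p q α β Φ cls n e ↔ e = a ∨ e = b ∨ e = c) ∧
    expL C L a = expL C L b ∧ expL C L c = none := by
  rcases n with ⟨v, b⟩ | d | ⟨c, s⟩
  · obtain ⟨l₁, l₂, l₃, h1, h2, h3, hs, -⟩ := k.ladder.star b (mem_univ _)
    have key : ∀ e, EInc p q α β Φ cls (.inl (v, b)) e ↔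
        ∃ l, Inc α β b l ∧ e = .inl (Φ.symm (v, l), decide (α l = b)) := by
      rintro (⟨d, s⟩ | e)
      · rw [eInc_inside_half]
        constructor
        · rintro ⟨rfl, h⟩
          have hd : Φ.symm (tail p q d, (Φ d).2) = d := by rw [← k.fst, Prod.mk.eta, Φ.symm_apply_apply]
          have hne := k.ladder_ne (Φ d).2
          refine ⟨(Φ d).2, ?_, ?_⟩
          · cases s <;> simp only [cond_true, cond_false] at h <;> simp [Inc, ← h, hne, hne.symm]
          · rw [hd]
            cases s <;> simp only [cond_true, cond_false] at h <;> simp [← h, hne]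
        · rintro ⟨l, hl, he⟩
          simp only [Sum.inl.injEq, Prod.mk.injEq] at he
          obtain ⟨rfl, rfl⟩ := he
          rw [← k.fst, Φ.apply_symm_apply]
          refine ⟨rfl, ?_⟩
          by_cases h : α l = b
          · simp [h]
          · simp only [h, decide_false, cond_false]
            by_contra h'
            exact hl (iff_of_false h h')
      · simp [eInc_inside_inr]
    have inj : ∀ {l l'}, l ≠ l' → (Sum.inl (Φ.symm (v, l), decide (α l = b)) : Wire E C) ≠
        .inl (Φ.symm (v, l'), decide (α l' = b)) := by
      intro l l' hl he
      simp only [Sum.inl.injEq, Prod.mk.injEq] at he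
      have := Φ.symm.injective he.1
      simp only [Prod.mk.injEq, true_and] at this
      exact hl this
    refine ⟨_, _, _, inj h1, inj h2, inj h3, fun e => ?_, rfl, rfl⟩
    rw [key]
    simp [hs]
  · cases hd : cls d with
    | none =>
      refine ⟨.inl (d, true), .inl (d, false), .inr (.inl d.1), by simp, by simp, by simp, ?_, rfl,
        (k.cls_none d).1 hd⟩
      rintro (⟨d', s⟩ | g | d' | c)
      · rw [eInc_port_half]; cases s <;> simp
      · rw [eInc_port_core]; simp [hd]
      · rw [eInc_port_stub]; simp [hd]
      · simp [eInc_port_link]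
    | some c =>
      refine ⟨.inl (d, true), .inl (d, false), .inr (.inr (.inl d)), by simp, by simp, by simp, ?_,
        rfl, rfl⟩
      rintro (⟨d', s⟩ | g | d' | c)
      · rw [eInc_port_half]; cases s <;> simp
      · rw [eInc_port_core]; simp [hd]
      · rw [eInc_port_stub]; simp [hd]
      · simp [eInc_port_link]
  · obtain ⟨d, d', hne, hdd⟩ := k.two c
    have h1 := (hdd d).2 (.inl rfl)
    have h2 := (hdd d').2 (.inr rfl)
    have hg : d.1 ≠ d'.1 := by
      intro h
      rcases eq_or_eq_rev h with h | h
      · exact hne h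
      · exact k.cls_rev_ne h2 (h ▸ h1)
    cases s
    · refine ⟨.inr (.inl d.1), .inr (.inl d'.1), .inr (.inr (.inr c)), by simpa using hg, by simp,
        by simp, ?_, ((k.cls_iff _ _).1 h1).2.trans ((k.cls_iff _ _).1 h2).2.symm, rfl⟩
      rintro (y | g | x | c')
      · simp [eInc_hub_half]
      · rw [k.eInc_near_core]
        simp only [hdd, Sum.inr.injEq, Sum.inl.injEq, reduceCtorEq, or_false]
        constructor
        · rintro ⟨s, rfl | rfl⟩ <;> simp
        · rintro (rfl | rfl)
          exacts [⟨d.2, .inl rfl⟩, ⟨d'.2, .inr rfl⟩]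
      · simp [eInc_near_stub]
      · rw [eInc_hub_link]; simp
    · refine ⟨.inr (.inr (.inl d)), .inr (.inr (.inl d')), .inr (.inr (.inr c)), by simpa using hne,
        by simp, by simp, ?_, rfl, rfl⟩
      rintro (y | g | x | c')
      · simp [eInc_hub_half]
      · simp [eInc_far_core]
      · rw [eInc_far_stub, hdd]; simp
      · rw [eInc_hub_link]; simp

end IsExpansion
end Expansion

section ExpansionConn

open Finset
open scoped Classical

variable {V E ι B Λ C : Type*}

section

variable (p q : E → V) (α β : Λ → B) (Φ : E × Bool ≃ V × Λ) (cls : E × Bool → Option C)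

/-- The ends of `e` get different colours. -/
def Cross (z : Node V B E C → Prop) (e : Wire E C) : Prop :=
  ¬(z (expP p q α β Φ cls e) ↔ z (expQ V B cls e))

/-- The original edges that a wire can be responsible for. -/
noncomputable def cover [Fintype E] : Wire E C → Finset E :=
  Sum.elim (fun x => {x.1.1}) (Sum.elim (fun g => {g}) (Sum.elim (fun d => {d.1})
    fun c => univ.filter fun g => ∃ s, cls (g, s) = some c))

end

variable {p q : E → V} {L : E → Option ι} {α β : Λ → B} {Φ : E × Bool ≃ V × Λ}
  {cls : E × Bool → Option C} {cv : C → V} {ci : C → ι} {z : Node V B E C → Prop}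

lemma half_of_not_cross {d : E × Bool} {s : Bool} (h : ¬Cross p q α β Φ cls z (.inl (d, s))) :
    z (.inl (tail p q d, cond s (α (Φ d).2) (β (Φ d).2))) ↔ z (.inr (.inl d)) := by
  simpa [Cross, expP, expQ] using h

lemma core_of_not_cross {d : E × Bool} (h : ¬Cross p q α β Φ cls z (.inr (.inl d.1))) :
    z (attach V B cls d false) ↔ z (attach V B cls (rev d) false) := by
  obtain ⟨g, s⟩ := d
  simp only [Cross, expP, expQ, Sum.elim_inr, Sum.elim_inl, not_not] at h
  cases s
  · exact h.symm
  · exact h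

lemma stub_of_not_cross {d : E × Bool} (h : ¬Cross p q α β Φ cls z (.inr (.inr (.inl d)))) :
    z (.inr (.inl d)) ↔ z (attach V B cls d true) := by
  simpa [Cross, expP, expQ] using h

lemma link_of_not_cross {c : C} (h : ¬Cross p q α β Φ cls z (.inr (.inr (.inr c)))) :
    z (.inr (.inr (c, false))) ↔ z (.inr (.inr (c, true))) := by
  simpa [Cross, expP, expQ] using h

variable [Fintype V] [Fintype E] [Fintype B] [Fintype Λ]

namespace IsExpansion

variable (k : IsExpansion p q L α β Φ cls cv ci)

include k

lemma smallStar_cover (e : Wire E C) : SmallStar p q (cover cls e) := by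
  have one : ∀ g, SmallStar p q {g} := fun g => by
    refine ⟨by simp, p g, fun g' hg' => ?_⟩
    rw [mem_singleton.1 hg']
    simpa [Inc] using (k.loopless g).symm
  rcases e with x | g | d | c
  · exact one _
  · exact one _
  · exact one _
  · obtain ⟨d, d', -, hdd⟩ := k.two c
    constructor
    · refine (card_le_card (t := {d.1, d'.1}) fun g hg => ?_).trans card_le_two
      simp only [cover, Sum.elim_inr, mem_filter, mem_univ, true_and, hdd] at hg
      obtain ⟨s, rfl | rfl⟩ := hg <;> simp
    · refine ⟨cv c, fun g hg => ?_⟩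
      simp only [cover, Sum.elim_inr, mem_filter, mem_univ, true_and] at hg
      obtain ⟨s, hs⟩ := hg
      exact (inc_iff_tail k.loopless).2 ⟨s, ((k.cls_iff _ _).1 hs).1⟩

omit k [Fintype V] [Fintype B] [Fintype Λ] in
lemma attach_of_not_cross {x : V → Prop} (hx : ∀ v b, z (.inl (v, b)) ↔ x v) (d : E × Bool)
    (hn : ∀ e, Cross p q α β Φ cls z e → d.1 ∉ cover cls e) :
    x (tail p q d) ↔ z (attach V B cls d false) := by
  have h1 := half_of_not_cross (p := p) (q := q) (α := α) (β := β) (Φ := Φ) (cls := cls) (z := z)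
    (d := d) (s := true) fun h => hn _ h (by simp [cover])
  rw [hx] at h1
  rw [h1]
  cases hd : cls d with
  | none => rw [attach_none hd]
  | some c =>
    have h2 := stub_of_not_cross (p := p) (q := q) (α := α) (β := β) (Φ := Φ) (cls := cls) (z := z)
      (d := d) fun h => hn _ h (by simp [cover])
    have h3 := link_of_not_cross (p := p) (q := q) (α := α) (β := β) (Φ := Φ) (cls := cls) (z := z)
      (c := c) fun h => hn _ h (by
        simp only [cover, Sum.elim_inr, mem_filter, mem_univ, true_and]; exact ⟨d.2, hd⟩)
    rw [h2, attach_some hd, attach_some hd, h3]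

section

variable (few : ∀ a b c, a ≠ b → a ≠ c → b ≠ c → Cross p q α β Φ cls z a → Cross p q α β Φ cls z b →
    ¬Cross p q α β Φ cls z c)

include few

lemma inside_const (v : V) (b b' : B) : z (.inl (v, b)) ↔ z (.inl (v, b')) := by
  by_contra hc
  have h3 : 3 ≤ (cut α β (univ.filter fun b => z (.inl (v, b)))).card := by
    refine k.ladder.conn _ (subset_univ _) ?_ ?_
    · by_contra he
      simp only [not_nonempty_iff_eq_empty, filter_eq_empty_iff, mem_univ, true_imp_iff] at he
      exact hc (iff_of_false (@he b) (@he b'))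
    · intro he
      simp only [filter_eq_self, mem_univ, true_imp_iff] at he
      exact hc (iff_of_true (he _) (he _))
  obtain ⟨l₁, h1, l₂, h2, l₃, h3, n12, n13, n23⟩ := two_lt_card.1 h3
  have key : ∀ l ∈ cut α β (univ.filter fun b => z (.inl (v, b))),
      ∃ s, Cross p q α β Φ cls z (.inl (Φ.symm (v, l), s)) := by
    intro l hl
    simp only [mem_cut, mem_filter, mem_univ, true_and] at hl
    by_contra hn
    push Not at hn
    have e1 := half_of_not_cross (hn true)
    have e2 := half_of_not_cross (hn false)
    rw [← k.fst, Φ.apply_symm_apply] at e1 e2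
    exact hl (e1.trans e2.symm)
  obtain ⟨s₁, c1⟩ := key _ h1
  obtain ⟨s₂, c2⟩ := key _ h2
  obtain ⟨s₃, c3⟩ := key _ h3
  exact few _ _ _ (by simp [n12]) (by simp [n13]) (by simp [n23]) c1 c2 c3

lemma exists_inside [Fintype C] : ∃ κ : Prop, ∀ v b, z (.inl (v, b)) ↔ κ := by
  have hx : ∀ v b, z (.inl (v, b)) ↔ ∃ b', z (.inl (v, b')) := fun v b =>
    ⟨fun h => ⟨b, h⟩, fun ⟨b', h⟩ => (k.inside_const few v b b').2 h⟩
  have h := k.connected (univ.filter fun v => ∃ b', z (.inl (v, b')))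
    ((univ.filter (Cross p q α β Φ cls z)).image (cover cls))
    (by
      refine card_image_le.trans (not_lt.1 fun h => ?_)
      obtain ⟨a, ha, b, hb, c, hc, hab, hac, hbc⟩ := two_lt_card.1 h
      simp only [mem_filter, mem_univ, true_and] at ha hb hc
      exact few a b c hab hac hbc ha hb hc)
    (by
      simp only [mem_image, forall_exists_index, and_imp]
      rintro _ e - rfl
      exact k.smallStar_cover e)
    (by
      intro g hg
      by_contra hn
      simp only [mem_image, mem_filter, mem_univ, true_and, exists_exists_and_eq_and, not_exists,
        not_and] at hn
      have h1 := attach_of_not_cross hx (g, true) hn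
      have h2 := attach_of_not_cross hx (g, false) hn
      have h3 := core_of_not_cross (p := p) (q := q) (α := α) (β := β) (Φ := Φ) (cls := cls) (z := z)
        (d := (g, true)) fun h => hn _ h (by simp [cover])
      simp only [mem_cut, mem_filter, mem_univ, true_and] at hg
      exact hg (h1.trans (h3.trans h2.symm)))
  rcases h with h | h
  · refine ⟨False, fun v b => ?_⟩
    simp only [filter_eq_empty_iff, mem_univ, true_imp_iff] at h
    rw [hx]; simpa using h (x := v)
  · refine ⟨True, fun v b => ?_⟩
    simp only [filter_eq_self, mem_univ, true_imp_iff] at h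
    rw [hx]; simpa using h v

lemma const [Fintype C] : ∃ κ : Prop, ∀ n, z n ↔ κ := by
  obtain ⟨κ, hκ⟩ := k.exists_inside few
  have few' : ∀ {a b}, a ≠ b → Cross p q α β Φ cls z a → Cross p q α β Φ cls z b → ∀ {c},
      a ≠ c → b ≠ c → ¬Cross p q α β Φ cls z c := fun hab ha hb _ hac hbc =>
    few _ _ _ hab hac hbc ha hb
  have port : ∀ d, z (.inr (.inl d)) ↔ κ := by
    intro d
    by_contra hd
    have hs : ∀ s, Cross p q α β Φ cls z (.inl (d, s)) := fun s => by
      by_contra hc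
      exact hd ((half_of_not_cross hc).symm.trans (hκ _ _))
    have no := @few' (.inl (d, true)) (.inl (d, false)) (by simp) (hs _) (hs _)
    have other : ∀ d' ≠ d, z (.inr (.inl d')) ↔ κ := fun d' hd' => by
      have := half_of_not_cross (@no (.inl (d', true)) (by simp [hd'.symm]) (by simp))
      rw [← this, hκ]
    cases hl : cls d with
    | none =>
      have := core_of_not_cross (@no (.inr (.inl d.1)) (by simp) (by simp))
      rw [attach_none hl, attach_none (k.cls_rev_none hl)] at this
      exact hd (this.trans (other _ (rev_ne d)))
    | some c =>
      obtain ⟨d', hd', hl'⟩ : ∃ d' ≠ d, cls d' = some c := by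
        obtain ⟨d₁, d₂, hne, h12⟩ := k.two c
        rcases (h12 d).1 hl with rfl | rfl
        · exact ⟨d₂, hne.symm, (h12 _).2 (.inr rfl)⟩
        · exact ⟨d₁, hne, (h12 _).2 (.inl rfl)⟩
      have e1 := stub_of_not_cross (@no (.inr (.inr (.inl d))) (by simp) (by simp))
      have e2 := stub_of_not_cross (@no (.inr (.inr (.inl d'))) (by simp) (by simp))
      rw [attach_some hl] at e1
      rw [attach_some hl', other d' hd'] at e2
      exact hd (e1.trans e2.symm)
  have far : ∀ c, z (.inr (.inr (c, true))) ↔ κ := by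
    intro c
    by_contra hc
    obtain ⟨d, d', hne, hdd⟩ := k.two c
    have h1 := (hdd d).2 (.inl rfl)
    have h2 := (hdd d').2 (.inr rfl)
    have hs : ∀ x, cls x = some c → Cross p q α β Φ cls z (.inr (.inr (.inl x))) := fun x hx => by
      by_contra hn
      have := stub_of_not_cross hn
      rw [attach_some hx, port] at this
      exact hc this.symm
    have no := @few' (.inr (.inr (.inl d))) (.inr (.inr (.inl d'))) (by simpa using hne)
      (hs _ h1) (hs _ h2)
    obtain ⟨c₂, hc₂, h3⟩ := k.exists_cls_rev h1
    have e1 := link_of_not_cross (@no (.inr (.inr (.inr c))) (by simp) (by simp))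
    have e2 := core_of_not_cross (@no (.inr (.inl d.1)) (by simp) (by simp))
    have e3 := link_of_not_cross (@no (.inr (.inr (.inr c₂))) (by simp) (by simp))
    have e4 := stub_of_not_cross (@no (.inr (.inr (.inl (rev d))))
      (by simpa using (rev_ne d).symm) (by
        simp only [ne_eq, Sum.inr.injEq, Sum.inl.injEq]
        rintro rfl; rw [h2] at h3; exact hc₂ (Option.some.inj h3).symm))
    rw [attach_some h1, attach_some h3] at e2
    rw [attach_some h3, port] at e4
    exact hc (e1.symm.trans (e2.trans (e3.trans e4.symm)))
  have near : ∀ c, z (.inr (.inr (c, false))) ↔ κ := by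
    intro c
    by_contra hc
    obtain ⟨d, d', hne, hdd⟩ := k.two c
    have h1 := (hdd d).2 (.inl rfl)
    have h2 := (hdd d').2 (.inr rfl)
    have hg : d.1 ≠ d'.1 := by
      intro h
      rcases eq_or_eq_rev h with h | h
      · exact hne h
      · exact k.cls_rev_ne h2 (h ▸ h1)
    have hlink : Cross p q α β Φ cls z (.inr (.inr (.inr c))) := by
      by_contra hn
      exact hc ((link_of_not_cross hn).trans (far c))
    have key : ∀ x, cls x = some c → ∃ c₂, c₂ ≠ c ∧ cls (rev x) = some c₂ ∧
        (Cross p q α β Φ cls z (.inr (.inl x.1)) ∨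
          Cross p q α β Φ cls z (.inr (.inr (.inr c₂)))) := by
      intro x hx
      obtain ⟨c₂, hc₂, h3⟩ := k.exists_cls_rev hx
      refine ⟨c₂, hc₂, h3, ?_⟩
      by_contra hn
      push Not at hn
      have e1 := core_of_not_cross hn.1
      rw [attach_some hx, attach_some h3] at e1
      exact hc (e1.trans ((link_of_not_cross hn.2).trans (far c₂)))
    obtain ⟨c₁, hc₁, hr₁, hx₁⟩ := key d h1
    obtain ⟨c₂, hc₂, hr₂, hx₂⟩ := key d' h2
    have h12 : c₁ ≠ c₂ := by
      rintro rfl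
      exact hne (k.simple _ _
        (((k.cls_iff _ _).1 h1).1.trans ((k.cls_iff _ _).1 h2).1.symm)
        (((k.cls_iff _ _).1 hr₁).1.trans ((k.cls_iff _ _).1 hr₂).1.symm))
    rcases hx₁ with hx₁ | hx₁ <;> rcases hx₂ with hx₂ | hx₂
    · exact few _ _ _ (by simpa using hg) (by simp) (by simp) hx₁ hx₂ hlink
    · exact few _ _ _ (by simp) (by simp) (by simpa using hc₂) hx₁ hx₂ hlink
    · exact few _ _ _ (by simp) (by simpa using hc₁) (by simp) hx₁ hx₂ hlink
    · exact few _ _ _ (by simpa using h12) (by simpa using hc₁) (by simpa using hc₂) hx₁ hx₂ hlink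
  refine ⟨κ, ?_⟩
  rintro (⟨v, b⟩ | d | ⟨c, s⟩)
  · exact hκ v b
  · exact port d
  · cases s
    exacts [near c, far c]

end

lemma cubicOn [Fintype C] :
    CubicOn (expP p q α β Φ cls) (expQ V B cls) univ (expL C L) where
  ends _ := by simp
  star n _ := k.star n
  conn Z _ hZ hZ' := by
    by_contra hlt
    obtain ⟨κ, hκ⟩ := k.const (z := (· ∈ Z)) fun a b c hab hac hbc ha hb hc => hlt
      (two_lt_card.2 ⟨a, mem_cut.2 ha, b, mem_cut.2 hb, c, mem_cut.2 hc, hab, hac, hbc⟩)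
    obtain ⟨n, hn⟩ := hZ
    exact hZ' (eq_univ_of_forall fun n' => (hκ n').2 ((hκ n).1 hn))

end IsExpansion
end ExpansionConn

section ExpansionCount

open Finset
open scoped Classical

variable {V E ι B Λ C : Type*} [Fintype V] [Fintype E] [Fintype B] [Fintype Λ]
  {p q : E → V} {L : E → Option ι} {α β : Λ → B} {Φ : E × Bool ≃ V × Λ}
  {cls : E × Bool → Option C} {cv : C → V} {ci : C → ι}

namespace IsExpansion

variable (k : IsExpansion p q L α β Φ cls cv ci)

include k

lemma card_darts (v : V) : (univ.filter fun d => tail p q d = v).card = Fintype.card Λ := by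
  have : (univ.filter fun d => tail p q d = v) = ({v} ×ˢ (univ : Finset Λ)).map Φ.symm.toEmbedding := by
    ext d
    simp only [mem_filter, mem_univ, true_and, mem_map_equiv, Equiv.symm_symm, mem_product,
      mem_singleton, and_true, k.fst]
  rw [this, card_map, card_product, card_singleton, one_mul, card_univ]

lemma card_core [Fintype C] {F : Wire E C → Prop}
    (hF : PMOn (expP p q α β Φ cls) (expQ V B cls) univ F) (v : V) :
    (univ.filter fun g => Inc p q v g ∧ F (.inr (.inl g))).card + Fintype.card B =
      Fintype.card Λ := by
  set K : Finset C := univ.filter fun c => cv c = v with hK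
  set M : Finset (Node V B E C) := disjSum ({v} ×ˢ univ) (disjSum ∅ (K ×ˢ {true})) with hM
  set P : Finset (Node V B E C) := disjSum ∅ (disjSum (univ.filter fun d => tail p q d = v)
    (K ×ˢ {false})) with hP
  have hMc : M.card = Fintype.card B + K.card := by
    simp [hM, card_disjSum]
  have hPc : P.card = Fintype.card Λ + K.card := by
    simp [hP, card_disjSum, k.card_darts]
  have hMi : ∀ x, (.inl x : Node V B E C) ∈ M ↔ x.1 = v := by simp [hM, eq_comm]
  have hMp : ∀ d, (.inr (.inl d) : Node V B E C) ∉ M := by simp [hM]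
  have hMh : ∀ c s, (.inr (.inr (c, s)) : Node V B E C) ∈ M ↔ cv c = v ∧ s = true := by
    simp [hM, hK]
  have hPi : ∀ x, (.inl x : Node V B E C) ∉ P := by simp [hP]
  have hPp : ∀ d, (.inr (.inl d) : Node V B E C) ∈ P ↔ tail p q d = v := by simp [hP]
  have hPh : ∀ c s, (.inr (.inr (c, s)) : Node V B E C) ∈ P ↔ cv c = v ∧ s = false := by
    simp [hP, hK]
  have hMa : ∀ d s, attach V B cls d s ∈ M ↔ cls d ≠ none ∧ s = true ∧ tail p q d = v := by
    intro d s
    cases h : cls d with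
    | none => simp [attach_none h, hMp]
    | some c => simp [attach_some h, hMh, ((k.cls_iff _ _).1 h).1, and_comm]
  have hPa : ∀ d s, attach V B cls d s ∈ P ↔ (cls d = none ∨ s = false) ∧ tail p q d = v := by
    intro d s
    cases h : cls d with
    | none => simp [attach_none h, hPp]
    | some c => simp [attach_some h, hPh, ((k.cls_iff _ _).1 h).1, and_comm]
  have sum : ∀ Z : Finset (Node V B E C),
      inner (expP p q α β Φ cls) (expQ V B cls) Z = ∅ →
      Z.card = ((cut (expP p q α β Φ cls) (expQ V B cls) Z).filter F).card := by
    intro Z hZ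
    have := sum_card_inc (expP p q α β Φ cls) (expQ V B cls) Z F
    rw [hZ, filter_empty, card_empty, mul_zero, add_zero] at this
    rw [← this, card_eq_sum_ones]
    refine sum_congr rfl fun n _ => ?_
    obtain ⟨e, he, hu⟩ := hF n (mem_univ _)
    exact (card_eq_one.2 ⟨e, by ext e'; simpa using ⟨hu e', by rintro rfl; exact he⟩⟩).symm
  have hMin : inner (expP p q α β Φ cls) (expQ V B cls) M = ∅ := by
    refine eq_empty_of_forall_notMem fun e he => ?_
    rw [mem_inner] at he
    rcases e with ⟨d, s⟩ | g | d | c <;>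
      simp [expP, expQ, hMp, hMa, hMh] at he
  have hPin : inner (expP p q α β Φ cls) (expQ V B cls) P = ∅ := by
    refine eq_empty_of_forall_notMem fun e he => ?_
    rw [mem_inner] at he
    rcases e with ⟨d, s⟩ | g | d | c <;>
      simp only [expP, expQ, hPp, hPa, hPh, hPi, Sum.elim_inr, Sum.elim_inl] at he
    · simp at he
    · have := k.tail_rev_ne (g, true)
      simp only [rev, Bool.not_true] at this
      exact this (he.2.2.2.trans he.2.1.2.symm)
    · rcases he.2.2.1 with h | h
      · exact he.1 (attach_none h true).symm
      · cases h
    · simp at he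
  have hcut : (cut (expP p q α β Φ cls) (expQ V B cls) P).filter F =
      ((cut (expP p q α β Φ cls) (expQ V B cls) M).filter F).disjUnion
        ((univ.filter fun g => Inc p q v g ∧ F (.inr (.inl g))).map
          (Function.Embedding.inl.trans Function.Embedding.inr)) (by
        rw [Finset.disjoint_left]
        intro e he he'
        simp only [mem_map, Function.Embedding.trans_apply, Function.Embedding.inl_apply,
          Function.Embedding.inr_apply] at he'
        obtain ⟨g, -, rfl⟩ := he'
        simp [mem_cut, expP, expQ, hMa] at he) := by
    ext e
    simp only [mem_filter, mem_cut, disjUnion_eq_union, mem_union, mem_map, mem_univ, true_and,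
      Function.Embedding.trans_apply, Function.Embedding.inl_apply, Function.Embedding.inr_apply]
    rcases e with ⟨d, s⟩ | g | d | c
    · simp [expP, expQ, hMi, hMp, hPi, hPp]
    · simp [expP, expQ, hMa, hPa, tail, Inc]
    · simp [expP, expQ, hMa, hPa, hMp, hPp]
      tauto
    · simp [expP, expQ, hMh, hPh]
  have h1 := sum M hMin
  have h2 := sum P hPin
  rw [hcut, card_disjUnion, card_map, ← h1] at h2
  omega

lemma exists_factor [Fintype C] [Nonempty V] [Nonempty B] : ∃ F : E → Prop,
    (∀ v, (univ.filter fun g => Inc p q v g ∧ F g).card + Fintype.card B = Fintype.card Λ) ∧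
    (∀ v g g', Inc p q v g → Inc p q v g' → F g → F g' → L g ≠ none → L g = L g' → g = g') ∧
    ∀ g i, L g = some i → ∃ g', F g' ∧ L g' = some i := by
  obtain ⟨v₀⟩ := ‹Nonempty V›
  obtain ⟨b₀⟩ := ‹Nonempty B›
  obtain ⟨e, _, _, _, _, _, he, -⟩ := k.star (.inl (v₀, b₀))
  obtain ⟨F, hF, hH, -⟩ := solvableBelow (Node V B E C) (Wire E C) ι _ _ _ _ _
    (Nat.lt_succ_self _) k.cubicOn (.inl (v₀, b₀)) (mem_univ _) (by
      rintro (x | e) h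
      · rfl
      · exact absurd h eInc_inside_inr) e ((he e).2 (.inl rfl))
  have lab : ∀ {g i s}, L g = some i → ∃ c, cls (g, s) = some c := by
    intro g i s hi
    rw [← Option.ne_none_iff_exists', Ne, k.cls_none, hi]
    simp
  refine ⟨fun g => F (.inr (.inl g)), k.card_core hF, ?_, ?_⟩
  · intro v g g' hg hg' hFg hFg' hn hL
    obtain ⟨i, hi⟩ := Option.ne_none_iff_exists'.1 hn
    obtain ⟨s, rfl⟩ := (inc_iff_tail k.loopless).1 hg
    obtain ⟨s', hs'⟩ := (inc_iff_tail k.loopless).1 hg'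
    obtain ⟨c, hc⟩ := lab (s := s) hi
    have h2 := (k.cls_iff _ _).1 hc
    have hc' : cls (g', s') = some c := (k.cls_iff _ _).2 ⟨hs'.trans h2.1, hL ▸ h2.2⟩
    have := (hF (.inr (.inr (c, false))) (mem_univ _)).unique
      ⟨k.eInc_near_core.2 ⟨s, hc⟩, hFg⟩ ⟨k.eInc_near_core.2 ⟨s', hc'⟩, hFg'⟩
    simpa using this
  · intro g i hi
    obtain ⟨c, hc⟩ := lab (s := true) hi
    obtain ⟨f, -, hf, hfi⟩ := hH (.inr (.inl g)) i
      (Inc.ne (k.eInc_near_core.2 ⟨true, hc⟩)) hi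
    rcases f with x | g' | d | c
    · simp [expL] at hfi
    · exact ⟨g', hf, hfi⟩
    · simp [expL] at hfi
    · simp [expL] at hfi

end IsExpansion

/-- The factor theorem for well-connected graphs with suitable edge labels. -/
theorem exists_factor_of_wellConnected [Nonempty V] {t : ℕ} (ht : 1 ≤ t)
    (hl : ∀ g, p g ≠ q g)
    (hs : ∀ d d', tail p q d = tail p q d' → tail p q (rev d) = tail p q (rev d') → d = d')
    (hd : ∀ v, (univ.filter fun g => Inc p q v g).card = 3 * t)
    (hL : ∀ d i, L d.1 = some i → ∃ d', d ≠ d' ∧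
      ∀ x, tail p q x = tail p q d ∧ L x.1 = some i ↔ x = d ∨ x = d')
    (hw : WellConnected p q) : ∃ F : E → Prop,
    (∀ v, (univ.filter fun g => Inc p q v g ∧ F g).card = t) ∧
    (∀ v g g', Inc p q v g → Inc p q v g' → F g → F g' → L g ≠ none → L g = L g' → g = g') ∧
    ∀ g i, L g = some i → ∃ g', F g' ∧ L g' = some i := by
  have : NeZero t := ⟨by omega⟩
  obtain ⟨α, β, hne, hcub⟩ := exists_ladder t
  let C := {x : V × ι // ∃ d, tail p q d = x.1 ∧ L d.1 = some x.2}
  have hC : Function.Injective fun c : C => c.2.choose := by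
    intro c c' h
    have h1 := c.2.choose_spec
    have h2 := c'.2.choose_spec
    rw [← show c.2.choose = c'.2.choose from h] at h2
    refine Subtype.ext (Prod.ext (h1.1.symm.trans h2.1) (Option.some.inj (h1.2.symm.trans h2.2)))
  have := Finite.of_injective _ hC
  have := Fintype.ofFinite C
  have hcls : ∀ d, ∃ o : Option C, (∀ c, o = some c ↔ tail p q d = c.1.1 ∧ L d.1 = some c.1.2) ∧
      (o = none ↔ L d.1 = none) := by
    intro d
    cases h : L d.1 with
    | none => exact ⟨none, by simp⟩
    | some i =>
      refine ⟨some ⟨(tail p q d, i), d, rfl, h⟩, fun c => ?_, by simp⟩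
      rw [Option.some.injEq, Option.some.injEq, Subtype.ext_iff, Prod.ext_iff]
  choose cls hcls using hcls
  have hdart : ∀ v, Fintype.card {d : E × Bool // tail p q d = v} =
      Fintype.card (ZMod (2 * t) ⊕ Fin t) := by
    intro v
    rw [Fintype.card_subtype, Fintype.card_sum, ZMod.card, Fintype.card_fin,
      show 2 * t + t = 3 * t by ring, ← hd v]
    refine card_bij (fun d _ => d.1) (fun d h => ?_) (fun d h d' h' he => ?_) fun g hg => ?_
    · simp only [mem_filter, mem_univ, true_and] at h ⊢
      rw [← h]; exact inc_tail hl d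
    · simp only [mem_filter, mem_univ, true_and] at h h'
      rcases eq_or_eq_rev he with rfl | rfl
      · rfl
      · obtain ⟨g, s⟩ := d'
        have := hl g
        cases s <;> simp [tail, rev] at h h'
        · exact absurd (h.trans h'.symm) this
        · exact absurd (h'.trans h.symm) this
    · simp only [mem_filter, mem_univ, true_and] at hg
      obtain ⟨s, hs⟩ := (inc_iff_tail hl).1 hg
      exact ⟨(g, s), by simpa using hs, rfl⟩
  let Φ : E × Bool ≃ V × (ZMod (2 * t) ⊕ Fin t) := (Equiv.sigmaFiberEquiv (tail p q)).symm.trans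
    ((Equiv.sigmaCongrRight fun v => Fintype.equivOfCardEq (hdart v)).trans (Equiv.sigmaEquivProd _ _))
  have k : IsExpansion p q L α β Φ cls (fun c : C => c.1.1) (fun c => c.1.2) :=
    { loopless := hl
      simple := hs
      connected := hw
      ladder := hcub
      ladder_ne := hne
      fst := fun d => rfl
      cls_iff := fun d => (hcls d).1
      cls_none := fun d => (hcls d).2
      two := fun c => by
        obtain ⟨⟨v, i⟩, d, hv, hdi⟩ := c
        obtain rfl : tail p q d = v := hv
        obtain ⟨d', hdd', hx⟩ := hL d i hdi
        exact ⟨d, d', hdd', fun x => ((hcls x).1 _).trans (hx x)⟩ }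
  obtain ⟨F, h1, h2, h3⟩ := k.exists_factor
  refine ⟨F, fun v => ?_, h2, h3⟩
  have := h1 v
  simp only [Fintype.card_sum, ZMod.card, Fintype.card_fin] at this
  omega

end ExpansionCount

section Graph

open Finset
open scoped Classical

variable {V ι : Type*} {G : SimpleGraph V} {p q : G.edgeSet → V}

section

variable (hpq : ∀ e : G.edgeSet, (e : Sym2 V) = s(p e, q e))

include hpq

lemma ends_ne (e : G.edgeSet) : p e ≠ q e := by
  have := e.2
  rw [hpq e, mem_edgeSet] at this
  exact this.ne

lemma inc_iff_mem {v : V} {e : G.edgeSet} : Inc p q v e ↔ v ∈ (e : Sym2 V) := by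
  have := ends_ne hpq e
  rw [hpq e, Sym2.mem_iff, Inc]
  constructor
  · tauto
  · rintro (rfl | rfl) <;> simp [this, this.symm]

lemma eq_mk_tail (d : G.edgeSet × Bool) : (d.1 : Sym2 V) = s(tail p q d, tail p q (rev d)) := by
  obtain ⟨e, s⟩ := d
  cases s
  · simp [tail, rev, hpq e, Sym2.eq_swap]
  · simp [tail, rev, hpq e]

lemma tail_rev_ne (d : G.edgeSet × Bool) : tail p q (rev d) ≠ tail p q d := by
  obtain ⟨g, s⟩ := d
  have := ends_ne hpq g
  cases s <;> simp [tail, rev, this, this.symm]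

lemma dart_ext {d d' : G.edgeSet × Bool} (h : d.1 = d'.1) (ht : tail p q d = tail p q d') :
    d = d' := by
  rcases eq_or_eq_rev h with h | rfl
  · exact h
  · exact absurd ht (tail_rev_ne hpq d')

variable [Fintype V]

lemma card_inc (v : V) (P : G.edgeSet → Prop) :
    (univ.filter fun e => Inc p q v e ∧ P e).card =
      {w | ∃ h : G.Adj v w, P ⟨s(v, w), h⟩}.ncard := by
  rw [Set.ncard_eq_toFinset_card']
  refine (card_bij (fun w hw => ⟨s(v, w), (by simpa using hw : ∃ h : G.Adj v w, P ⟨s(v, w), h⟩).1⟩)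
    (fun w hw => ?_) (fun w hw w' hw' h => ?_) fun e he => ?_).symm
  · simp only [Set.mem_toFinset, Set.mem_ofPred_eq] at hw
    simp only [mem_filter, mem_univ, true_and, inc_iff_mem hpq]
    exact ⟨Sym2.mem_mk_left _ _, hw.2⟩
  · exact Sym2.congr_right.1 (congrArg Subtype.val h)
  · simp only [mem_filter, mem_univ, true_and, inc_iff_mem hpq] at he
    obtain ⟨⟨w, hw⟩, hP⟩ := he
    obtain ⟨e, hG⟩ := e
    obtain rfl : e = s(v, w) := hw
    exact ⟨w, by simpa using ⟨hG, hP⟩, rfl⟩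

variable {t : ℕ} (hd : ∀ v, (univ.filter fun e => Inc p q v e).card = 3 * t)

include hd

lemma le_card_cut (_ : 1 ≤ t) {X : Finset V} (h1 : X.Nonempty) (h2 : X.card ≤ 2) :
    3 * t ≤ (cut p q X).card := by
  have hsum := sum_card_inc p q X fun _ => True
  simp only [and_true, filter_true, hd, sum_const, smul_eq_mul] at hsum
  have h0 := h1.card_pos
  have hin : (inner p q X).card + 1 ≤ X.card := by
    obtain h | h : X.card = 1 ∨ X.card = 2 := by omega
    · obtain ⟨x, rfl⟩ := card_eq_one.1 h
      have : inner p q {x} = ∅ := by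
        refine eq_empty_of_forall_notMem fun e he => ?_
        rw [mem_inner, mem_singleton, mem_singleton] at he
        exact he.1 (he.2.1.trans he.2.2.symm)
      simp [this]
    · obtain ⟨x, y, -, rfl⟩ := card_eq_two.1 h
      have : (inner p q {x, y}).card ≤ 1 := by
        have key : ∀ e ∈ inner p q {x, y}, (e : Sym2 V) = s(x, y) := by
          intro e he
          simp only [mem_inner, mem_insert, mem_singleton] at he
          rw [hpq e]
          rcases he with ⟨hne, h | h, h' | h'⟩ <;> simp_all
        refine card_le_one.2 fun e he f hf => Subtype.ext ((key e he).trans (key f hf).symm)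
      omega
  obtain h | h : X.card = 1 ∨ X.card = 2 := by omega
  · rw [h] at hsum hin; omega
  · rw [h] at hsum hin; omega

lemma eq_empty_or_univ_of_cover (hconn : KConnected 3 G) (ht : 1 ≤ t) {m : ℕ} (hm : 2 * m < 3 * t)
    {X : Finset V} {R : Finset (Finset G.edgeSet)} (hR : R.card ≤ 2)
    (hs : ∀ Y ∈ R, Y.card ≤ m ∧ ∃ v, ∀ g ∈ Y, Inc p q v g)
    (hc : ∀ g ∈ cut p q X, ∃ Y ∈ R, g ∈ Y) : X = ∅ ∨ X = univ := by
  have hcut : (cut p q X).card ≤ 2 * m := by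
    have : cut p q X ⊆ R.biUnion id := fun g hg => by simpa using hc g hg
    exact (card_le_card this).trans ((card_biUnion_le_card_mul _ _ m fun Y hY => (hs Y hY).1).trans
      (Nat.mul_le_mul_right _ hR))
  have : Nonempty V := Fintype.card_pos_iff.1 (by have := hconn.1; omega)
  have hs' : ∀ Y, ∃ v, Y ∈ R → ∀ g ∈ Y, Inc p q v g := fun Y => by
    by_cases hY : Y ∈ R
    · obtain ⟨v, hv⟩ := (hs Y hY).2; exact ⟨v, fun _ => hv⟩
    · exact ⟨Classical.arbitrary V, fun h => absurd h hY⟩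
  choose f hf using hs'
  have hSc : (R.image f).card ≤ 2 := card_image_le.trans hR
  have hcon := hconn.2 (R.image f : Finset V) (by rw [Set.ncard_coe_finset]; omega)
  have hsep : X ⊆ R.image f ∨ Xᶜ ⊆ R.image f := by
    by_contra hn
    push Not at hn
    obtain ⟨⟨a, ha, haS⟩, b, hb, hbS⟩ := And.intro (not_subset.1 hn.1) (not_subset.1 hn.2)
    obtain ⟨W⟩ := hcon.preconnected ⟨a, by simpa using haS⟩ ⟨b, by simpa using hbS⟩
    obtain ⟨d, -, hd1, hd2⟩ := W.exists_boundary_dart {x | (x : V) ∈ X} ha (by simpa using hb)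
    have hadj : s((d.fst : V), (d.snd : V)) ∈ G.edgeSet := d.adj
    obtain ⟨Y, hY, hg⟩ := hc ⟨s((d.fst : V), (d.snd : V)), hadj⟩ (by
      rw [mem_cut]
      have := hpq ⟨s((d.fst : V), (d.snd : V)), hadj⟩
      simp only [Set.mem_ofPred_eq] at hd1 hd2
      rcases Sym2.eq_iff.1 this with ⟨h1, h2⟩ | ⟨h1, h2⟩
      · rw [← h1, ← h2]; tauto
      · rw [← h1, ← h2]; tauto)
    have := (inc_iff_mem hpq).1 (hf Y hY _ hg)
    rcases Sym2.mem_iff.1 this with h | h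
    · exact d.fst.2 (by rw [← h]; simpa using ⟨Y, hY, rfl⟩)
    · exact d.snd.2 (by rw [← h]; simpa using ⟨Y, hY, rfl⟩)
  by_contra hn
  push Not at hn
  rcases hsep with h | h
  · have := le_card_cut hpq hd ht hn.1 ((card_le_card h).trans hSc)
    omega
  · have := le_card_cut hpq hd ht (X := Xᶜ)
      (nonempty_iff_ne_empty.2 (by simpa using hn.2)) ((card_le_card h).trans hSc)
    have h' : cut p q Xᶜ = cut p q X := by
      ext e; simp only [mem_cut, mem_compl]; tauto
    rw [h'] at this
    omega

lemma wellConnected (hconn : KConnected 3 G) (ht : 2 ≤ t) : WellConnected p q :=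
  fun _ _ hR hs hc => eq_empty_or_univ_of_cover hpq hd hconn (by omega) (m := 2) (by omega) hR hs hc

variable {L : G.edgeSet → Option ι}
  (hL : ∀ v i, (∃ e, Inc p q v e ∧ L e = some i) →
    (univ.filter fun e => Inc p q v e ∧ L e = some i).card = 2)

include hL

lemma cubicOn_of_three (hconn : KConnected 3 G) (ht : t = 1) : CubicOn p q univ L where
  ends _ := by simp
  star v _ := by
    obtain ⟨a, b, c, h1, h2, h3, hs, hl⟩ := exists_star_of_even
      (C := univ.filter fun e => Inc p q v e) (L := L) (by rw [hd, ht]) (fun i => by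
        rw [filter_filter]
        by_cases h : ∃ e, Inc p q v e ∧ L e = some i
        · rw [hL v i h]; exact even_two
        · push Not at h
          rw [filter_eq_empty_iff.2 fun e _ h' => h e h'.1 h'.2]; simp)
    exact ⟨a, b, c, h1, h2, h3, by simpa using hs, hl⟩
  conn Z _ hZ hZ' := by
    by_contra hlt
    rcases eq_empty_or_univ_of_cover hpq hd hconn ht.ge (m := 1) (by omega) (X := Z)
      (R := (cut p q Z).image singleton) (card_image_le.trans (by omega))
      (fun Y hY => by
        obtain ⟨g, -, rfl⟩ := mem_image.1 hY
        refine ⟨by simp, p g, fun g' hg' => ?_⟩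
        rw [mem_singleton.1 hg', inc_iff_mem hpq, hpq g]
        exact Sym2.mem_mk_left _ _)
      (fun g hg => ⟨{g}, mem_image_of_mem _ hg, mem_singleton_self g⟩) with h | h
    · exact hZ.ne_empty h
    · exact hZ' h

lemma exists_factor_edges (hconn : KConnected 3 G) (ht : 1 ≤ t) : ∃ F : G.edgeSet → Prop,
    (∀ v, (univ.filter fun g => Inc p q v g ∧ F g).card = t) ∧
    (∀ v g g', Inc p q v g → Inc p q v g' → F g → F g' → L g ≠ none → L g = L g' → g = g') ∧
    ∀ g i, L g = some i → ∃ g', F g' ∧ L g' = some i := by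
  have : Nonempty V := Fintype.card_pos_iff.1 (by have := hconn.1; omega)
  obtain rfl | ht2 : t = 1 ∨ 2 ≤ t := by omega
  · have hcub := cubicOn_of_three hpq hd hL hconn rfl
    obtain ⟨F, hF, hH⟩ : ∃ F, PMOn p q univ F ∧ Hits p q L F := by
      by_cases hu : ∃ u, ∀ e, Inc p q u e → L e = none
      · obtain ⟨u, hu⟩ := hu
        obtain ⟨e, _, _, _, _, _, he, -⟩ := hcub.star u (mem_univ _)
        obtain ⟨F, hF, hH, -⟩ := solvableBelow V G.edgeSet ι _ p q univ L (Nat.lt_succ_self _) hcub u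
          (mem_univ _) hu e ((he e).2 (.inl rfl))
        exact ⟨F, hF, hH⟩
      · push Not at hu
        obtain ⟨u⟩ := ‹Nonempty V›
        obtain ⟨e, he, hle⟩ := hu u
        obtain ⟨i, hi⟩ := Option.ne_none_iff_exists'.1 hle
        obtain ⟨a, b, c, -, -, -, hs, hab, hc⟩ := hcub.star u (mem_univ _)
        have hall : ∀ f, Inc p q u f → L f = some i ∨ L f = none := by
          have hai : L a = some i := by
            rcases (hs e).1 he with rfl | rfl | rfl
            · exact hi
            · exact hab.trans hi
            · exact absurd hc hle
          intro f hf
          rcases (hs f).1 hf with rfl | rfl | rfl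
          · exact .inl hai
          · exact .inl (hab.symm.trans hai)
          · exact .inr hc
        obtain ⟨F, hF, hH, hFe⟩ := solvableBelow V G.edgeSet ι _ p q univ _ (Nat.lt_succ_self _)
          (hcub.mapLabels (fun o => if o = some i then none else o) (by simp)) u (mem_univ _)
          (fun f hf => by rcases hall f hf with h | h <;> simp [h]) e he
        refine ⟨F, hF, fun f j hf hj => ?_⟩
        by_cases hji : j = i
        · subst hji; exact ⟨e, he.ne, hFe, hi⟩
        · obtain ⟨f', h1, h2, h3⟩ := hH f j hf (by simp [hj, hji])
          refine ⟨f', h1, h2, ?_⟩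
          beta_reduce at h3
          split_ifs at h3 with h
          exact h3
    refine ⟨F, fun v => ?_, fun v g g' hg hg' hFg hFg' _ _ =>
      (hF v (mem_univ _)).unique ⟨hg, hFg⟩ ⟨hg', hFg'⟩, fun g i hi => ?_⟩
    · obtain ⟨e, he, hu⟩ := hF v (mem_univ _)
      exact card_eq_one.2 ⟨e, by ext e'; simpa using ⟨hu e', by rintro rfl; exact he⟩⟩
    · obtain ⟨f, -, hf⟩ := hH g i (ends_ne hpq g) hi
      exact ⟨f, hf⟩
  · refine exists_factor_of_wellConnected ht (ends_ne hpq) (fun d d' h h' => ?_) hd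
      (fun d i hi => ?_) (wellConnected hpq hd hconn ht2)
    · exact dart_ext hpq (Subtype.ext (by rw [eq_mk_tail hpq d, eq_mk_tail hpq d', h, h'])) h
    · have hinc := inc_tail (ends_ne hpq) d
      obtain ⟨e', he', hne⟩ := exists_mem_ne (by rw [hL (tail p q d) i ⟨d.1, hinc, hi⟩]; omega) d.1
      have h2 := hL (tail p q d) i ⟨d.1, hinc, hi⟩
      simp only [mem_filter, mem_univ, true_and] at he'
      obtain ⟨s', hs'⟩ := (inc_iff_tail (ends_ne hpq)).1 he'.1
      have heq : (univ.filter fun e => Inc p q (tail p q d) e ∧ L e = some i) = {d.1, e'} := by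
        refine (eq_of_subset_of_card_le ?_ ?_).symm
        · simp only [insert_subset_iff, singleton_subset_iff, mem_filter, mem_univ, true_and]
          exact ⟨⟨hinc, hi⟩, he'⟩
        · rw [h2, card_pair hne.symm]
      refine ⟨(e', s'), by rintro rfl; exact hne rfl, fun x => ⟨fun ⟨hx, hxi⟩ => ?_, ?_⟩⟩
      · have : x.1 ∈ (univ.filter fun e => Inc p q (tail p q d) e ∧ L e = some i) := by
          simp only [mem_filter, mem_univ, true_and]
          exact ⟨hx ▸ inc_tail (ends_ne hpq) x, hxi⟩
        rw [heq, mem_insert, mem_singleton] at this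
        rcases this with h | h
        · exact .inl (dart_ext hpq h hx)
        · exact .inr (dart_ext hpq h (hx.trans hs'.symm))
      · rintro (rfl | rfl)
        · exact ⟨rfl, hi⟩
        · exact ⟨hs', he'.2⟩

end

/-- A 3-connected `3 * t`-regular graph has a `t`-factor that meets every cycle of an
edge-disjoint family in a nonempty matching. -/
theorem exists_isTFactor {V : Type*} [Fintype V] (t : ℕ) (ht : 1 ≤ t) (G : SimpleGraph V)
    (hconn : KConnected 3 G) (hreg : IsRegular G (3 * t))
    (𝒪 : Set G.Subgraph) (hcyc : ∀ O ∈ 𝒪, IsCycleSG O ∧ 3 ≤ O.edgeSet.ncard)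
    (hdisj : PairwiseEdgeDisjoint 𝒪) :
    ∃ F : G.Subgraph, IsTFactor F t ∧
      ∀ O ∈ 𝒪, (F.edgeSet ∩ O.edgeSet).Nonempty ∧
        IsMatchingSet (F.edgeSet ∩ O.edgeSet) := by
  have hpq : ∀ e : G.edgeSet, ∃ x : V × V, (e : Sym2 V) = s(x.1, x.2) := fun ⟨e, _⟩ => by
    induction e with | _ a b => exact ⟨(a, b), rfl⟩
  choose x hpq using hpq
  have hL : ∀ e : G.edgeSet, ∃ o : Option G.Subgraph,
      ∀ O, o = some O ↔ O ∈ 𝒪 ∧ (e : Sym2 V) ∈ O.edgeSet := by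
    intro e
    by_cases h : ∃ O ∈ 𝒪, (e : Sym2 V) ∈ O.edgeSet
    · obtain ⟨O, hO, he⟩ := h
      refine ⟨some O, fun O' => ⟨?_, fun ⟨hO', he'⟩ => ?_⟩⟩
      · rintro ⟨⟩; exact ⟨hO, he⟩
      · by_contra hne
        exact Set.disjoint_left.1 (hdisj hO hO' fun h => hne (congrArg some h)) he he'
    · push Not at h
      exact ⟨none, fun O => ⟨by simp, fun ⟨hO, he⟩ => absurd he (h O hO)⟩⟩
  choose L hL using hL
  obtain ⟨F, h1, h2, h3⟩ := exists_factor_edges (p := fun e => (x e).1) (q := fun e => (x e).2)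
    hpq (t := t) (L := L) (fun v => by
      have := card_inc (p := fun e => (x e).1) (q := fun e => (x e).2) hpq v fun _ => True
      simp only [and_true, exists_prop] at this
      rw [this]; exact hreg v)
    (fun v O ⟨e, he, hO⟩ => by
      refine Eq.trans (by congr) ((card_inc (p := fun e => (x e).1) (q := fun e => (x e).2) hpq v
        fun e => L e = some O).trans ?_)
      have hv := (inc_iff_mem hpq).1 he
      obtain ⟨hO, he⟩ := (hL e O).1 hO
      rw [← (hcyc O hO).1.2 v (O.mem_verts_of_mem_edge he hv), sdeg]
      congr 1
      ext w
      simp only [hL, Set.mem_ofPred_eq, Subgraph.mem_edgeSet, Subgraph.mem_neighborSet]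
      exact ⟨fun h => h.2.2, fun h => ⟨h.adj_sub, hO, h⟩⟩) hconn ht
  let H : G.Subgraph :=
    { verts := Set.univ
      Adj := fun v w => ∃ h : G.Adj v w, F ⟨s(v, w), h⟩
      adj_sub := fun h => h.1
      edge_vert := fun _ => Set.mem_univ _
      symm := ⟨fun v w ⟨h, hF⟩ => ⟨h.symm, by simpa only [Sym2.eq_swap (a := w)] using hF⟩⟩ }
  have hH : ∀ e, e ∈ H.edgeSet ↔ ∃ h : e ∈ G.edgeSet, F ⟨e, h⟩ := fun e => by
    induction e with | _ a b => rfl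
  refine ⟨H, ⟨fun v => Set.mem_univ v, fun v => (card_inc (p := fun e => (x e).1) (q := fun e => (x e).2) hpq v
    F).symm.trans (h1 v)⟩, fun O hO => ⟨?_, ?_⟩⟩
  · obtain ⟨e, he⟩ := Set.nonempty_of_ncard_ne_zero (s := O.edgeSet) (by have := (hcyc O hO).2; omega)
    obtain ⟨g, hg, hgO⟩ := h3 ⟨e, O.edgeSet_subset he⟩ O ((hL _ _).2 ⟨hO, he⟩)
    exact ⟨g, (hH _).2 ⟨g.2, hg⟩, ((hL _ _).1 hgO).2⟩
  · rintro e ⟨heF, heO⟩ f ⟨hfF, hfO⟩ hne v hve hvf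
    obtain ⟨he, heF⟩ := (hH e).1 heF
    obtain ⟨hf, hfF⟩ := (hH f).1 hfF
    have l1 := (hL ⟨e, he⟩ O).2 ⟨hO, heO⟩
    have l2 := (hL ⟨f, hf⟩ O).2 ⟨hO, hfO⟩
    exact hne (congrArg Subtype.val (h2 v _ _ ((inc_iff_mem hpq).2 hve) ((inc_iff_mem hpq).2 hvf)
      heF hfF (by simp [l1]) (l1.trans l2.symm)))

end Graph

/-- In a 3-connected 3t-regular graph, for any set of pairwise edge-disjoint cycles of
length at least 3 there is a `t`-factor whose intersection with each cycle of the set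
is a non-empty matching. -/
theorem stmt_10 {V : Type*} [Fintype V] (t : ℕ) (ht : 1 ≤ t) (G : SimpleGraph V)
    (hconn : KConnected 3 G) (hreg : IsRegular G (3 * t))
    (𝒪 : Set G.Subgraph) (hcyc : ∀ O ∈ 𝒪, IsCycleSG O ∧ 3 ≤ O.edgeSet.ncard)
    (hdisj : PairwiseEdgeDisjoint 𝒪) :
    ∃ F : G.Subgraph, IsTFactor F t ∧
      ∀ O ∈ 𝒪, (F.edgeSet ∩ O.edgeSet).Nonempty ∧
        IsMatchingSet (F.edgeSet ∩ O.edgeSet) :=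
  exists_isTFactor t ht G hconn hreg 𝒪 hcyc hdisj

end PaperFormalization
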